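/- arXiv:2206.12752 — 2 statements merged into one kernel-verified Lean document; each statement's English description precedes it below -/
import Mathlib

section
/- Let B_1 be the unit ball in ℝ^N centered at the origin, N ≥ 4 even, and α > 0. If 16(N+2)/(N−2)² + 2 < p < (2N+2α)/(N−2), then the positive classical K_+ ground state solution u of the Hénon equation −Δu = |x|^α u^{p−1} in B_1, u = 0 on ∂B_1, is nonradial. -/
open MeasureTheory Real Set Filter

noncomputable section

abbrev Euc (N : ℕ) := EuclideanSpace ℝ (Fin N)

variable {N : ℕ}

/-- The Euclidean Laplacian. -/
def lap (u : Euc N → ℝ) (x : Euc N) : ℝ :=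
  ∑ i : Fin N,
    iteratedFDeriv ℝ 2 u x ![EuclideanSpace.single i 1, EuclideanSpace.single i 1]

/-- `s = (x₁² + ⋯ + xₙ²)^{1/2}`. -/
def sVar (n : ℕ) (x : Euc N) : ℝ :=
  Real.sqrt (∑ j : Fin N, if (j : ℕ) < n then x j ^ 2 else 0)

/-- `t = (x_{n+1}² + ⋯ + x_N²)^{1/2}`. -/
def tVar (n : ℕ) (x : Euc N) : ℝ :=
  Real.sqrt (∑ j : Fin N, if n ≤ (j : ℕ) then x j ^ 2 else 0)

/-- Pragmatic membership in `H¹₀(Ω)` (continuous representative). -/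
def MemH10 (Ω : Set (Euc N)) (u : Euc N → ℝ) : Prop :=
  Continuous u ∧ (∀ x ∈ Ω, DifferentiableAt ℝ u x) ∧ (∀ x ∉ Ω, u x = 0) ∧
    IntegrableOn (fun x => ‖gradient u x‖ ^ 2) Ω volume ∧
    IntegrableOn (fun x => u x ^ 2) Ω volume

/-- `(s,t)` lies in the cross-section of `Ω`. -/
def inCross (n : ℕ) (Ω : Set (Euc N)) (s t : ℝ) : Prop :=
  ∃ x ∈ Ω, sVar n x = s ∧ tVar n x = t

/-- The convex cone `K₊`: nonnegative `G`-invariant functions in `H¹₀(Ω)`,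
even across `θ = π/4` and nondecreasing in `θ` on `Ω̃₀` (i.e. for `0 < θ < π/4`). -/
def Kplus (n : ℕ) (Ω : Set (Euc N)) : Set (Euc N → ℝ) :=
  { u | MemH10 Ω u ∧ (∀ x, 0 ≤ u x) ∧
      ∃ w : ℝ → ℝ → ℝ,
        (∀ x, u x = w (sVar n x) (tVar n x)) ∧
        (∀ s t, w s t = w t s) ∧
        (∀ r θ₁ θ₂ : ℝ, 0 < θ₁ → θ₁ ≤ θ₂ → θ₂ < π / 4 →
          inCross n Ω (r * Real.cos θ₁) (r * Real.sin θ₁) →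
          inCross n Ω (r * Real.cos θ₂) (r * Real.sin θ₂) →
          w (r * Real.cos θ₁) (r * Real.sin θ₁) ≤ w (r * Real.cos θ₂) (r * Real.sin θ₂)) }

/-- The energy functional `E(u) = (1/2)∫_Ω |∇u|² − (1/p)∫_Ω a|u|^p`. -/
def energy (Ω : Set (Euc N)) (a : Euc N → ℝ) (p : ℝ) (u : Euc N → ℝ) : ℝ :=
  (1 / 2) * (∫ x in Ω, ‖gradient u x‖ ^ 2) - (1 / p) * (∫ x in Ω, a x * |u x| ^ p)

/-- The norm of the space `V = H¹₀(Ω) ∩ L^p_a(Ω)`. -/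
def vnorm (Ω : Set (Euc N)) (a : Euc N → ℝ) (p : ℝ) (u : Euc N → ℝ) : ℝ :=
  (∫ x in Ω, (‖gradient u x‖ ^ 2 + u x ^ 2)) ^ (1 / 2 : ℝ) +
    (∫ x in Ω, a x * |u x| ^ p) ^ (1 / p)

/-- The mountain pass level of the energy restricted to `K`. -/
def mountainPassLevel (Ω : Set (Euc N)) (a : Euc N → ℝ) (p : ℝ)
    (K : Set (Euc N → ℝ)) : ℝ :=
  sInf { c : ℝ | ∃ γ : ℝ → Euc N → ℝ,
    (∀ t ∈ Icc (0 : ℝ) 1, γ t ∈ K) ∧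
    (∀ t ∈ Icc (0 : ℝ) 1, ∀ ε > (0 : ℝ), ∃ δ > (0 : ℝ), ∀ s ∈ Icc (0 : ℝ) 1,
      |s - t| < δ → vnorm Ω a p (γ s - γ t) < ε) ∧
    γ 0 = 0 ∧ γ 1 ≠ 0 ∧ energy Ω a p (γ 1) ≤ 0 ∧
    c = sSup ((fun t => energy Ω a p (γ t)) '' Icc (0 : ℝ) 1) }

/-- `u` is a `K` ground state: a mountain-pass critical point of the energy restricted
to `K`, at the (positive) mountain-pass level. -/
def IsGroundState (Ω : Set (Euc N)) (a : Euc N → ℝ) (p : ℝ)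
    (K : Set (Euc N → ℝ)) (u : Euc N → ℝ) : Prop :=
  u ∈ K ∧ 0 < energy Ω a p u ∧ energy Ω a p u = mountainPassLevel Ω a p K

/-- A radial function. -/
def IsRadial {N : ℕ} (u : Euc N → ℝ) : Prop :=
  ∃ f : ℝ → ℝ, ∀ x, u x = f ‖x‖

open scoped Topology
open Metric

def qf (n : ℕ) (x : Euc N) : ℝ := ∑ j : Fin N, (if (j : ℕ) < n then (1:ℝ) else -1) * x j ^ 2

def Xf (n : ℕ) (x : Euc N) : ℝ := qf n x / ‖x‖ ^ 2

lemma qf_smul (n : ℕ) (c : ℝ) (x : Euc N) : qf n (c • x) = c ^ 2 * qf n x := by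
  simp only [qf, Finset.mul_sum]
  refine Finset.sum_congr rfl fun j _ => ?_
  rw [PiLp.smul_apply, smul_eq_mul]; ring

lemma qf_continuous (n : ℕ) : Continuous (qf n : Euc N → ℝ) := by
  unfold qf; fun_prop

lemma abs_qf_le (n : ℕ) (x : Euc N) : |qf n x| ≤ ‖x‖ ^ 2 := by
  rw [EuclideanSpace.norm_sq_eq]
  refine (Finset.abs_sum_le_sum_abs _ _).trans (Finset.sum_le_sum fun j _ => ?_)
  split_ifs <;> simp

lemma abs_Xf_le (n : ℕ) (x : Euc N) : |Xf n x| ≤ 1 := by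
  unfold Xf
  rw [abs_div, abs_of_nonneg (by positivity : 0 ≤ ‖x‖^2)]
  exact div_le_one_of_le₀ (abs_qf_le n x) (by positivity)

lemma qf_eq (n : ℕ) (x : Euc N) : qf n x = ‖x‖ ^ 2 * Xf n x := by
  unfold Xf
  by_cases h : x = 0
  · subst h; simp [qf]
  · have : ‖x‖ ≠ 0 := norm_ne_zero_iff.2 h
    field_simp

def sphI (N n : ℕ) (k : ℝ → ℝ) : ℝ :=
  ∫ ω : sphere (0 : Euc N) 1, k (qf n (ω : Euc N)) ∂(volume : Measure (Euc N)).toSphere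

lemma Xf_eq (n : ℕ) (x : Euc N) : Xf n x = qf n (‖x‖⁻¹ • x) := by
  rw [qf_smul, Xf]; field_simp

lemma polar_int (n : ℕ) (F k : ℝ → ℝ) (hN : N ≠ 0) :
    ∫ x : Euc N in ball 0 1, F ‖x‖ * k (Xf n x) =
      sphI N n k * ∫ r in Ioo (0:ℝ) 1, r ^ (N - 1) * F r := by
  have : Nonempty (Fin N) := ⟨⟨0, by omega⟩⟩
  have : Nontrivial (Euc N) := inferInstance
  have hd : Module.finrank ℝ (Euc N) = N := by simp
  set G : ℝ → ℝ := (Iio (1:ℝ)).indicator F with hG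
  calc ∫ x : Euc N in ball 0 1, F ‖x‖ * k (Xf n x)
      = ∫ x : Euc N, G ‖x‖ * k (Xf n x) := by
        rw [← integral_indicator measurableSet_ball]
        refine integral_congr_ae (.of_forall fun x => ?_)
        by_cases h : ‖x‖ < 1 <;> simp [indicator, hG, h]
    _ = ∫ x : ({(0)}ᶜ : Set (Euc N)), G ‖x.1‖ * k (Xf n x.1) ∂((volume : Measure (Euc N)).comap (↑)) := by
      rw [integral_subtype_comap (measurableSet_singleton _).compl fun x : Euc N ↦ G ‖x‖ * k (Xf n x),
        restrict_compl_singleton]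
    _ = ∫ x, k (qf n (x.1 : Euc N)) * G x.2 ∂(volume : Measure (Euc N)).toSphere.prod (.volumeIoiPow (Module.finrank ℝ (Euc N) - 1)) := by
      have := (volume : Measure (Euc N)).measurePreserving_homeomorphUnitSphereProd.integral_comp
        (Homeomorph.measurableEmbedding _) (fun x => k (qf n (x.1 : Euc N)) * G x.2)
      rw [← this]
      refine integral_congr_ae (.of_forall fun x => ?_)
      simp [Xf_eq, mul_comm]
    _ = sphI N n k * ∫ x : Ioi (0 : ℝ), G x ∂.volumeIoiPow (Module.finrank ℝ (Euc N) - 1) :=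
      integral_prod_mul (fun ω : sphere (0 : Euc N) 1 => k (qf n (ω : Euc N))) (fun r : Ioi (0:ℝ) => G r)
    _ = _ := by
      congr 1
      simp only [Measure.volumeIoiPow, ENNReal.ofReal]
      rw [integral_withDensity_eq_integral_smul,
        integral_subtype_comap measurableSet_Ioi fun a ↦ Real.toNNReal (a ^ (Module.finrank ℝ (Euc N) - 1)) • G a, hd,
        ← integral_indicator measurableSet_Ioi, ← integral_indicator measurableSet_Ioo]
      · refine integral_congr_ae (.of_forall fun r => ?_)
        by_cases h0 : 0 < r
        · by_cases h1 : r < 1 <;> simp [indicator, hG, h0, h1, NNReal.smul_def, h0.le]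
        · simp [indicator, h0]
      · exact (measurable_subtype_coe.pow_const _).real_toNNReal

lemma polar_integrable (n : ℕ) (F k : ℝ → ℝ) (hN : N ≠ 0) (hk : Continuous k)
    (hF : IntegrableOn (fun r => r ^ (N - 1) * F r) (Ioo (0:ℝ) 1)) :
    IntegrableOn (fun x : Euc N => F ‖x‖ * k (Xf n x)) (ball 0 1) := by
  have : Nonempty (Fin N) := ⟨⟨0, by omega⟩⟩
  have : Nontrivial (Euc N) := inferInstance
  have hd : Module.finrank ℝ (Euc N) = N := by simp
  have h1 : IntegrableOn (fun x : Euc N => F ‖x‖) (ball 0 1) := by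
    rw [integrableOn_fun_norm_addHaar, hd]; simpa using hF
  obtain ⟨C, hC⟩ := (isCompact_Icc (a := (-1:ℝ)) (b := 1)).exists_bound_of_continuousOn hk.continuousOn
  refine Integrable.mul_bdd (c := C) h1 ?_ ?_
  · have : Measurable (Xf n : Euc N → ℝ) := by
      unfold Xf; exact (qf_continuous n).measurable.div (by fun_prop)
    exact (hk.measurable.comp this).aestronglyMeasurable
  · exact .of_forall fun x => hC _ (abs_le.1 (abs_Xf_le n x))

lemma sphI_int (n : ℕ) (k : ℝ → ℝ) (hk : Continuous k) :
    Integrable (fun ω : sphere (0 : Euc N) 1 => k (qf n (ω : Euc N)))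
      (volume : Measure (Euc N)).toSphere := by
  have : Continuous (fun ω : sphere (0 : Euc N) 1 => k (qf n (ω : Euc N))) :=
    hk.comp ((qf_continuous n).comp continuous_subtype_val)
  exact this.integrable_of_hasCompactSupport (HasCompactSupport.of_compactSpace _)

lemma sphI_add (n : ℕ) (k l : ℝ → ℝ) (hk : Continuous k) (hl : Continuous l) :
    sphI N n (fun X => k X + l X) = sphI N n k + sphI N n l :=
  integral_add (sphI_int n k hk) (sphI_int n l hl)

lemma sphI_smul (n : ℕ) (c : ℝ) (k : ℝ → ℝ) :
    sphI N n (fun X => c * k X) = c * sphI N n k := integral_const_mul _ _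

lemma sphI_one_pos (n : ℕ) (hN : N ≠ 0) : 0 < sphI N n (fun _ => 1) := by
  have : Nonempty (Fin N) := ⟨⟨0, by omega⟩⟩
  have : Nontrivial (Euc N) := inferInstance
  unfold sphI
  simp only [integral_const, smul_eq_mul, mul_one]
  rw [Measure.toSphere_real_apply_univ]
  have : 0 < (volume : Measure (Euc N)).real (ball 0 1) :=
    ENNReal.toReal_pos (measure_ball_pos _ _ one_pos).ne' measure_ball_lt_top.ne
  simp only [finrank_euclideanSpace, Fintype.card_fin]
  positivity

lemma sum_sign (n : ℕ) (hN : N = 2 * n) :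
    ∑ j : Fin N, (if (j : ℕ) < n then (1:ℝ) else -1) = 0 := by
  subst hN
  rw [Fin.sum_univ_eq_sum_range (fun j => if j < n then (1:ℝ) else -1), two_mul,
    Finset.sum_range_add]
  rw [Finset.sum_congr rfl (fun j hj => if_pos (Finset.mem_range.1 hj)),
    Finset.sum_congr rfl (fun j _ => if_neg (by omega : ¬ (n + j < n)))]
  simp

def Jv (n : ℕ) (x : Euc N) : Euc N :=
  WithLp.toLp 2 (fun j => (if (j : ℕ) < n then (1:ℝ) else -1) * x j)

lemma Jv_apply (n : ℕ) (x : Euc N) (j : Fin N) :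
    Jv n x j = (if (j : ℕ) < n then (1:ℝ) else -1) * x j := rfl

lemma inner_Jv (n : ℕ) (x v : Euc N) :
    inner ℝ (Jv n x) v = ∑ j : Fin N, (if (j : ℕ) < n then (1:ℝ) else -1) * x j * v j := by
  rw [PiLp.inner_apply]
  refine Finset.sum_congr rfl fun j _ => ?_
  rw [Jv_apply]; simp [mul_comm]

lemma qf_hasFDerivAt (n : ℕ) (x : Euc N) :
    HasFDerivAt (qf n) ((2:ℝ) • innerSL ℝ (Jv n x)) x := by
  have : ∀ j ∈ (Finset.univ : Finset (Fin N)), HasFDerivAt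
      (fun y : Euc N => (if (j : ℕ) < n then (1:ℝ) else -1) * y j ^ 2)
      ((if (j : ℕ) < n then (1:ℝ) else -1) • ((2 * x j) • (EuclideanSpace.proj j : Euc N →L[ℝ] ℝ))) x := by
    intro j _
    have h : HasFDerivAt (fun y : Euc N => y j) (EuclideanSpace.proj j : Euc N →L[ℝ] ℝ) x :=
      (EuclideanSpace.proj j : Euc N →L[ℝ] ℝ).hasFDerivAt
    have h2 := (h.pow 2).const_mul (if (j : ℕ) < n then (1:ℝ) else -1)
    refine h2.congr_fderiv ?_
    simp
  refine (HasFDerivAt.fun_sum this).congr_fderiv ?_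
  refine ContinuousLinearMap.ext fun v => ?_
  rw [smul_apply, innerSL_apply_apply, inner_Jv]
  rw [FunLike.coe_sum, Finset.sum_apply, smul_eq_mul, Finset.mul_sum]
  refine Finset.sum_congr rfl fun j _ => ?_
  simp only [smul_apply, smul_eq_mul]
  change _ * (2 * x j * v j) = _
  ring

lemma st_deriv_zero {y : ℝ} (hy : y ≤ 0) : deriv Real.smoothTransition y = 0 := by
  apply IsLocalMin.deriv_eq_zero
  refine .of_forall fun z => ?_
  rw [Real.smoothTransition.zero_of_nonpos hy]
  exact Real.smoothTransition.nonneg z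

lemma st_hasDerivAt (y : ℝ) : HasDerivAt Real.smoothTransition (deriv Real.smoothTransition y) y :=
  ((Real.smoothTransition.contDiff (n := 1)).differentiable (by simp) y).hasDerivAt

lemma st_deriv_cont : Continuous (deriv Real.smoothTransition) :=
  (Real.smoothTransition.contDiff (n := 1)).continuous_deriv le_rfl

def wst (x : Euc N) : ℝ := Real.smoothTransition (1 - ‖x‖ ^ 2)

lemma wst_hasFDerivAt (x : Euc N) :
    HasFDerivAt (wst : Euc N → ℝ)
      ((-2 * deriv Real.smoothTransition (1 - ‖x‖ ^ 2)) • (innerSL ℝ x)) x := by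
  have h1 : HasFDerivAt (fun y : Euc N => 1 - ‖y‖ ^ 2) (-(2 • innerSL ℝ x)) x :=
    ((hasStrictFDerivAt_norm_sq x).hasFDerivAt).const_sub 1
  refine ((st_hasDerivAt (1 - ‖x‖ ^ 2)).comp_hasFDerivAt x h1).congr_fderiv ?_
  refine ContinuousLinearMap.ext fun v => ?_
  simp
  ring

lemma wst_zero {x : Euc N} (hx : 1 ≤ ‖x‖) : wst x = 0 :=
  Real.smoothTransition.zero_of_nonpos (by nlinarith)

lemma cs_of (F : Euc N → ℝ) (hF : ∀ x, 1 < ‖x‖ → F x = 0) : HasCompactSupport F := by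
  refine HasCompactSupport.intro (isCompact_closedBall (0:Euc N) 1) fun x hx => hF x ?_
  simpa using hx

lemma wst_cont : Continuous (wst : Euc N → ℝ) :=
  continuous_iff_continuousAt.2 fun x => (wst_hasFDerivAt x).continuousAt

lemma inner_single (x : Euc N) (i : Fin N) : inner ℝ x (EuclideanSpace.single i (1:ℝ)) = x i := by
  rw [EuclideanSpace.inner_single_right]; simp

lemma lineOf {f : Euc N → ℝ} {L : Euc N →L[ℝ] ℝ} {x v : Euc N} {c : ℝ} (h : HasFDerivAt f L x)
    (e : L v = c) : HasLineDerivAt ℝ f c x v := e ▸ h.hasLineDerivAt v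

lemma qpow_ibp (n j : ℕ) (i : Fin N) :
    ∫ x : Euc N, wst x * ((j + 1) * qf n x ^ j * (2 * x i ^ 2)
        + qf n x ^ (j + 1) * (if (i : ℕ) < n then (1:ℝ) else -1)) =
      - ∫ x : Euc N, (-2 * deriv Real.smoothTransition (1 - ‖x‖ ^ 2)) * x i *
        (qf n x ^ (j + 1) * ((if (i : ℕ) < n then (1:ℝ) else -1) * x i)) := by
  set s : ℝ := (if (i : ℕ) < n then (1:ℝ) else -1) with hs
  have hs2 : s * s = 1 := by rw [hs]; split_ifs <;> simp
  have hq := qf_continuous (N := N) n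
  have hw := wst_cont (N := N)
  have hdc : Continuous fun x : Euc N => deriv Real.smoothTransition (1 - ‖x‖ ^ 2) :=
    st_deriv_cont.comp (by fun_prop)
  have hV : ∀ x : Euc N, HasLineDerivAt ℝ (fun x : Euc N => qf n x ^ (j + 1) * (s * x i))
      ((j + 1) * qf n x ^ j * (2 * x i ^ 2) + qf n x ^ (j + 1) * s) x (EuclideanSpace.single i (1:ℝ)) := by
    intro x
    have h : HasFDerivAt (fun y : Euc N => y i) (EuclideanSpace.proj i : Euc N →L[ℝ] ℝ) x :=
      (EuclideanSpace.proj i : Euc N →L[ℝ] ℝ).hasFDerivAt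
    refine lineOf (((qf_hasFDerivAt n x).pow (j+1)).fun_mul (h.const_mul s)) ?_
    have e1 : (EuclideanSpace.proj i : Euc N →L[ℝ] ℝ) (EuclideanSpace.single i (1:ℝ)) = 1 := by simp
    simp only [add_apply, smul_apply, innerSL_apply_apply,
      inner_single, Jv_apply, e1, smul_eq_mul, nsmul_eq_mul, ← hs]
    simp
    linear_combination (2 * (j+1) * qf n x ^ j * x i ^ 2) * hs2
  have hw0 : ∀ x : Euc N, 1 < ‖x‖ → deriv Real.smoothTransition (1 - ‖x‖ ^ 2) = 0 :=
    fun x hx => st_deriv_zero (by nlinarith)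
  have hW : ∀ x : Euc N, HasLineDerivAt ℝ wst
      ((-2 * deriv Real.smoothTransition (1 - ‖x‖ ^ 2)) * x i) x (EuclideanSpace.single i (1:ℝ)) := by
    intro x
    refine lineOf (wst_hasFDerivAt x) ?_
    simp only [smul_apply, innerSL_apply_apply,
      inner_single, smul_eq_mul]
  refine integral_bilinear_hasLineDerivAt_right_eq_neg_left_of_integrable
    (μ := (volume : Measure (Euc N))) (B := ContinuousLinearMap.mul ℝ ℝ)
    (v := EuclideanSpace.single i (1:ℝ)) ?_ ?_ ?_ (fun x _ => hW x) (fun x _ => hV x)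
  all_goals
    refine Continuous.integrable_of_hasCompactSupport ?_ (cs_of _ fun x hx => ?_)
  · simp only [ContinuousLinearMap.mul_apply']; fun_prop
  · simp [hw0 x hx]
  · simp only [ContinuousLinearMap.mul_apply']; fun_prop
  · simp [wst_zero hx.le]
  · simp only [ContinuousLinearMap.mul_apply']; fun_prop
  · simp [wst_zero hx.le]

lemma qpow_ibp_sum (n j : ℕ) (hN : N = 2 * n) :
    ∫ x : Euc N, wst x * (2 * (j + 1) * qf n x ^ j * ‖x‖ ^ 2) =
      ∫ x : Euc N, (2 * deriv Real.smoothTransition (1 - ‖x‖ ^ 2)) * qf n x ^ (j + 2) := by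
  have hq := qf_continuous (N := N) n
  have hw := wst_cont (N := N)
  have hdc : Continuous fun x : Euc N => deriv Real.smoothTransition (1 - ‖x‖ ^ 2) :=
    st_deriv_cont.comp (by fun_prop)
  have hw0 : ∀ x : Euc N, 1 < ‖x‖ → deriv Real.smoothTransition (1 - ‖x‖ ^ 2) = 0 :=
    fun x hx => st_deriv_zero (by nlinarith)
  have h := Finset.sum_congr (rfl : (Finset.univ : Finset (Fin N)) = Finset.univ)
    (fun i _ => qpow_ibp n j i)
  rw [Finset.sum_neg_distrib, ← integral_finsetSum, ← integral_finsetSum, ← integral_neg] at h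
  · convert h using 1
    · refine integral_congr_ae (.of_forall fun x => ?_)
      simp only
      rw [← Finset.mul_sum, Finset.sum_add_distrib, ← Finset.mul_sum, ← Finset.mul_sum,
        ← Finset.mul_sum, sum_sign n hN, EuclideanSpace.norm_sq_eq]
      simp
      ring_nf
      simp
    · refine integral_congr_ae (.of_forall fun x => ?_)
      simp only
      have : ∀ i : Fin N, -2 * deriv smoothTransition (1 - ‖x‖ ^ 2) * x i *
          (qf n x ^ (j + 1) * ((if (i:ℕ) < n then (1:ℝ) else -1) * x i)) =
          (-2 * deriv smoothTransition (1 - ‖x‖ ^ 2) * qf n x ^ (j + 1)) *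
            ((if (i:ℕ) < n then (1:ℝ) else -1) * x i ^ 2) := fun i => by ring
      rw [Finset.sum_congr rfl fun i _ => this i, ← Finset.mul_sum]
      change _ = -(_ * qf n x)
      ring
  all_goals
    intro i _
    refine Continuous.integrable_of_hasCompactSupport ?_ (cs_of _ fun x hx => ?_)
  · fun_prop
  · simp [hw0 x hx]
  · fun_prop
  · simp [wst_zero hx.le]

lemma R_ibp (m : ℕ) (hm : m ≠ 0) :
    (m + 1) * ∫ r in Ioo (0:ℝ) 1, r ^ m * Real.smoothTransition (1 - r ^ 2) =
      2 * ∫ r in Ioo (0:ℝ) 1, r ^ (m + 2) * deriv Real.smoothTransition (1 - r ^ 2) := by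
  have hd : ∀ r : ℝ, HasDerivAt (fun r => r ^ (m+1) * Real.smoothTransition (1 - r ^ 2))
      ((m + 1) * (r ^ m * Real.smoothTransition (1 - r ^ 2)) - 2 * (r ^ (m + 2) * deriv Real.smoothTransition (1 - r ^ 2))) r := by
    intro r
    have h1 : HasDerivAt (fun r : ℝ => 1 - r ^ 2) (-(2 * r)) r := by
      simpa using (hasDerivAt_pow 2 r).const_sub 1
    have h2 := (hasDerivAt_pow (m+1) r).fun_mul ((st_hasDerivAt (1 - r^2)).comp r h1)
    refine h2.congr_deriv ?_
    simp; ring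
  have hc := st_deriv_cont
  have hc' : Continuous Real.smoothTransition := Real.smoothTransition.continuous
  have hi := intervalIntegral.integral_eq_sub_of_hasDerivAt (a := 0) (b := 1)
    (fun r _ => hd r) (Continuous.intervalIntegrable (by fun_prop) _ _)
  rw [intervalIntegral.integral_sub (Continuous.intervalIntegrable (by fun_prop) _ _)
    (Continuous.intervalIntegrable (by fun_prop) _ _), intervalIntegral.integral_const_mul,
    intervalIntegral.integral_const_mul] at hi
  simp only [intervalIntegral.integral_of_le zero_le_one, integral_Ioc_eq_integral_Ioo] at hi
  simp at hi
  linarith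

lemma R_pos (m : ℕ) : 0 < ∫ r in Ioo (0:ℝ) 1, r ^ m * Real.smoothTransition (1 - r ^ 2) := by
  have hc' : Continuous Real.smoothTransition := Real.smoothTransition.continuous
  rw [← integral_Ioc_eq_integral_Ioo, ← intervalIntegral.integral_of_le zero_le_one]
  refine intervalIntegral.intervalIntegral_pos_of_pos_on
    (Continuous.intervalIntegrable (by fun_prop) _ _) (fun r hr => ?_) one_pos
  exact mul_pos (pow_pos hr.1 _) (Real.smoothTransition.pos_of_pos (by nlinarith [hr.1, hr.2]))

lemma moment (n j : ℕ) (hN : N = 2 * n) (hn : 2 ≤ n) :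
    2 * (j + 1) * sphI N n (fun X => X ^ j) = (N + 2 * (j + 1)) * sphI N n (fun X => X ^ (j + 2)) := by
  have hN0 : N ≠ 0 := by omega
  have h := qpow_ibp_sum (N := N) n j hN
  have a1 : ∀ F : Euc N → ℝ, (∀ x, 1 ≤ ‖x‖ → F x = 0) → ∫ x, F x = ∫ x in Metric.ball 0 1, F x := by
    intro F hF
    rw [setIntegral_eq_integral_of_forall_compl_eq_zero]
    intro x hx
    exact hF x (by simpa using hx)
  rw [a1 _ (fun x hx => by simp [wst_zero hx]), a1 _ (fun x hx => by
    simp [st_deriv_zero (by nlinarith : 1 - ‖x‖^2 ≤ 0)])] at h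
  have e1 := polar_int (N := N) n (fun r => r ^ (2 * j + 2) * Real.smoothTransition (1 - r ^ 2)) (fun X => X ^ j) hN0
  have e2 := polar_int (N := N) n (fun r => r ^ (2 * j + 4) * deriv Real.smoothTransition (1 - r ^ 2)) (fun X => X ^ (j+2)) hN0
  have f1 : ∀ x : Euc N, wst x * (2 * (j + 1) * qf n x ^ j * ‖x‖ ^ 2) =
      (2 * (j + 1)) * (‖x‖ ^ (2 * j + 2) * Real.smoothTransition (1 - ‖x‖ ^ 2) * Xf n x ^ j) := by
    intro x
    rw [qf_eq, wst]; ring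
  have f2 : ∀ x : Euc N, (2 * deriv Real.smoothTransition (1 - ‖x‖ ^ 2)) * qf n x ^ (j + 2) =
      2 * (‖x‖ ^ (2 * j + 4) * deriv Real.smoothTransition (1 - ‖x‖ ^ 2) * Xf n x ^ (j+2)) := by
    intro x
    rw [qf_eq]; ring
  simp only [f1, f2, integral_const_mul] at h
  rw [e1, e2] at h
  have g1 : ∀ r : ℝ, r ^ (N - 1) * (r ^ (2 * j + 2) * Real.smoothTransition (1 - r ^ 2)) =
      r ^ (N + 2 * j + 1) * Real.smoothTransition (1 - r ^ 2) := by
    intro r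
    rw [show N + 2 * j + 1 = (N - 1) + (2 * j + 2) by omega]; ring
  have g2 : ∀ r : ℝ, r ^ (N - 1) * (r ^ (2 * j + 4) * deriv Real.smoothTransition (1 - r ^ 2)) =
      r ^ (N + 2 * j + 1 + 2) * deriv Real.smoothTransition (1 - r ^ 2) := by
    intro r
    rw [show N + 2 * j + 1 + 2 = (N - 1) + (2 * j + 4) by omega]; ring
  simp only [g1, g2] at h
  have k1 := R_ibp (N + 2 * j + 1) (by omega)
  have k2 := R_pos (N + 2 * j + 1)
  push_cast at k1
  have : 2 * (j + 1) * sphI N n (fun X => X ^ j) * (∫ r in Ioo (0:ℝ) 1, r ^ (N + 2 * j + 1) * Real.smoothTransition (1 - r ^ 2)) = (N + 2 * (j + 1)) * sphI N n (fun X => X ^ (j + 2)) * (∫ r in Ioo (0:ℝ) 1, r ^ (N + 2 * j + 1) * Real.smoothTransition (1 - r ^ 2)) := by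
    linear_combination h - sphI N n (fun X => X ^ (j + 2)) * k1
  exact mul_right_cancel₀ k2.ne' this

/-- the angular profile -/
def hh (n : ℕ) (X : ℝ) : ℝ := 1 / ((n : ℝ) + 1) - X ^ 2

lemma moments (n : ℕ) (hN : N = 2 * n) (hn : 2 ≤ n) :
    sphI N n (hh n) = 0 ∧ 0 < sphI N n (fun X => hh n X ^ 2) ∧
    sphI N n (fun X => 16 * (X ^ 2 - X ^ 4)) = 4 * ((N : ℝ) + 2) * sphI N n (fun X => hh n X ^ 2) := by
  have h0 := moment (N := N) n 0 hN hn
  have h2 := moment (N := N) n 2 hN hn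
  have hp := sphI_one_pos (N := N) n (by omega)
  have hNr : (N : ℝ) = 2 * n := by rw [hN]; push_cast; ring
  have hn0 : (2:ℝ) ≤ n := by exact_mod_cast hn
  simp only [pow_zero, zero_add] at h0
  norm_num at h0 h2
  rw [hNr] at *
  set M0 := sphI N n (fun _ => 1)
  set M2 := sphI N n (fun X => X ^ 2)
  set M4 := sphI N n (fun X => X ^ 4)
  have E0 : M0 = (n + 1) * M2 := by linarith
  have E4 : M2 = (n + 3) / 3 * M4 := by linarith
  have M4p : 0 < M4 := by
    rw [E0, E4] at hp
    by_contra hc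
    push Not at hc
    have : ((n:ℝ) + 1) * ((n + 3) / 3) * M4 ≤ 0 := mul_nonpos_of_nonneg_of_nonpos (by positivity) hc
    linarith
  have c1 : sphI N n (hh n) = 1 / ((n:ℝ) + 1) * M0 + (-1) * M2 := by
    rw [← sphI_smul, ← sphI_smul, ← sphI_add _ _ _ (by fun_prop) (by fun_prop)]
    congr 1; funext X; unfold hh; ring
  have c2 : sphI N n (fun X => hh n X ^ 2) = (1 / ((n:ℝ) + 1)) ^ 2 * M0 + ((-(2 / ((n:ℝ) + 1))) * M2 + M4) := by
    rw [← sphI_smul, ← sphI_smul, ← sphI_add _ _ _ (by fun_prop) (by fun_prop),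
      ← sphI_add _ _ _ (by fun_prop) (by fun_prop)]
    congr 1; funext X; unfold hh; ring
  have c3 : sphI N n (fun X => 16 * (X ^ 2 - X ^ 4)) = 16 * M2 + (-16) * M4 := by
    rw [← sphI_smul, ← sphI_smul, ← sphI_add _ _ _ (by fun_prop) (by fun_prop)]
    congr 1; funext X; ring
  have c2' : sphI N n (fun X => hh n X ^ 2) = (2 * n) / (3 * (n + 1)) * M4 := by
    rw [c2, E0, E4]; field_simp; ring
  refine ⟨?_, ?_, ?_⟩
  · rw [c1, E0]; field_simp; ring
  · rw [c2']; positivity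
  · rw [c2', c3, E4]; field_simp; ring

def Bc (F : ℝ → ℝ) : Prop := ContinuousOn F (Ioo 0 1) ∧ ∃ C, ∀ r ∈ Ioo (0:ℝ) 1, |F r| ≤ C

lemma Bc.mul {F G : ℝ → ℝ} (hF : Bc F) (hG : Bc G) : Bc (fun r => F r * G r) := by
  obtain ⟨h1, C, hC⟩ := hF
  obtain ⟨h2, D, hD⟩ := hG
  refine ⟨h1.mul h2, C * D, fun r hr => ?_⟩
  rw [abs_mul]
  exact mul_le_mul (hC r hr) (hD r hr) (abs_nonneg _) ((abs_nonneg _).trans (hC r hr))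

lemma Bc.add {F G : ℝ → ℝ} (hF : Bc F) (hG : Bc G) : Bc (fun r => F r + G r) := by
  obtain ⟨h1, C, hC⟩ := hF
  obtain ⟨h2, D, hD⟩ := hG
  exact ⟨h1.add h2, C + D, fun r hr => (abs_add_le _ _).trans (add_le_add (hC r hr) (hD r hr))⟩

lemma Bc.of_cont {F : ℝ → ℝ} (hF : Continuous F) : Bc F := by
  obtain ⟨C, hC⟩ := (isCompact_Icc (a := (0:ℝ)) (b := 1)).exists_bound_of_continuousOn hF.continuousOn
  exact ⟨hF.continuousOn, C, fun r hr => hC r ⟨hr.1.le, hr.2.le⟩⟩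

lemma Bc.sq {F : ℝ → ℝ} (hF : Bc F) : Bc (fun r => F r ^ 2) := by
  simpa only [pow_two] using hF.mul hF

lemma Bc.cmul {F : ℝ → ℝ} (c : ℝ) (hF : Bc F) : Bc (fun r => c * F r) :=
  (Bc.of_cont continuous_const).mul hF

lemma Bc.congr {F G : ℝ → ℝ} (hF : Bc F) (h : ∀ r ∈ Ioo (0:ℝ) 1, G r = F r) : Bc G := by
  obtain ⟨h1, C, hC⟩ := hF
  exact ⟨h1.congr h, C, fun r hr => by rw [h r hr]; exact hC r hr⟩

lemma Bc.int {F : ℝ → ℝ} (hF : Bc F) : IntegrableOn F (Ioo 0 1) := by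
  obtain ⟨h1, C, hC⟩ := hF
  have : IsFiniteMeasure (volume.restrict (Ioo (0:ℝ) 1)) := ⟨by simp⟩
  refine Integrable.of_bound (h1.aestronglyMeasurable measurableSet_Ioo) C ?_
  exact (ae_restrict_iff' measurableSet_Ioo).2 (.of_forall hC)

open scoped Topology

lemma ftc0 {Φ φ : ℝ → ℝ} (hd : ∀ r ∈ Ioo (0:ℝ) 1, HasDerivAt Φ (φ r) r) (hφ : Bc φ)
    (h0 : Tendsto Φ (𝓝[>] 0) (𝓝 0)) (h1 : Tendsto Φ (𝓝[<] 1) (𝓝 0)) :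
    ∫ r in Ioo (0:ℝ) 1, φ r = 0 := by
  have := intervalIntegral.integral_eq_sub_of_hasDerivAt_of_tendsto (a := (0:ℝ)) (b := 1)
    one_pos hd ((intervalIntegrable_iff_integrableOn_Ioo_of_le zero_le_one).2 hφ.int) h0 h1
  rw [intervalIntegral.integral_of_le zero_le_one, integral_Ioc_eq_integral_Ioo] at this
  simpa using this

/-- if `F` is bounded and `G → 0` then `F G → 0` -/
lemma bc_tendsto0 {F G : ℝ → ℝ} (hF : Bc F) (hG : Tendsto G (𝓝[>] 0) (𝓝 0)) :
    Tendsto (fun r => F r * G r) (𝓝[>] 0) (𝓝 0) := by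
  obtain ⟨h1, C, hC⟩ := hF
  refine bdd_le_mul_tendsto_zero' C ?_ hG
  filter_upwards [Ioo_mem_nhdsGT one_pos] with r hr using hC r hr

lemma bc_tendsto1 {F G : ℝ → ℝ} (hF : Bc F) (hG : Tendsto G (𝓝[<] 1) (𝓝 0)) :
    Tendsto (fun r => F r * G r) (𝓝[<] 1) (𝓝 0) := by
  obtain ⟨h1, C, hC⟩ := hF
  refine bdd_le_mul_tendsto_zero' C ?_ hG
  filter_upwards [Ioo_mem_nhdsLT one_pos] with r hr using hC r hr

structure RadSol (m : ℕ) (α p : ℝ) (f f1 : ℝ → ℝ) : Prop where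
  hm : 2 ≤ m
  hα : 0 < α
  hp : 2 < p
  hf : ∀ r ∈ Ioo (0:ℝ) 1, HasDerivAt f (f1 r) r
  hf1 : ∀ r ∈ Ioo (0:ℝ) 1, HasDerivAt f1 (-((m + 1) / r * f1 r) - r ^ α * f r ^ (p - 1)) r
  pos : ∀ r ∈ Ioo (0:ℝ) 1, 0 < f r
  bdd : ∃ M, ∀ r ∈ Ioo (0:ℝ) 1, f r ≤ M
  bdd1 : ∃ C, ∀ r ∈ Ioo (0:ℝ) 1, r ≤ 1/2 → |f1 r| ≤ C
  lim : Tendsto f (𝓝[<] 1) (𝓝 0)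

namespace RadSol
variable {m : ℕ} {α p : ℝ} {f f1 : ℝ → ℝ}

lemma bf (h : RadSol m α p f f1) : Bc f := by
  obtain ⟨M, hM⟩ := h.bdd
  exact ⟨fun r hr => (h.hf r hr).continuousAt.continuousWithinAt, M, fun r hr => by
    rw [abs_of_pos (h.pos r hr)]; exact hM r hr⟩

lemma bpow (h : RadSol m α p f f1) {s : ℝ} (hs : 0 < s) : Bc (fun r => f r ^ s) := by
  obtain ⟨M, hM⟩ := h.bdd
  refine ⟨h.bf.1.rpow_const fun r hr => Or.inr hs.le, M ^ s, fun r hr => ?_⟩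
  rw [abs_of_nonneg (rpow_nonneg (h.pos r hr).le _)]
  exact rpow_le_rpow (h.pos r hr).le (hM r hr) hs.le

lemma bra (h : RadSol m α p f f1) : Bc (fun r => r ^ α) :=
  Bc.of_cont (continuous_id.rpow_const fun _ => Or.inr h.hα.le)

lemma derivΦ (h : RadSol m α p f f1) (r : ℝ) (hr : r ∈ Ioo (0:ℝ) 1) :
    HasDerivAt (fun r => r ^ (m + 1) * f1 r) (-(r ^ (m + 1) * (r ^ α * f r ^ (p - 1)))) r := by
  refine ((hasDerivAt_pow (m+1) r).fun_mul (h.hf1 r hr)).congr_deriv ?_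
  have : r ≠ 0 := hr.1.ne'
  push_cast
  try simp only [add_tsub_cancel_right]
  field_simp
  ring

lemma bf1 (h : RadSol m α p f f1) : Bc f1 := by
  refine ⟨fun r hr => (h.hf1 r hr).continuousAt.continuousWithinAt, ?_⟩
  obtain ⟨C, hC⟩ := h.bdd1
  obtain ⟨_, B, hB⟩ := (((Bc.of_cont (continuous_pow (m+1))).mul
    (h.bra.mul (h.bpow (s := p - 1) (by linarith [h.hp])))))
  set A := |(1/2:ℝ) ^ (m + 1) * f1 (1/2)|
  have hB0 : 0 ≤ B := (abs_nonneg _).trans (hB (1/2) (by constructor <;> norm_num))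
  refine ⟨max C (2 ^ (m+1) * (A + B)), fun r hr => ?_⟩
  rcases le_or_gt r (1/2) with h2 | h2
  · exact (hC r hr h2).trans (le_max_left _ _)
  · refine le_trans ?_ (le_max_right _ _)
    have := Convex.norm_image_sub_le_of_norm_hasDerivWithin_le (s := Ioo (0:ℝ) 1)
      (f := fun r => r ^ (m + 1) * f1 r) (C := B) (x := 1/2) (y := r)
      (fun r hr => (h.derivΦ r hr).hasDerivWithinAt)
      (fun r hr => by rw [norm_neg]; exact hB r hr) (convex_Ioo 0 1) (by constructor <;> norm_num) hr
    simp only [Real.norm_eq_abs] at this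
    have e1 : |r ^ (m+1) * f1 r| ≤ A + B := by
      have e2 : |r - 1/2| ≤ 1 := by rw [abs_le]; constructor <;> linarith [hr.1, hr.2]
      have e3 : |r ^ (m+1) * f1 r| ≤ |r ^ (m+1) * f1 r - (1/2) ^ (m+1) * f1 (1/2)| + A := by
        have := abs_add_le (r ^ (m+1) * f1 r - (1/2) ^ (m+1) * f1 (1/2)) ((1/2) ^ (m+1) * f1 (1/2))
        rwa [sub_add_cancel] at this
      nlinarith
    rw [abs_mul, abs_of_pos (pow_pos hr.1 _)] at e1
    have e4 : 1 ≤ 2 ^ (m+1) * r ^ (m+1) := by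
      rw [← mul_pow]; exact one_le_pow₀ (by linarith)
    calc |f1 r| ≤ (2 ^ (m+1) * r ^ (m+1)) * |f1 r| := le_mul_of_one_le_left (abs_nonneg _) e4
      _ = 2 ^ (m+1) * (r ^ (m+1) * |f1 r|) := by ring
      _ ≤ _ := by gcongr

lemma fpow (h : RadSol m α p f f1) (r : ℝ) (hr : r ∈ Ioo (0:ℝ) 1) : f r ^ (p-1) * f r = f r ^ p := by
  rw [← Real.rpow_add_one (h.pos r hr).ne']; congr 1; ring

/-- weighted identity -/
lemma ident (h : RadSol m α p f f1) (g g1 : ℝ → ℝ) (hg : ∀ r, HasDerivAt g (g1 r) r)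
    (hg1 : Continuous g1) :
    ∫ r in Ioo (0:ℝ) 1, r ^ (m+1) * ((f1 r * g r + f r * g1 r) ^ 2) =
      (∫ r in Ioo (0:ℝ) 1, r ^ (m+1) * (r ^ α * f r ^ p * g r ^ 2)) +
      ∫ r in Ioo (0:ℝ) 1, r ^ (m+1) * (f r ^ 2 * g1 r ^ 2) := by
  have hgc : Continuous g := continuous_iff_continuousAt.2 fun r => (hg r).continuousAt
  have bg := Bc.of_cont hgc
  have bg1 := Bc.of_cont hg1
  have br := Bc.of_cont (continuous_pow (M := ℝ) (m+1))
  have b1 : Bc fun r => r ^ (m+1) * ((f1 r * g r + f r * g1 r) ^ 2) :=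
    br.mul ((h.bf1.mul bg).add (h.bf.mul bg1)).sq
  have b2 : Bc fun r => r ^ (m+1) * (r ^ α * f r ^ p * g r ^ 2) :=
    br.mul ((h.bra.mul (h.bpow (by linarith [h.hp]))).mul bg.sq)
  have b3 : Bc fun r => r ^ (m+1) * (f r ^ 2 * g1 r ^ 2) := br.mul (h.bf.sq.mul bg1.sq)
  have key := ftc0 (Φ := fun r => (r ^ (m+1) * f1 r) * (f r * g r ^ 2))
    (φ := fun r => r ^ (m+1) * ((f1 r * g r + f r * g1 r) ^ 2) + ((-1) * (r ^ (m+1) * (r ^ α * f r ^ p * g r ^ 2))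
      + (-1) * (r ^ (m+1) * (f r ^ 2 * g1 r ^ 2)))) ?_ (b1.add ((b2.cmul _).add (b3.cmul _))) ?_ ?_
  · rw [integral_add b1.int ((b2.cmul _).add (b3.cmul _)).int, integral_add (b2.cmul _).int (b3.cmul _).int,
      integral_const_mul, integral_const_mul] at key
    linarith
  · intro r hr
    refine ((h.derivΦ r hr).fun_mul ((h.hf r hr).fun_mul ((hg r).fun_pow 2))).congr_deriv ?_
    rw [← h.fpow r hr]
    push_cast
    ring
  · have : Tendsto (fun r : ℝ => r ^ (m+1)) (𝓝[>] 0) (𝓝 0) := by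
      have := (continuous_pow (M := ℝ) (m+1)).tendsto 0
      simp at this
      exact this.mono_left nhdsWithin_le_nhds
    refine (bc_tendsto0 ((h.bf1.mul h.bf).mul bg.sq) this).congr fun r => by ring
  · refine (bc_tendsto1 ((br.mul h.bf1).mul bg.sq) h.lim).congr fun r => by ring

lemma hardy (h : RadSol m α p f f1) (k k1 : ℝ → ℝ) (hk : ∀ r, HasDerivAt (fun r => r * k r) (k1 r) r)
    (hkc : Continuous k) (hk1 : Continuous k1) :
    (m:ℝ) ^ 2 / 4 * ∫ r in Ioo (0:ℝ) 1, r ^ (m+1) * (f r ^ 2 * k r ^ 2) ≤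
      ∫ r in Ioo (0:ℝ) 1, r ^ (m+1) * ((f1 r * (r * k r) + f r * k1 r) ^ 2) := by
  have bk := Bc.of_cont hkc
  have bk1 := Bc.of_cont hk1
  have br := Bc.of_cont (continuous_pow (M := ℝ) (m+1))
  have bi := Bc.of_cont (continuous_id (X := ℝ))
  have bw : Bc fun r => f1 r * (r * k r) + f r * k1 r := (h.bf1.mul (bi.mul bk)).add (h.bf.mul bk1)
  have b1 : Bc fun r => r ^ (m+1) * ((f1 r * (r * k r) + f r * k1 r) ^ 2) := br.mul bw.sq
  have b2 : Bc fun r => r ^ (m+1) * (f r ^ 2 * k r ^ 2) := br.mul (h.bf.sq.mul bk.sq)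
  have b3 : Bc fun r => r ^ (m+1) * ((f1 r * (r * k r) + f r * k1 r) * (f r * k r)) :=
    br.mul (bw.mul (h.bf.mul bk))
  have key := ftc0 (Φ := fun r => r ^ m * (f r * (r * k r)) ^ 2)
    (φ := fun r => m * (r ^ (m+1) * (f r ^ 2 * k r ^ 2)) +
      2 * (r ^ (m+1) * ((f1 r * (r * k r) + f r * k1 r) * (f r * k r))))
      ?_ ((b2.cmul _).add (b3.cmul _)) ?_ ?_
  · rw [integral_add (b2.cmul _).int (b3.cmul _).int, integral_const_mul, integral_const_mul] at key
    have nn : 0 ≤ ∫ r in Ioo (0:ℝ) 1, (r ^ (m+1) * ((f1 r * (r * k r) + f r * k1 r) ^ 2) +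
        ((m:ℝ)^2/4 * (r ^ (m+1) * (f r ^ 2 * k r ^ 2)) +
        (m:ℝ) * (r ^ (m+1) * ((f1 r * (r * k r) + f r * k1 r) * (f r * k r))))) := by
      refine setIntegral_nonneg measurableSet_Ioo fun r hr => ?_
      have : 0 ≤ r ^ (m+1) * ((f1 r * (r * k r) + f r * k1 r) + m / 2 * (f r * k r)) ^ 2 :=
        mul_nonneg (pow_nonneg hr.1.le _) (sq_nonneg _)
      convert this using 1
      ring
    rw [integral_add b1.int ((b2.cmul _).add (b3.cmul _)).int, integral_add (b2.cmul _).int (b3.cmul _).int,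
      integral_const_mul, integral_const_mul] at nn
    nlinarith
  · intro r hr
    refine ((hasDerivAt_pow m r).fun_mul (((h.hf r hr).fun_mul (hk r)).fun_pow 2)).congr_deriv ?_
    obtain ⟨j, rfl⟩ : ∃ j, m = j + 1 := ⟨m - 1, by have := h.hm; omega⟩
    push_cast
    try simp only [add_tsub_cancel_right]
    ring
  · have : Tendsto (fun r : ℝ => r ^ m) (𝓝[>] 0) (𝓝 0) := by
      have := (continuous_pow (M := ℝ) m).tendsto 0
      rw [zero_pow (by have := h.hm; omega)] at this
      exact this.mono_left nhdsWithin_le_nhds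
    refine (bc_tendsto0 ((h.bf.mul (bi.mul bk)).sq) this).congr fun r => by simp only [id]; ring
  · refine (bc_tendsto1 ((Bc.of_cont (continuous_pow (M := ℝ) m)).mul (h.bf.mul (bi.mul bk).sq)) h.lim).congr
      fun r => by simp only [id]; ring

end RadSol

def gd (d r : ℝ) : ℝ := r * (r ^ 3 / (d ^ 2 + r ^ 2) ^ 2)
def kd (d r : ℝ) : ℝ := r ^ 3 / (d ^ 2 + r ^ 2) ^ 2
def g1d (d r : ℝ) : ℝ := 4 * d ^ 2 * r ^ 3 / (d ^ 2 + r ^ 2) ^ 3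

lemma Dpos {d : ℝ} (hd : 0 < d) (r : ℝ) : 0 < d ^ 2 + r ^ 2 := by positivity

lemma gd_hasDerivAt {d : ℝ} (hd : 0 < d) (r : ℝ) : HasDerivAt (gd d) (g1d d r) r := by
  have hD := (Dpos hd r).ne'
  have h1 : HasDerivAt (fun r : ℝ => d ^ 2 + r ^ 2) (2 * r) r := by
    simpa using (hasDerivAt_pow 2 r).const_add (d ^ 2)
  have h2 := (hasDerivAt_id r).fun_mul ((hasDerivAt_pow 3 r).fun_div (h1.fun_pow 2) (pow_ne_zero 2 hD))
  refine h2.congr_deriv ?_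
  unfold g1d
  simp only [id]
  push_cast
  field_simp
  ring

lemma kd_cont {d : ℝ} (hd : 0 < d) : Continuous (kd d) := by
  unfold kd
  exact Continuous.div (by fun_prop) (by fun_prop) fun r => pow_ne_zero _ (Dpos hd r).ne'

lemma g1d_cont {d : ℝ} (hd : 0 < d) : Continuous (g1d d) := by
  unfold g1d
  exact Continuous.div (by fun_prop) (by fun_prop) fun r => pow_ne_zero _ (Dpos hd r).ne'

lemma gd_cont {d : ℝ} (hd : 0 < d) : Continuous (gd d) := continuous_id.mul (kd_cont hd)

namespace RadSol
variable {m : ℕ} {α p : ℝ} {f f1 : ℝ → ℝ}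

lemma energy_id (h : RadSol m α p f f1) :
    ∫ r in Ioo (0:ℝ) 1, r ^ (m+1) * (f1 r ^ 2) = ∫ r in Ioo (0:ℝ) 1, r ^ (m+1) * (r ^ α * f r ^ p) := by
  have := h.ident (fun _ => 1) (fun _ => 0) (fun r => hasDerivAt_const r 1) continuous_const
  simpa using this

lemma pos_int {F : ℝ → ℝ} (hF : Bc F) (hp : ∀ r ∈ Ioo (0:ℝ) 1, 0 < F r) :
    0 < ∫ r in Ioo (0:ℝ) 1, F r := by
  rw [← integral_Ioc_eq_integral_Ioo, ← intervalIntegral.integral_of_le zero_le_one]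
  exact intervalIntegral.intervalIntegral_pos_of_pos_on
    ((intervalIntegrable_iff_integrableOn_Ioo_of_le zero_le_one).2 hF.int) hp one_pos

lemma g1_bound {d r : ℝ} (hm : 2 ≤ m) (hd : 0 < d) (hr : r ∈ Ioo (0:ℝ) 1) :
    r ^ (m+1) * g1d d r ^ 2 ≤ 16 * d := by
  have hD := Dpos hd r
  have h0 : r ^ (m+1) ≤ r ^ 3 := pow_le_pow_of_le_one hr.1.le hr.2.le (by omega)
  have h1 : d * r ≤ d ^ 2 + r ^ 2 := by nlinarith [sq_nonneg (d - r)]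
  have h2 : (d * r) ^ 3 ≤ (d ^ 2 + r ^ 2) ^ 3 := pow_le_pow_left₀ (by have := hr.1; positivity) h1 3
  have h3 : (r ^ 2) ^ 3 ≤ (d ^ 2 + r ^ 2) ^ 3 := pow_le_pow_left₀ (by positivity) (by nlinarith) 3
  have h4 : (d * r) ^ 3 * (r ^ 2) ^ 3 ≤ (d ^ 2 + r ^ 2) ^ 3 * (d ^ 2 + r ^ 2) ^ 3 :=
    mul_le_mul h2 h3 (by positivity) (by positivity)
  calc r ^ (m+1) * g1d d r ^ 2 ≤ r ^ 3 * g1d d r ^ 2 := by gcongr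
    _ ≤ 16 * d := by
      unfold g1d
      rw [div_pow, ← mul_div_assoc, div_le_iff₀ (by positivity)]
      nlinarith

lemma strict (h : RadSol m α p f f1) (μ : ℝ) (hμ : μ < (p - 2) * ((m:ℝ) ^ 2 / 4)) :
    ∃ d : ℝ, 0 < d ∧
      (∫ r in Ioo (0:ℝ) 1, r ^ (m+1) * ((f1 r * gd d r + f r * g1d d r) ^ 2)) +
        μ * (∫ r in Ioo (0:ℝ) 1, r ^ (m+1) * (f r ^ 2 * kd d r ^ 2)) <
      (p - 1) * ∫ r in Ioo (0:ℝ) 1, r ^ (m+1) * (r ^ α * f r ^ p * gd d r ^ 2) := by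
  obtain ⟨M, hM⟩ := h.bdd
  have hp := h.hp
  have br := Bc.of_cont (continuous_pow (M := ℝ) (m+1))
  have bκ : ∀ {d : ℝ}, 0 < d → Bc fun r => r ^ (m+1) * (f r ^ 2 * kd d r ^ 2) := fun hd =>
    br.mul (h.bf.sq.mul (Bc.of_cont (kd_cont hd)).sq)
  set κ := ∫ r in Ioo (0:ℝ) 1, r ^ (m+1) * (f r ^ 2 * kd 1 r ^ 2) with hκ
  have hκ0 : 0 < κ := by
    refine pos_int (bκ one_pos) fun r hr => ?_
    have := h.pos r hr
    have := hr.1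
    unfold kd
    positivity
  set s := (p - 2) * ((m:ℝ) ^ 2 / 4) - μ with hs
  have hs0 : 0 < s := by linarith
  set d := min 1 (s * κ / (2 * ((p - 1) * (16 * (M ^ 2 + 1))))) with hd
  have hd0 : 0 < d := lt_min one_pos (div_pos (by positivity) (by
    have : 0 < p - 1 := by linarith
    positivity))
  have hd1 : d ≤ 1 := min_le_left _ _
  have hd2 : d ≤ s * κ / (2 * ((p - 1) * (16 * (M ^ 2 + 1)))) := min_le_right _ _
  refine ⟨d, hd0, ?_⟩
  have e1 := h.ident (gd d) (g1d d) (gd_hasDerivAt hd0) (g1d_cont hd0)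
  have e2 := h.hardy (kd d) (g1d d) (gd_hasDerivAt hd0) (kd_cont hd0) (g1d_cont hd0)
  change _ ≤ ∫ r in Ioo (0:ℝ) 1, r ^ (m+1) * ((f1 r * gd d r + f r * g1d d r) ^ 2) at e2
  have e3 : κ ≤ ∫ r in Ioo (0:ℝ) 1, r ^ (m+1) * (f r ^ 2 * kd d r ^ 2) := by
    refine setIntegral_mono_on (bκ one_pos).int (bκ hd0).int measurableSet_Ioo fun r hr => ?_
    have := hr.1
    have hD := Dpos hd0 r
    have : d ^ 2 ≤ 1 ^ 2 := pow_le_pow_left₀ hd0.le hd1 2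
    unfold kd
    gcongr
  have e4 : ∫ r in Ioo (0:ℝ) 1, r ^ (m+1) * (f r ^ 2 * g1d d r ^ 2) ≤ M ^ 2 * (16 * d) := by
    have : ∫ r in Ioo (0:ℝ) 1, r ^ (m+1) * (f r ^ 2 * g1d d r ^ 2) ≤ ∫ r in Ioo (0:ℝ) 1, M ^ 2 * (16 * d) := by
      refine setIntegral_mono_on (br.mul (h.bf.sq.mul (Bc.of_cont (g1d_cont hd0)).sq)).int
        (Bc.of_cont continuous_const).int measurableSet_Ioo fun r hr => ?_
      have a1 := g1_bound h.hm hd0 hr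
      have a2 : f r ^ 2 ≤ M ^ 2 := pow_le_pow_left₀ (h.pos r hr).le (hM r hr) 2
      have : 0 ≤ r ^ (m+1) * g1d d r ^ 2 := by have := hr.1; positivity
      calc _ = f r ^ 2 * (r ^ (m+1) * g1d d r ^ 2) := by ring
        _ ≤ _ := mul_le_mul a2 a1 this (by positivity)
    simpa using this
  set A := ∫ r in Ioo (0:ℝ) 1, r ^ (m+1) * ((f1 r * gd d r + f r * g1d d r) ^ 2)
  set B := ∫ r in Ioo (0:ℝ) 1, r ^ (m+1) * (r ^ α * f r ^ p * gd d r ^ 2)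
  set H := ∫ r in Ioo (0:ℝ) 1, r ^ (m+1) * (f r ^ 2 * kd d r ^ 2)
  set G := ∫ r in Ioo (0:ℝ) 1, r ^ (m+1) * (f r ^ 2 * g1d d r ^ 2)
  have f1 : (p - 2) * ((m:ℝ)^2/4 * H) ≤ (p-2) * A := mul_le_mul_of_nonneg_left e2 (by linarith)
  have f2 : (p - 1) * G ≤ (p-1) * (M ^ 2 * (16 * d)) := mul_le_mul_of_nonneg_left e4 (by linarith)
  have f3 : (p-1) * ((M ^ 2 + 1) * (16 * d)) ≤ s * κ / 2 := by
    have : 0 < p - 1 := by linarith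
    rw [le_div_iff₀ (by positivity)] at hd2
    linarith
  have f4 : s * κ ≤ s * H := mul_le_mul_of_nonneg_left e3 hs0.le
  have f5 : 0 ≤ (p-1) * (16 * d) := mul_nonneg (by linarith) (by linarith)
  have f6 : 0 < s * κ := by positivity
  have f7 : s * H = (p - 2) * ((m:ℝ)^2/4 * H) - μ * H := by rw [hs]; ring
  nlinarith

end RadSol

open scoped Topology
open Metric
lemma nrm_hasFDerivAt {x : Euc N} (hx : x ≠ 0) :
    HasFDerivAt (fun y : Euc N => ‖y‖) (‖x‖⁻¹ • innerSL ℝ x) x := by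
  have h1 : HasFDerivAt (fun y : Euc N => ‖y‖ ^ 2) ((2:ℝ) • innerSL ℝ x) x := by
    refine (hasStrictFDerivAt_norm_sq x).hasFDerivAt.congr_fderiv ?_
    rw [two_smul, two_smul]
  have h2 := h1.sqrt (by positivity)
  have h3 : (fun y : Euc N => √(‖y‖ ^ 2)) = fun y => ‖y‖ := by
    funext y; exact Real.sqrt_sq (norm_nonneg y)
  rw [h3] at h2
  refine h2.congr_fderiv ?_
  rw [Real.sqrt_sq (norm_nonneg x), smul_smul]
  congr 1
  have : ‖x‖ ≠ 0 := norm_ne_zero_iff.2 hx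
  field_simp

/-- derivative of a radial function -/
lemma radial_fderiv {u : Euc N → ℝ} {f : ℝ → ℝ} {f' : ℝ} (hu : ∀ x, u x = f ‖x‖) {x : Euc N} (hx : x ≠ 0)
    (hf : HasDerivAt f f' ‖x‖) : HasFDerivAt u ((f' / ‖x‖) • innerSL ℝ x) x := by
  have h := hf.comp_hasFDerivAt x (nrm_hasFDerivAt hx)
  have e : (f ∘ fun y : Euc N => ‖y‖) = u := by funext y; simp [hu y]
  rw [e] at h
  refine h.congr_fderiv ?_
  rw [smul_smul]; rfl

lemma radial_ode {u : Euc N → ℝ} {f f1 : ℝ → ℝ} (hu : ∀ x, u x = f ‖x‖)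
    (hf : ∀ r ∈ Ioo (0:ℝ) 1, HasDerivAt f (f1 r) r) {x : Euc N} (hx : x ≠ 0) (hx1 : ‖x‖ < 1)
    (hC : ContDiffAt ℝ 2 u x) {f2 : ℝ} (hf1 : HasDerivAt f1 f2 ‖x‖) :
    lap u x = f2 + ((N:ℝ) - 1) / ‖x‖ * f1 ‖x‖ := by
  have hr : 0 < ‖x‖ := norm_pos_iff.2 hx
  have hD : DifferentiableAt ℝ (fderiv ℝ u) x :=
    (hC.fderiv_right (m := 1) (by norm_num)).differentiableAt (by norm_num)
  have hev : ∀ᶠ y in 𝓝 x, fderiv ℝ u y = (f1 ‖y‖ / ‖y‖) • innerSL ℝ y := by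
    have h1 : ∀ᶠ y in 𝓝 x, y ≠ 0 := isOpen_ne.mem_nhds hx
    have h2 : ∀ᶠ y : Euc N in 𝓝 x, ‖y‖ < 1 := (isOpen_lt continuous_norm continuous_const).mem_nhds hx1
    filter_upwards [h1, h2] with y hy hy1
    exact (radial_fderiv hu hy (hf _ ⟨norm_pos_iff.2 hy, hy1⟩)).fderiv
  have hc : HasDerivAt (fun r => f1 r / r) ((f2 * ‖x‖ - f1 ‖x‖ * 1) / ‖x‖ ^ 2) ‖x‖ :=
    hf1.fun_div (hasDerivAt_id _) hr.ne'
  have key : ∀ i : Fin N, iteratedFDeriv ℝ 2 u x ![EuclideanSpace.single i 1, EuclideanSpace.single i 1]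
      = ((f2 * ‖x‖ - f1 ‖x‖) / ‖x‖ ^ 2) / ‖x‖ * x i ^ 2 + f1 ‖x‖ / ‖x‖ := by
    intro i
    rw [iteratedFDeriv_two_apply]
    have ha : HasFDerivAt (fun y => fderiv ℝ u y (EuclideanSpace.single i 1))
        ((ContinuousLinearMap.apply ℝ ℝ (EuclideanSpace.single i (1:ℝ) : Euc N)).comp
          (fderiv ℝ (fderiv ℝ u) x)) x :=
      (ContinuousLinearMap.apply ℝ ℝ (EuclideanSpace.single i (1:ℝ) : Euc N)).hasFDerivAt.comp x
        hD.hasFDerivAt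
    have hb : HasFDerivAt (fun y : Euc N => (f1 ‖y‖ / ‖y‖) * y i)
        ((f1 ‖x‖ / ‖x‖) • (EuclideanSpace.proj i : Euc N →L[ℝ] ℝ) + x i • (((f2 * ‖x‖ - f1 ‖x‖ * 1) / ‖x‖ ^ 2) • (‖x‖⁻¹ • innerSL ℝ x))) x :=
      (hc.comp_hasFDerivAt x (nrm_hasFDerivAt hx)).fun_mul
        (EuclideanSpace.proj i : Euc N →L[ℝ] ℝ).hasFDerivAt
    have hab : (fun y => fderiv ℝ u y (EuclideanSpace.single i 1)) =ᶠ[𝓝 x]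
        (fun y : Euc N => (f1 ‖y‖ / ‖y‖) * y i) := by
      filter_upwards [hev] with y hy
      rw [hy]
      change (f1 ‖y‖ / ‖y‖) * inner ℝ y (EuclideanSpace.single i 1) = _
      rw [inner_single]
    have := (ha.congr_of_eventuallyEq hab.symm).unique hb
    have h3 := congrArg (fun L : Euc N →L[ℝ] ℝ => L (EuclideanSpace.single i 1)) this
    change fderiv ℝ (fderiv ℝ u) x (EuclideanSpace.single i 1) (EuclideanSpace.single i 1) =
      (f1 ‖x‖ / ‖x‖) * (EuclideanSpace.single i (1:ℝ) : Euc N) i + x i * (((f2 * ‖x‖ - f1 ‖x‖ * 1) / ‖x‖ ^ 2) * (‖x‖⁻¹ * inner ℝ x (EuclideanSpace.single i 1))) at h3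
    rw [inner_single] at h3
    simp only [Matrix.cons_val_zero, Matrix.cons_val_one] 
    rw [h3]
    simp
    field_simp
    ring
  unfold lap
  simp_rw [key]
  rw [Finset.sum_add_distrib, ← Finset.mul_sum, ← EuclideanSpace.real_norm_sq_eq]
  simp
  field_simp
  ring

lemma radial_sol (hN : 4 ≤ N) {α p : ℝ} (hα : 0 < α) (hp : 2 < p) {u : Euc N → ℝ} {f : ℝ → ℝ}
    (hu : ∀ x, u x = f ‖x‖) (huc : Continuous u)
    (hpos : ∀ x ∈ ball (0 : Euc N) 1, 0 < u x)
    (hreg : ∀ x ∈ ball (0 : Euc N) 1, ContDiffAt ℝ 2 u x)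
    (heq : ∀ x ∈ ball (0 : Euc N) 1, - lap u x = ‖x‖ ^ α * u x ^ (p - 1))
    (hbc : ∀ x ∉ ball (0 : Euc N) 1, u x = 0) :
    ∃ f1, RadSol (N - 2) α p f f1 := by
  set e : Euc N := EuclideanSpace.single ⟨0, by omega⟩ 1 with he
  have hen : ‖e‖ = 1 := by simp [he]
  have hne : ∀ r : ℝ, 0 ≤ r → ‖r • e‖ = r := fun r hr => by
    rw [norm_smul, hen, mul_one, Real.norm_of_nonneg hr]
  have hfr : ∀ r : ℝ, 0 ≤ r → f r = u (r • e) := fun r hr => by rw [hu, hne r hr]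
  have hmem : ∀ r ∈ Ioo (0:ℝ) 1, r • e ∈ ball (0 : Euc N) 1 := fun r hr => by
    rw [mem_ball_zero_iff, hne r hr.1.le]; exact hr.2
  have hline : ∀ r : ℝ, HasDerivAt (fun s : ℝ => s • e) e r := fun r => by
    simpa using (hasDerivAt_id r).smul_const e
  have hf : ∀ r ∈ Ioo (0:ℝ) 1, HasDerivAt f (fderiv ℝ u (r • e) e) r := by
    intro r hr
    have h1 : HasDerivAt (fun s : ℝ => u (s • e)) (fderiv ℝ u (r • e) e) r :=
      ((hreg _ (hmem r hr)).differentiableAt (by norm_num)).hasFDerivAt.comp_hasDerivAt r (hline r)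
    refine h1.congr_of_eventuallyEq ?_
    filter_upwards [Ioi_mem_nhds hr.1] with s hs using hfr s hs.le
  refine ⟨fun r => fderiv ℝ u (r • e) e, ?_⟩
  have huf : Continuous fun r : ℝ => u (r • e) := by fun_prop
  refine ⟨by omega, hα, hp, hf, ?_, ?_, ?_, ?_, ?_⟩
  · intro r hr
    have hD : DifferentiableAt ℝ (fderiv ℝ u) (r • e) :=
      ((hreg _ (hmem r hr)).fderiv_right (m := 1) (by norm_num)).differentiableAt (by norm_num)
    have h1 : HasDerivAt (fun s : ℝ => fderiv ℝ u (s • e) e) (fderiv ℝ (fderiv ℝ u) (r • e) e e) r :=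
      (ContinuousLinearMap.apply ℝ ℝ e).hasFDerivAt.comp_hasDerivAt r
        (hD.hasFDerivAt.comp_hasDerivAt r (hline r))
    have hx : r • e ≠ 0 := by rw [← norm_pos_iff, hne r hr.1.le]; exact hr.1
    have h2 := radial_ode hu hf hx (by rw [hne r hr.1.le]; exact hr.2) (hreg _ (hmem r hr))
      (f2 := fderiv ℝ (fderiv ℝ u) (r • e) e e) (by rw [hne r hr.1.le]; exact h1)
    have h3 := heq _ (hmem r hr)
    rw [h2, hne r hr.1.le, ← hfr r hr.1.le] at h3
    refine h1.congr_deriv ?_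
    have : ((N - 2 : ℕ) : ℝ) = N - 2 := by rw [Nat.cast_sub (by omega)]; norm_num
    rw [this]
    have e1 : (N:ℝ) - 2 + 1 = N - 1 := by ring
    rw [e1]
    linarith
  · intro r hr
    rw [hfr r hr.1.le]; exact hpos _ (hmem r hr)
  · obtain ⟨C, hC⟩ := (isCompact_Icc (a := (0:ℝ)) (b := 1)).exists_bound_of_continuousOn huf.continuousOn
    refine ⟨C, fun r hr => ?_⟩
    rw [hfr r hr.1.le]
    exact (le_abs_self _).trans (hC r ⟨hr.1.le, hr.2.le⟩)
  · have hc : ContinuousOn (fun r : ℝ => fderiv ℝ u (r • e) e) (Icc 0 (1/2)) := by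
      intro r hr
      have hm : r • e ∈ ball (0 : Euc N) 1 := by
        rw [mem_ball_zero_iff, hne r hr.1]; linarith [hr.2]
      have hD : ContinuousAt (fderiv ℝ u) (r • e) :=
        ((hreg _ hm).fderiv_right (m := 1) (by norm_num)).continuousAt
      have h1 : ContinuousAt (fun s : ℝ => fderiv ℝ u (s • e)) r :=
        ContinuousAt.comp (f := fun s : ℝ => s • e) hD (hline r).continuousAt
      exact (h1.clm_apply continuousAt_const).continuousWithinAt
    obtain ⟨C, hC⟩ := isCompact_Icc.exists_bound_of_continuousOn hc
    exact ⟨C, fun r hr h2 => hC r ⟨hr.1.le, h2⟩⟩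
  · have h1 : Tendsto (fun r : ℝ => u (r • e)) (𝓝[<] 1) (𝓝 (u ((1:ℝ) • e))) :=
      (huf.tendsto 1).mono_left nhdsWithin_le_nhds
    rw [hbc ((1:ℝ) • e) (by rw [mem_ball_zero_iff, hne 1 zero_le_one]; norm_num)] at h1
    refine h1.congr' ?_
    filter_upwards [Ioo_mem_nhdsLT one_pos] with r hr using (hfr r hr.1.le).symm

open scoped Topology
open Metric

def phi (n : ℕ) (d : ℝ) (x : Euc N) : ℝ :=
  (1 / ((n:ℝ) + 1) * (‖x‖ ^ 2) ^ 2 - qf n x ^ 2) / (d ^ 2 + ‖x‖ ^ 2) ^ 2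

lemma phi_eq (n : ℕ) (d : ℝ) (x : Euc N) : phi n d x = gd d ‖x‖ * hh n (Xf n x) := by
  unfold phi gd hh
  rw [qf_eq]; ring

lemma gd_bound {d : ℝ} (hd : 0 < d) {r : ℝ} (hr : 0 ≤ r) : 0 ≤ gd d r ∧ gd d r ≤ 1 := by
  unfold gd
  constructor
  · positivity
  · rw [← mul_div_assoc, div_le_one (by positivity)]
    nlinarith [sq_nonneg d, sq_nonneg r, mul_nonneg (sq_nonneg d) (sq_nonneg r), sq_nonneg (d^2)]

lemma hh_bound (n : ℕ) {X : ℝ} (hX : |X| ≤ 1) : |hh n X| ≤ 1 := by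
  unfold hh
  have h1 : X ^ 2 ≤ 1 := by rw [← sq_abs]; exact pow_le_one₀ (abs_nonneg _) hX
  have h2 : 1 / ((n:ℝ) + 1) ≤ 1 := by
    rw [div_le_one (by positivity)]; linarith [Nat.cast_nonneg (α := ℝ) n]
  have h3 : 0 ≤ 1 / ((n:ℝ) + 1) := by positivity
  rw [abs_le]; constructor <;> nlinarith [sq_nonneg X]

lemma phi_bound (n : ℕ) {d : ℝ} (hd : 0 < d) (x : Euc N) : |phi n d x| ≤ 1 := by
  rw [phi_eq, abs_mul]
  have h1 := gd_bound hd (norm_nonneg x)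
  have h2 := hh_bound n (abs_Xf_le n x)
  rw [abs_of_nonneg h1.1]
  exact mul_le_one₀ h1.2 (abs_nonneg _) h2

lemma nsq_hasFDerivAt (x : Euc N) :
    HasFDerivAt (fun y : Euc N => ‖y‖ ^ 2) ((2:ℝ) • innerSL ℝ x) x := by
  refine (hasStrictFDerivAt_norm_sq x).hasFDerivAt.congr_fderiv ?_
  rw [two_smul, two_smul]

lemma phi_hasFDerivAt (n : ℕ) {d : ℝ} (hd : 0 < d) (x : Euc N) :
    HasFDerivAt (phi n d)
      (innerSL ℝ ((4 * (1 / ((n:ℝ) + 1)) * ‖x‖ ^ 2 / (d ^ 2 + ‖x‖ ^ 2) ^ 2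
          - 4 * (1 / ((n:ℝ) + 1) * (‖x‖ ^ 2) ^ 2 - qf n x ^ 2) / (d ^ 2 + ‖x‖ ^ 2) ^ 3) • x
        + (-4 * qf n x / (d ^ 2 + ‖x‖ ^ 2) ^ 2) • Jv n x)) x := by
  have hD : d ^ 2 + ‖x‖ ^ 2 ≠ 0 := by positivity
  have h1 := ((nsq_hasFDerivAt x).pow 2).const_mul (1 / ((n:ℝ) + 1))
  have h2 := (qf_hasFDerivAt n x).pow 2
  have h3 := ((nsq_hasFDerivAt x).const_add (d ^ 2)).pow 2
  have h4 := (hasDerivAt_inv (pow_ne_zero 2 hD)).comp_hasFDerivAt x h3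
  have h5 := (h1.sub h2).mul h4
  have e : phi n d = ((fun y : Euc N => 1 / ((n:ℝ) + 1) * (‖y‖ ^ 2) ^ 2) - fun y => qf n y ^ 2) *
      ((fun y => y⁻¹) ∘ fun y : Euc N => (d ^ 2 + ‖y‖ ^ 2) ^ 2) := by
    funext y; simp [phi, div_eq_mul_inv]
  rw [e]
  refine h5.congr_fderiv ?_
  ext w
  simp [inner_add_left, inner_smul_left]
  field_simp
  ring

lemma phi_cont (n : ℕ) {d : ℝ} (hd : 0 < d) : Continuous (phi n d : Euc N → ℝ) := by
  rw [continuous_iff_continuousAt]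
  intro x; exact (phi_hasFDerivAt n hd x).continuousAt

lemma norm_comb (n : ℕ) (a b : ℝ) (x : Euc N) :
    ‖a • x + b • Jv n x‖ ^ 2 = a ^ 2 * ‖x‖ ^ 2 + 2 * a * b * qf n x + b ^ 2 * ‖x‖ ^ 2 := by
  rw [EuclideanSpace.real_norm_sq_eq, EuclideanSpace.real_norm_sq_eq, qf, Finset.mul_sum, Finset.mul_sum,
    Finset.mul_sum, ← Finset.sum_add_distrib, ← Finset.sum_add_distrib]
  refine Finset.sum_congr rfl fun j _ => ?_
  simp only [PiLp.add_apply, PiLp.smul_apply, Jv_apply, smul_eq_mul]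
  split_ifs <;> ring

def vt (n : ℕ) (d ε : ℝ) (u : Euc N → ℝ) (x : Euc N) : ℝ := u x * (1 + ε * phi n d x)

lemma grad_eq {v : Euc N → ℝ} {y x : Euc N} (h : HasFDerivAt v (innerSL ℝ y) x) : gradient v x = y := by
  have : HasGradientAt v y x := h
  exact this.gradient

lemma vt_grad (n : ℕ) {d : ℝ} (hd : 0 < d) (ε : ℝ) {u : Euc N → ℝ} {x : Euc N} (hx : x ≠ 0) {f f1 : ℝ}
    (hu : u x = f) (hu1 : HasFDerivAt u ((f1 / ‖x‖) • innerSL ℝ x) x) :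
    ‖gradient (vt n d ε u) x‖ ^ 2 =
      (f1 + ε * hh n (Xf n x) * (f1 * gd d ‖x‖ + f * g1d d ‖x‖)) ^ 2
      + ε ^ 2 * (f ^ 2 * kd d ‖x‖ ^ 2 * (16 * (Xf n x ^ 2 - Xf n x ^ 4))) := by
  have hr : 0 < ‖x‖ := norm_pos_iff.2 hx
  have hD : d ^ 2 + ‖x‖ ^ 2 ≠ 0 := by positivity
  have h := hu1.mul (((phi_hasFDerivAt n hd x).const_mul ε).const_add 1)
  set A := (4 * (1 / ((n:ℝ) + 1)) * ‖x‖ ^ 2 / (d ^ 2 + ‖x‖ ^ 2) ^ 2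
          - 4 * (1 / ((n:ℝ) + 1) * (‖x‖ ^ 2) ^ 2 - qf n x ^ 2) / (d ^ 2 + ‖x‖ ^ 2) ^ 3) with hA
  set B := (-4 * qf n x / (d ^ 2 + ‖x‖ ^ 2) ^ 2) with hB
  have h2 : HasFDerivAt (vt n d ε u) (innerSL ℝ (((1 + ε * phi n d x) * (f1 / ‖x‖) + ε * f * A) • x
      + (ε * f * B) • Jv n x)) x := by
    have e : vt n d ε u = u * fun y => 1 + ε * phi n d y := rfl
    rw [e]
    refine h.congr_fderiv ?_
    ext w
    simp [inner_add_left, inner_smul_left, hu]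
    ring
  rw [grad_eq h2, norm_comb, hA, hB, phi_eq, gd, g1d, kd, hh]
  have e0 : qf n x = ‖x‖ ^ 2 * Xf n x := qf_eq n x
  rw [e0]
  generalize Xf n x = X
  generalize hc : 1 / ((n:ℝ) + 1) = c
  generalize ‖x‖ = r at *
  field_simp
  ring

open scoped Topology
open Metric

lemma st_sq (n : ℕ) (x : Euc N) : sVar n x ^ 2 + tVar n x ^ 2 = ‖x‖ ^ 2 := by
  unfold sVar tVar
  rw [Real.sq_sqrt (Finset.sum_nonneg fun j _ => by split_ifs <;> positivity),
    Real.sq_sqrt (Finset.sum_nonneg fun j _ => by split_ifs <;> positivity),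
    EuclideanSpace.real_norm_sq_eq, ← Finset.sum_add_distrib]
  refine Finset.sum_congr rfl fun j _ => ?_
  by_cases h : (j:ℕ) < n
  · simp [h, not_le.2 h]
  · simp [h, not_lt.1 h]

lemma st_qf (n : ℕ) (x : Euc N) : sVar n x ^ 2 - tVar n x ^ 2 = qf n x := by
  unfold sVar tVar
  rw [Real.sq_sqrt (Finset.sum_nonneg fun j _ => by split_ifs <;> positivity),
    Real.sq_sqrt (Finset.sum_nonneg fun j _ => by split_ifs <;> positivity),
    qf, ← Finset.sum_sub_distrib]
  refine Finset.sum_congr rfl fun j _ => ?_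
  by_cases h : (j:ℕ) < n
  · simp [h, not_le.2 h]
  · simp [h, not_lt.1 h]

lemma vt_fac_nonneg (n : ℕ) {d ε : ℝ} (hd : 0 < d) (h0 : 0 ≤ ε) (h1 : ε ≤ 1) (x : Euc N) :
    0 ≤ 1 + ε * phi n d x := by
  have := abs_le.1 (phi_bound n hd x)
  nlinarith

lemma vt_mono {f : ℝ → ℝ} (hf : ∀ r, 0 ≤ r → 0 ≤ f r) {n : ℕ} {d ε : ℝ} (hd : 0 < d) (h0 : 0 ≤ ε) :
    ∃ w : ℝ → ℝ → ℝ,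
        (∀ x : Euc N, f ‖x‖ * (1 + ε * phi n d x) = w (sVar n x) (tVar n x)) ∧
        (∀ s t, w s t = w t s) ∧
        (∀ r θ₁ θ₂ : ℝ, 0 < θ₁ → θ₁ ≤ θ₂ → θ₂ < π / 4 →
          w (r * Real.cos θ₁) (r * Real.sin θ₁) ≤ w (r * Real.cos θ₂) (r * Real.sin θ₂)) := by
  refine ⟨fun s t => f (√(s ^ 2 + t ^ 2)) * (1 + ε * ((1 / ((n:ℝ) + 1) * (s ^ 2 + t ^ 2) ^ 2 - (s ^ 2 - t ^ 2) ^ 2)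
    / (d ^ 2 + (s ^ 2 + t ^ 2)) ^ 2)), ?_, ?_, ?_⟩
  · intro x
    simp only [st_sq, st_qf, phi]
    rw [Real.sqrt_sq (norm_nonneg x)]
  · intro s t
    simp only []
    rw [add_comm (s ^ 2), ← neg_sub (t ^ 2) (s ^ 2), neg_sq]
  · intro r θ₁ θ₂ h1 h2 h3
    have e1 : ∀ θ, (r * Real.cos θ) ^ 2 + (r * Real.sin θ) ^ 2 = r ^ 2 := fun θ => by
      have := Real.sin_sq_add_cos_sq θ
      linear_combination r ^ 2 * this
    have e2 : ∀ θ, (r * Real.cos θ) ^ 2 - (r * Real.sin θ) ^ 2 = r ^ 2 * Real.cos (2 * θ) := fun θ => by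
      rw [Real.cos_two_mul']; ring
    simp only [e1, e2]
    have hc : Real.cos (2 * θ₂) ≤ Real.cos (2 * θ₁) :=
      Real.cos_le_cos_of_nonneg_of_le_pi (by linarith) (by linarith [Real.pi_pos]) (by linarith)
    have hc0 : 0 ≤ Real.cos (2 * θ₂) := Real.cos_nonneg_of_mem_Icc ⟨by linarith [Real.pi_pos], by linarith⟩
    refine mul_le_mul_of_nonneg_left ?_ (hf _ (Real.sqrt_nonneg _))
    have : (r ^ 2 * Real.cos (2 * θ₂)) ^ 2 ≤ (r ^ 2 * Real.cos (2 * θ₁)) ^ 2 := by gcongr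
    gcongr

/-- the remaining integrals -/
lemma vt_integrals {n m : ℕ} (hN : N = 2 * n) (hn : 2 ≤ n) (hm : N = m + 2) {α p : ℝ} {f f1 : ℝ → ℝ}
    (h : RadSol m α p f f1) {d : ℝ} (hd : 0 < d) (ε : ℝ) {u : Euc N → ℝ} (hu : ∀ x, u x = f ‖x‖) :
    IntegrableOn (fun x => ‖gradient (vt n d ε u) x‖ ^ 2) (ball 0 1) ∧
    ∫ x in ball 0 1, ‖gradient (vt n d ε u) x‖ ^ 2 =
      sphI N n (fun _ => 1) * (∫ r in Ioo (0:ℝ) 1, r ^ (m+1) * f1 r ^ 2)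
      + ε ^ 2 * sphI N n (fun X => hh n X ^ 2) *
        ((∫ r in Ioo (0:ℝ) 1, r ^ (m+1) * ((f1 r * gd d r + f r * g1d d r) ^ 2))
          + 4 * ((N:ℝ) + 2) * (∫ r in Ioo (0:ℝ) 1, r ^ (m+1) * (f r ^ 2 * kd d r ^ 2))) := by
  have hN0 : N ≠ 0 := by omega
  have hm1 : N - 1 = m + 1 := by omega
  have hhc : Continuous (hh n) := by unfold hh; fun_prop
  obtain ⟨M1, M2, M3⟩ := moments n hN hn
  have bG : Bc (fun r => f1 r * gd d r + f r * g1d d r) :=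
    (h.bf1.mul (Bc.of_cont (gd_cont hd))).add (h.bf.mul (Bc.of_cont (g1d_cont hd)))
  have bp : Bc (fun r => r ^ (m+1)) := Bc.of_cont (by fun_prop)
  set F0 : ℝ → ℝ := fun r => f1 r ^ 2 with hF0
  set F1 : ℝ → ℝ := fun r => 2 * ε * (f1 r * (f1 r * gd d r + f r * g1d d r)) with hF1
  set F2 : ℝ → ℝ := fun r => ε ^ 2 * ((f1 r * gd d r + f r * g1d d r) ^ 2) with hF2
  set F3 : ℝ → ℝ := fun r => ε ^ 2 * (f r ^ 2 * kd d r ^ 2) with hF3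
  have b0 : Bc F0 := h.bf1.sq
  have b1 : Bc F1 := (h.bf1.mul bG).cmul _
  have b2 : Bc F2 := bG.sq.cmul _
  have b3 : Bc F3 := (h.bf.sq.mul (Bc.of_cont (kd_cont hd)).sq).cmul _
  have i0 := polar_integrable (N := N) n F0 (fun _ => 1) hN0 continuous_const (by rw [hm1]; exact (bp.mul b0).int)
  have i1 := polar_integrable (N := N) n F1 (hh n) hN0 hhc (by rw [hm1]; exact (bp.mul b1).int)
  have i2 := polar_integrable (N := N) n F2 (fun X => hh n X ^ 2) hN0 (by fun_prop) (by rw [hm1]; exact (bp.mul b2).int)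
  have i3 := polar_integrable (N := N) n F3 (fun X => 16*(X^2-X^4)) hN0 (by fun_prop) (by rw [hm1]; exact (bp.mul b3).int)
  have hev : (fun x => ‖gradient (vt n d ε u) x‖ ^ 2) =ᵐ[volume.restrict (ball (0 : Euc N) 1)]
      (fun x => F0 ‖x‖ * 1 + F1 ‖x‖ * hh n (Xf n x) + F2 ‖x‖ * hh n (Xf n x) ^ 2
        + F3 ‖x‖ * (16*(Xf n x^2-Xf n x^4))) := by
    have : Nontrivial (Euc N) := by
      have : Nonempty (Fin N) := ⟨⟨0, by omega⟩⟩
      infer_instance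
    have h0 : ∀ᵐ x ∂(volume.restrict (ball (0 : Euc N) 1)), x ≠ 0 :=
      ae_restrict_of_ae (compl_mem_ae_iff.2 (measure_singleton _))
    filter_upwards [h0, ae_restrict_mem measurableSet_ball] with x hx hx1
    rw [mem_ball_zero_iff] at hx1
    rw [vt_grad n hd ε hx (hu x) (radial_fderiv hu hx (h.hf _ ⟨norm_pos_iff.2 hx, hx1⟩))]
    simp only [hF0, hF1, hF2, hF3]
    ring
  refine ⟨(((i0.add i1).add i2).add i3).congr hev.symm, ?_⟩
  have j1 : IntegrableOn (fun x : Euc N => F0 ‖x‖ * 1 + F1 ‖x‖ * hh n (Xf n x)) (ball 0 1) := i0.add i1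
  have j2 : IntegrableOn (fun x : Euc N => F0 ‖x‖ * 1 + F1 ‖x‖ * hh n (Xf n x) + F2 ‖x‖ * hh n (Xf n x) ^ 2)
    (ball 0 1) := j1.add i2
  rw [integral_congr_ae hev, integral_add j2 i3, integral_add j1 i2, integral_add i0 i1,
    polar_int n F0 (fun _ => 1) hN0, polar_int n F1 (hh n) hN0, polar_int n F2 (fun X => hh n X ^ 2) hN0,
    polar_int n F3 (fun X => 16*(X^2-X^4)) hN0, M1, M3, hm1]
  have e2 : ∫ r in Ioo (0:ℝ) 1, r ^ (m+1) * F2 r = ε ^ 2 * ∫ r in Ioo (0:ℝ) 1, r ^ (m+1) * ((f1 r * gd d r + f r * g1d d r) ^ 2) := by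
    rw [← integral_const_mul]; congr 1; funext r; simp only [hF2]; ring
  have e3 : ∫ r in Ioo (0:ℝ) 1, r ^ (m+1) * F3 r = ε ^ 2 * ∫ r in Ioo (0:ℝ) 1, r ^ (m+1) * (f r ^ 2 * kd d r ^ 2) := by
    rw [← integral_const_mul]; congr 1; funext r; simp only [hF3]; ring
  rw [e2, e3]
  ring

lemma vt_K {n m : ℕ} (hN : N = 2 * n) (hn : 2 ≤ n) (hm : N = m + 2) {α p : ℝ} {f f1 : ℝ → ℝ}
    (h : RadSol m α p f f1) {d : ℝ} (hd : 0 < d) {ε : ℝ} (h0 : 0 ≤ ε) (h1 : ε ≤ 1) {u : Euc N → ℝ}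
    (hu : ∀ x, u x = f ‖x‖) (huc : Continuous u) (hu0 : ∀ x, 0 ≤ u x)
    (hud : ∀ x ∈ ball (0 : Euc N) 1, DifferentiableAt ℝ u x)
    (hbc : ∀ x ∉ ball (0 : Euc N) 1, u x = 0) :
    vt n d ε u ∈ Kplus n (ball (0 : Euc N) 1) := by
  have hf0 : ∀ r, 0 ≤ r → 0 ≤ f r := by
    intro r hr
    have := hu0 (r • (EuclideanSpace.single ⟨0, by omega⟩ 1 : Euc N))
    rw [hu, norm_smul] at this
    simpa [abs_of_nonneg hr] using this
  have hc : Continuous (vt n d ε u) := huc.mul (by have := phi_cont (N := N) n hd; fun_prop)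
  obtain ⟨w, w1, w2, w3⟩ := vt_mono (N := N) (n := n) (ε := ε) hf0 hd h0
  refine ⟨⟨hc, ?_, ?_, (vt_integrals hN hn hm h hd ε hu).1, ?_⟩, ?_, w, ?_, w2, ?_⟩
  · intro x hx
    exact (hud x hx).mul (((phi_hasFDerivAt n hd x).const_mul ε).const_add 1).differentiableAt
  · intro x hx
    simp [vt, hbc x hx]
  · exact ((hc.pow 2).locallyIntegrable.integrableOn_isCompact (isCompact_closedBall 0 1)).mono_set
      ball_subset_closedBall
  · intro x
    exact mul_nonneg (hu0 x) (vt_fac_nonneg n hd h0 h1 x)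
  · intro x
    rw [← w1, vt, hu]
  · intro r θ₁ θ₂ a b c _ _
    exact w3 r θ₁ θ₂ a b c

open scoped Topology
open Metric

lemma bern {p κ : ℝ} (hp : 2 < p) (hκ : κ < p - 1) :
    ∃ η > 0, η < 1 ∧ ∀ y : ℝ, |y| ≤ η → 1 + p * y + p * κ / 2 * y ^ 2 ≤ (1 + y) ^ p := by
  have hd : ∀ q : ℝ, 1 ≤ q → ∀ y : ℝ, HasDerivAt (fun y : ℝ => (1 + y) ^ q) (q * (1 + y) ^ (q - 1)) y := by
    intro q hq y
    have := ((hasDerivAt_id y).const_add 1).rpow_const (p := q) (Or.inr hq)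
    refine this.congr_deriv ?_
    simp
  have h0 := hd (p - 1) (by linarith) 0
  rw [hasDerivAt_iff_isLittleO] at h0
  have h1 := h0.def (sub_pos.2 hκ)
  obtain ⟨η, hη, hball⟩ := Metric.eventually_nhds_iff.1 h1
  have hL : ∀ y : ℝ, |y| < η → y ≤ 0 → (1 + y) ^ (p - 1) ≤ 1 + κ * y := by
    intro y hy hy0
    have := hball (y := y) (by simpa using hy)
    simp at this
    rw [abs_of_nonpos hy0] at this
    have := (abs_le.1 this).2
    nlinarith
  set G : ℝ → ℝ := fun y => (1 + y) ^ p - (1 + p * y + p * κ / 2 * y ^ 2) with hG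
  have hGd : ∀ y, HasDerivAt G (p * ((1 + y) ^ (p - 1) - (1 + κ * y))) y := by
    intro y
    have a1 : HasDerivAt (fun y : ℝ => 1 + p * y + p * κ / 2 * y ^ 2) (p + p * κ / 2 * (2 * y)) y := by
      have b1 := ((hasDerivAt_id y).const_mul p).const_add 1
      have b2 := ((hasDerivAt_id y).fun_pow 2).const_mul (p * κ / 2)
      refine (b1.fun_add b2).congr_deriv ?_
      simp
    refine ((hd p (by linarith) y).fun_sub a1).congr_deriv ?_
    ring
  have hGc : Continuous G := by
    rw [continuous_iff_continuousAt]; exact fun y => (hGd y).continuousAt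
  have hG0 : G 0 = 0 := by simp [hG]
  refine ⟨min (η / 2) (1 / 2), by positivity, by linarith [min_le_right (η/2) (1/2)], fun y hy => ?_⟩
  have hyη : |y| < η := by linarith [min_le_left (η/2) (1/2)]
  suffices 0 ≤ G y by simpa [hG] using this
  rcases le_total 0 y with h | h
  · have hm : MonotoneOn G (Icc 0 y) := by
      refine monotoneOn_of_deriv_nonneg (convex_Icc 0 y) hGc.continuousOn
        (fun z _ => (hGd z).differentiableAt.differentiableWithinAt) fun z hz => ?_
      rw [interior_Icc] at hz
      rw [(hGd z).deriv]
      refine mul_nonneg (by linarith) ?_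
      have := one_add_mul_self_le_rpow_one_add (s := z) (by linarith [hz.1]) (p := p - 1) (by linarith)
      nlinarith [hz.1]
    have := hm (left_mem_Icc.2 h) (right_mem_Icc.2 h) h
    rwa [hG0] at this
  · have hm : AntitoneOn G (Icc y 0) := by
      refine antitoneOn_of_deriv_nonpos (convex_Icc y 0) hGc.continuousOn
        (fun z _ => (hGd z).differentiableAt.differentiableWithinAt) fun z hz => ?_
      rw [interior_Icc] at hz
      rw [(hGd z).deriv]
      refine mul_nonpos_of_nonneg_of_nonpos (by linarith) ?_
      have := hL z (by rw [abs_of_neg hz.2]; rw [abs_of_nonpos h] at hyη; linarith [hz.1]) hz.2.le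
      linarith
    have := hm (left_mem_Icc.2 h) (right_mem_Icc.2 h) h
    rwa [hG0] at this

lemma vt_B {n m : ℕ} (hN : N = 2 * n) (hn : 2 ≤ n) (hm : N = m + 2) {α p : ℝ} {f f1 : ℝ → ℝ}
    (h : RadSol m α p f f1) {d : ℝ} (hd : 0 < d) {ε η K : ℝ} (h0 : 0 ≤ ε) (h1 : ε ≤ η) (hη : η < 1)
    (hK : ∀ y : ℝ, |y| ≤ η → 1 + p * y + K * y ^ 2 ≤ (1 + y) ^ p) {u : Euc N → ℝ}
    (hu : ∀ x, u x = f ‖x‖) (huc : Continuous u) (hu0 : ∀ x, 0 ≤ u x) :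
    sphI N n (fun _ => 1) * (∫ r in Ioo (0:ℝ) 1, r ^ (m+1) * (r ^ α * f r ^ p))
      + ε ^ 2 * K * sphI N n (fun X => hh n X ^ 2) *
        (∫ r in Ioo (0:ℝ) 1, r ^ (m+1) * (r ^ α * f r ^ p * gd d r ^ 2)) ≤
    ∫ x in ball (0 : Euc N) 1, ‖x‖ ^ α * |vt n d ε u x| ^ p := by
  have hN0 : N ≠ 0 := by omega
  have hm1 : N - 1 = m + 1 := by omega
  have hα := h.hα
  have hp := h.hp
  have hhc : Continuous (hh n) := by unfold hh; fun_prop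
  obtain ⟨M1, M2, M3⟩ := moments n hN hn
  have bp : Bc (fun r => r ^ (m+1)) := Bc.of_cont (by fun_prop)
  have bF : Bc (fun r => r ^ α * f r ^ p) := h.bra.mul (h.bpow (by linarith))
  have bg : Bc (gd d) := Bc.of_cont (gd_cont hd)
  set F0 : ℝ → ℝ := fun r => r ^ α * f r ^ p with hF0
  set F1 : ℝ → ℝ := fun r => p * ε * (r ^ α * f r ^ p * gd d r) with hF1
  set F2 : ℝ → ℝ := fun r => ε ^ 2 * K * (r ^ α * f r ^ p * gd d r ^ 2) with hF2
  have b1 : Bc F1 := (bF.mul bg).cmul _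
  have b2 : Bc F2 := (bF.mul bg.sq).cmul _
  have i0 := polar_integrable (N := N) n F0 (fun _ => 1) hN0 continuous_const (by rw [hm1]; exact (bp.mul bF).int)
  have i1 := polar_integrable (N := N) n F1 (hh n) hN0 hhc (by rw [hm1]; exact (bp.mul b1).int)
  have i2 := polar_integrable (N := N) n F2 (fun X => hh n X ^ 2) hN0 (by fun_prop) (by rw [hm1]; exact (bp.mul b2).int)
  have j1 : IntegrableOn (fun x : Euc N => F0 ‖x‖ * 1 + F1 ‖x‖ * hh n (Xf n x)) (ball 0 1) := i0.add i1
  have j2 : IntegrableOn (fun x : Euc N => F0 ‖x‖ * 1 + F1 ‖x‖ * hh n (Xf n x) + F2 ‖x‖ * hh n (Xf n x) ^ 2)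
    (ball 0 1) := j1.add i2
  have hc : Continuous (vt n d ε u) := huc.mul (by have := phi_cont (N := N) n hd; fun_prop)
  have hcc : Continuous (fun x => ‖x‖ ^ α * |vt n d ε u x| ^ p) :=
    (continuous_norm.rpow_const fun _ => Or.inr hα.le).mul (hc.abs.rpow_const fun _ => Or.inr (by linarith))
  have jv : IntegrableOn (fun x => ‖x‖ ^ α * |vt n d ε u x| ^ p) (ball 0 1) :=
    (hcc.locallyIntegrable.integrableOn_isCompact (isCompact_closedBall 0 1)).mono_set ball_subset_closedBall
  have hle := setIntegral_mono j2 jv (fun x => by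
    have hb := phi_bound n hd x
    have hy : |ε * phi n d x| ≤ η := by
      rw [abs_mul, abs_of_nonneg h0]
      nlinarith [abs_nonneg (phi n d x)]
    have hk := hK _ hy
    have hpos : 0 ≤ 1 + ε * phi n d x := by linarith [(abs_le.1 hy).1]
    have e : |vt n d ε u x| ^ p = f ‖x‖ ^ p * (1 + ε * phi n d x) ^ p := by
      rw [vt, abs_of_nonneg (mul_nonneg (hu0 x) hpos), Real.mul_rpow (hu0 x) hpos, hu]
    have hfn : 0 ≤ f ‖x‖ := hu x ▸ hu0 x
    simp only [hF0, hF1, hF2]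
    rw [e]
    have := mul_le_mul_of_nonneg_left hk (show 0 ≤ ‖x‖ ^ α * f ‖x‖ ^ p by positivity)
    rw [phi_eq] at this ⊢
    calc _ = ‖x‖ ^ α * f ‖x‖ ^ p * (1 + p * (ε * (gd d ‖x‖ * hh n (Xf n x))) + K * (ε * (gd d ‖x‖ * hh n (Xf n x))) ^ 2) := by ring
      _ ≤ _ := this
      _ = _ := by ring)
  refine le_trans (le_of_eq ?_) hle
  rw [integral_add j1 i2, integral_add i0 i1,
    polar_int n F0 (fun _ => 1) hN0, polar_int n F1 (hh n) hN0, polar_int n F2 (fun X => hh n X ^ 2) hN0, M1, hm1]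
  have e2 : ∫ r in Ioo (0:ℝ) 1, r ^ (m+1) * F2 r = ε ^ 2 * K * ∫ r in Ioo (0:ℝ) 1, r ^ (m+1) * (r ^ α * f r ^ p * gd d r ^ 2) := by
    rw [← integral_const_mul]; congr 1; funext r; simp only [hF2]; ring
  rw [e2]
  ring

open scoped Topology
open Metric

lemma sc1 {p Q L κS : ℝ} (hp : 2 < p) (hL : L = p / 2 * κS) (hQ : Q < κS) :
    ∃ z0 > 0, ∀ z : ℝ, 0 < z → z < z0 → 1 + z * Q < (1 + z * L) ^ (2 / p) := by
  have h1 : HasDerivAt (fun z : ℝ => (1 + z * L) ^ (2 / p)) κS 0 := by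
    have := (((hasDerivAt_id (0:ℝ)).mul_const L).const_add 1).rpow_const (p := 2 / p) (Or.inl (by simp))
    refine this.congr_deriv ?_
    simp [hL]
    have : p ≠ 0 := by linarith
    field_simp
  rw [hasDerivAt_iff_isLittleO] at h1
  have h2 := h1.def (show 0 < (κS - Q) / 2 by linarith)
  obtain ⟨η, hη, hball⟩ := Metric.eventually_nhds_iff.1 h2
  refine ⟨η, hη, fun z hz hzη => ?_⟩
  have := hball (y := z) (by simpa [abs_of_pos hz] using hzη)
  simp at this
  rw [abs_of_pos hz] at this
  have := (abs_le.1 this).1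
  nlinarith

lemma sc2 {p a b : ℝ} (hp : 2 < p) (ha : 0 ≤ a) (hb : 0 < b) (hab : a < b ^ (2 / p)) :
    ∃ l, l < 1 ∧ ∀ τ : ℝ, 0 ≤ τ → τ ^ 2 * a / 2 - τ ^ p * b / p ≤ l * (1 / 2 - 1 / p) := by
  have hp0 : 0 < p := by linarith
  set β := b ^ (1 / p) with hβ
  have hβ0 : 0 < β := by positivity
  have e1 : β ^ p = b := by rw [hβ, ← Real.rpow_mul hb.le, one_div_mul_cancel hp0.ne', Real.rpow_one]
  have e2 : β ^ 2 = b ^ (2 / p) := by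
    rw [hβ, ← Real.rpow_natCast, ← Real.rpow_mul hb.le]; congr 1; push_cast; ring
  rw [← e2] at hab
  have hl : a / β ^ 2 < 1 := (div_lt_one (by positivity)).2 hab
  have hl0 : 0 ≤ a / β ^ 2 := by positivity
  refine ⟨a / β ^ 2, hl, fun τ hτ => ?_⟩
  have e3 : τ ^ 2 * a = (a / β ^ 2) * (τ * β) ^ 2 := by field_simp
  have e4 : τ ^ p * b = (τ * β) ^ p := by rw [Real.mul_rpow hτ hβ0.le, e1]
  rw [e3, e4]
  set y := τ * β
  have hy : 0 ≤ y := by positivity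
  have hyp : 0 ≤ y ^ p := by positivity
  have e5 : y ^ p = (1 + (y ^ 2 - 1)) ^ (p / 2) := by
    rw [add_sub_cancel, ← Real.rpow_natCast, ← Real.rpow_mul hy]; congr 1; push_cast; ring
  have h6 := one_add_mul_self_le_rpow_one_add (s := y ^ 2 - 1) (by nlinarith) (p := p / 2) (by linarith)
  rw [← e5] at h6
  have h7 : y ^ 2 / 2 - y ^ p / p ≤ 1 / 2 - 1 / p := by
    have : (1 + p / 2 * (y ^ 2 - 1)) / p ≤ y ^ p / p := by gcongr
    have e : (1 + p / 2 * (y ^ 2 - 1)) / p = 1 / p + (y ^ 2 - 1) / 2 := by field_simp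
    linarith
  have h8 : 0 ≤ (1 - a / β ^ 2) * (y ^ p / p) := mul_nonneg (by linarith) (by positivity)
  have h9 := mul_le_mul_of_nonneg_left h7 hl0
  linarith

lemma grad_smul {v : Euc N → ℝ} {x : Euc N} (c : ℝ) (hv : DifferentiableAt ℝ v x) :
    gradient (c • v) x = c • gradient v x := by
  unfold gradient
  rw [fderiv_const_smul hv]
  simp

lemma int_grad_smul {v : Euc N → ℝ} (c : ℝ) (hv : ∀ x ∈ ball (0 : Euc N) 1, DifferentiableAt ℝ v x) :
    ∫ x in ball (0 : Euc N) 1, ‖gradient (c • v) x‖ ^ 2 = c ^ 2 * ∫ x in ball (0 : Euc N) 1, ‖gradient v x‖ ^ 2 := by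
  rw [← integral_const_mul]
  refine setIntegral_congr_fun measurableSet_ball fun x hx => ?_
  rw [grad_smul c (hv x hx), norm_smul, mul_pow, Real.norm_eq_abs, sq_abs]

lemma int_pow_smul {v : Euc N → ℝ} (a : Euc N → ℝ) (p c : ℝ) :
    ∫ x in ball (0 : Euc N) 1, a x * |(c • v) x| ^ p = |c| ^ p * ∫ x in ball (0 : Euc N) 1, a x * |v x| ^ p := by
  rw [← integral_const_mul]
  refine setIntegral_congr_fun measurableSet_ball fun x hx => ?_
  simp only [Pi.smul_apply, smul_eq_mul]
  rw [abs_mul, Real.mul_rpow (abs_nonneg _) (abs_nonneg _)]; ring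

lemma vnorm_smul {v : Euc N → ℝ} {a : Euc N → ℝ} {p : ℝ} (hp : 0 < p) (ha : ∀ x, 0 ≤ a x) (c : ℝ)
    (hv : ∀ x ∈ ball (0 : Euc N) 1, DifferentiableAt ℝ v x) :
    vnorm (ball (0 : Euc N) 1) a p (c • v) = |c| * vnorm (ball (0 : Euc N) 1) a p v := by
  unfold vnorm
  rw [int_pow_smul]
  have : ∫ x in ball (0 : Euc N) 1, (‖gradient (c • v) x‖ ^ 2 + (c • v) x ^ 2) =
      |c| ^ 2 * ∫ x in ball (0 : Euc N) 1, (‖gradient v x‖ ^ 2 + v x ^ 2) := by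
    rw [← integral_const_mul]
    refine setIntegral_congr_fun measurableSet_ball fun x hx => ?_
    simp only [Pi.smul_apply, smul_eq_mul]
    rw [grad_smul c (hv x hx), norm_smul, Real.norm_eq_abs, sq_abs, mul_pow, mul_pow, sq_abs]; ring
  rw [this, Real.mul_rpow (by positivity) (integral_nonneg fun x => by positivity),
    Real.mul_rpow (by positivity) (integral_nonneg fun x => mul_nonneg (ha x) (by positivity)),
    ← Real.rpow_mul (abs_nonneg c), ← Real.rpow_natCast, ← Real.rpow_mul (abs_nonneg c),
    mul_one_div_cancel hp.ne']
  norm_num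
  ring

lemma Kplus_smul {n : ℕ} {v : Euc N → ℝ} (hv : v ∈ Kplus n (ball (0 : Euc N) 1)) {c : ℝ} (hc : 0 ≤ c) :
    c • v ∈ Kplus n (ball (0 : Euc N) 1) := by
  obtain ⟨⟨h1, h2, h3, h4, h5⟩, h6, w, w1, w2, w3⟩ := hv
  refine ⟨⟨h1.const_smul c, fun x hx => (h2 x hx).const_smul c, fun x hx => by simp [h3 x hx], ?_, ?_⟩,
    fun x => mul_nonneg hc (h6 x), fun s t => c * w s t, fun x => by simp [w1 x], fun s t => by simp only [w2 s t],
    fun r a b i j k l q => mul_le_mul_of_nonneg_left (w3 r a b i j k l q) hc⟩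
  · refine (h4.const_mul (c ^ 2)).congr ?_
    filter_upwards [ae_restrict_mem measurableSet_ball] with x hx
    rw [grad_smul c (h2 x hx), norm_smul, mul_pow, Real.norm_eq_abs, sq_abs]
  · refine (h5.const_mul (c ^ 2)).congr (.of_forall fun x => ?_)
    simp only [Pi.smul_apply, smul_eq_mul]; ring

lemma mp {n : ℕ} {v : Euc N → ℝ} (hv : v ∈ Kplus n (ball (0 : Euc N) 1)) {a : Euc N → ℝ} {p : ℝ}
    (hp : 2 < p) (ha : ∀ x, 0 ≤ a x) {A B C : ℝ}
    (hA : ∫ x in ball (0 : Euc N) 1, ‖gradient v x‖ ^ 2 = A)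
    (hB : ∫ x in ball (0 : Euc N) 1, a x * |v x| ^ p = B) (hB0 : 0 < B)
    (hC : ∀ τ : ℝ, 0 ≤ τ → τ ^ 2 * A / 2 - τ ^ p * B / p ≤ C) :
    mountainPassLevel (ball (0 : Euc N) 1) a p (Kplus n (ball (0 : Euc N) 1)) ≤ C := by
  have hp0 : 0 < p := by linarith
  have hvd := hv.1.2.1
  have hE : ∀ τ : ℝ, 0 ≤ τ → energy (ball (0 : Euc N) 1) a p (τ • v) = τ ^ 2 * A / 2 - τ ^ p * B / p := by
    intro τ hτ
    unfold energy
    rw [int_grad_smul τ hvd, int_pow_smul, hA, hB, abs_of_nonneg hτ]; ring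
  obtain ⟨T, hT0, hT⟩ : ∃ T : ℝ, 0 < T ∧ T ^ 2 * A / 2 - T ^ p * B / p ≤ 0 := by
    have h1 := tendsto_rpow_atTop (show 0 < p - 2 by linarith)
    obtain ⟨T, hT1, hT2⟩ := ((h1.eventually_ge_atTop (p * A / (2 * B))).and (eventually_gt_atTop 0)).exists
    refine ⟨T, hT2, ?_⟩
    have e : T ^ p = T ^ 2 * T ^ (p - 2) := by
      rw [← Real.rpow_natCast T 2, ← Real.rpow_add hT2]; congr 1; push_cast; ring
    rw [div_le_iff₀ (by positivity)] at hT1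
    have : A / 2 ≤ T ^ (p - 2) * B / p := by rw [le_div_iff₀ hp0]; linarith
    have := mul_le_mul_of_nonneg_left this (sq_nonneg T)
    rw [e]
    have e3 : T ^ 2 * T ^ (p - 2) * B / p = T ^ 2 * (T ^ (p - 2) * B / p) := by ring
    linarith
  have hz : energy (ball (0 : Euc N) 1) a p 0 = 0 := by
    have := hE 0 le_rfl
    rw [zero_smul] at this
    rw [this]
    simp [Real.zero_rpow hp0.ne']
  have hv0 : v ≠ 0 := by
    rintro rfl
    simp [Real.zero_rpow hp0.ne'] at hB
    linarith
  unfold mountainPassLevel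
  refine le_trans (csInf_le (a := sSup ((fun t : ℝ => energy (ball (0 : Euc N) 1) a p ((t * T) • v)) '' Icc (0 : ℝ) 1))
    ?_ ⟨fun t => (t * T) • v, ?_, ?_, ?_, ?_, ?_, rfl⟩) ?_
  · refine ⟨0, ?_⟩
    rintro c ⟨γ, -, -, h0, -, -, rfl⟩
    by_cases hb : BddAbove ((fun t => energy (ball (0 : Euc N) 1) a p (γ t)) '' Icc (0 : ℝ) 1)
    · refine le_csSup hb ⟨0, by simp, ?_⟩
      simp only [h0, hz]
    · rw [Real.sSup_of_not_bddAbove hb]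
  · intro t ht
    exact Kplus_smul hv (mul_nonneg ht.1 hT0.le)
  · intro t ht ε hε
    set V := vnorm (ball (0 : Euc N) 1) a p v with hV
    refine ⟨ε / (T * |V| + 1), by positivity, fun s hs hst => ?_⟩
    have e : (s * T) • v - (t * T) • v = ((s - t) * T) • v := by rw [← sub_smul]; ring_nf
    simp only []
    rw [e, vnorm_smul hp0 ha _ hvd, abs_mul, abs_of_pos hT0, ← hV]
    rw [lt_div_iff₀ (by positivity)] at hst
    have h1 : V ≤ |V| := le_abs_self V
    have h2 : |s - t| * T * V ≤ |s - t| * T * |V| := mul_le_mul_of_nonneg_left h1 (by positivity)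
    nlinarith [abs_nonneg (s - t)]
  · simp
  · simp only [one_mul]
    exact smul_ne_zero hT0.ne' hv0
  · simp only [one_mul]
    rw [hE T hT0.le]; exact hT
  · refine csSup_le ⟨_, 0, by simp, rfl⟩ ?_
    rintro _ ⟨t, ht, rfl⟩
    have h1 := mul_nonneg ht.1 hT0.le
    simp only []
    rw [hE _ h1]
    exact hC _ h1

open scoped Topology
open Metric

lemma final_aux {n m : ℕ} (hN : N = 2 * n) (hn : 2 ≤ n) (hm : N = m + 2) {α p : ℝ} {f f1 : ℝ → ℝ}
    (h : RadSol m α p f f1) (hμ : 4 * ((N:ℝ) + 2) < (p - 2) * ((m:ℝ) ^ 2 / 4)) {u : Euc N → ℝ}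
    (hu : ∀ x, u x = f ‖x‖) (huc : Continuous u) (hu0 : ∀ x, 0 ≤ u x)
    (hud : ∀ x ∈ ball (0 : Euc N) 1, DifferentiableAt ℝ u x)
    (hbc : ∀ x ∉ ball (0 : Euc N) 1, u x = 0)
    (hpos : 0 < energy (ball (0 : Euc N) 1) (fun x => ‖x‖ ^ α) p u) :
    mountainPassLevel (ball (0 : Euc N) 1) (fun x => ‖x‖ ^ α) p (Kplus n (ball (0 : Euc N) 1))
      < energy (ball (0 : Euc N) 1) (fun x => ‖x‖ ^ α) p u := by
  have hN0 : N ≠ 0 := by omega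
  have hm1 : N - 1 = m + 1 := by omega
  have hp := h.hp
  obtain ⟨d, hd, hst⟩ := h.strict _ hμ
  obtain ⟨M1, M2, M3⟩ := moments n hN hn
  have hM0 := sphI_one_pos (N := N) n hN0
  set M0 := sphI N n (fun _ => 1)
  set m2 := sphI N n (fun X => hh n X ^ 2)
  set A0 := M0 * ∫ r in Ioo (0:ℝ) 1, r ^ (m+1) * f1 r ^ 2 with hA0
  have hA0' : A0 = M0 * ∫ r in Ioo (0:ℝ) 1, r ^ (m+1) * (r ^ α * f r ^ p) := by rw [hA0, h.energy_id]
  set S := ∫ r in Ioo (0:ℝ) 1, r ^ (m+1) * (r ^ α * f r ^ p * gd d r ^ 2) with hS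
  set Q := (∫ r in Ioo (0:ℝ) 1, r ^ (m+1) * ((f1 r * gd d r + f r * g1d d r) ^ 2))
          + 4 * ((N:ℝ) + 2) * (∫ r in Ioo (0:ℝ) 1, r ^ (m+1) * (f r ^ 2 * kd d r ^ 2)) with hQ
  have hE : energy (ball (0 : Euc N) 1) (fun x => ‖x‖ ^ α) p u = (1 / 2 - 1 / p) * A0 := by
    have h1 := (vt_integrals hN hn hm h hd 0 hu).2
    have e : vt n d 0 u = u := by funext x; simp [vt]
    rw [e] at h1
    have h2 : ∫ x in ball (0 : Euc N) 1, ‖x‖ ^ α * |u x| ^ p = A0 := by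
      have := polar_int (N := N) n (fun r => r ^ α * f r ^ p) (fun _ => 1) hN0
      rw [hm1] at this
      rw [hA0', ← this]
      congr 1; funext x
      rw [abs_of_nonneg (hu0 x), hu, mul_one]
    unfold energy
    rw [h1, h2]
    simp only [hA0]
    ring
  have hp' : 0 < 1 / 2 - 1 / p := by
    have : 1 / p < 1 / 2 := by gcongr
    linarith
  have hA0pos : 0 < A0 := by
    rw [hE] at hpos
    exact (pos_iff_pos_of_mul_pos hpos).1 hp'
  have hQ0 : 0 ≤ Q := by
    refine add_nonneg (setIntegral_nonneg measurableSet_Ioo fun r hr => ?_)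
      (mul_nonneg (by positivity) (setIntegral_nonneg measurableSet_Ioo fun r hr => ?_))
    · have := hr.1; positivity
    · have := hr.1; positivity
  have hSpos : 0 < S := (pos_iff_pos_of_mul_pos (hQ0.trans_lt hst)).1 (by linarith)
  obtain ⟨κ, hκ1, hκ2⟩ := exists_between ((div_lt_iff₀ hSpos).2 hst)
  rw [div_lt_iff₀ hSpos] at hκ1
  obtain ⟨η, hη, hη1, hb⟩ := bern hp hκ2
  obtain ⟨z0, hz0, hz⟩ := sc1 (L := p / 2 * (κ * S)) hp rfl hκ1
  obtain ⟨ε, hε0, hεη, hεz⟩ : ∃ ε > 0, ε ≤ η ∧ ε ^ 2 * m2 / A0 < z0 := by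
    have hc : Tendsto (fun ε : ℝ => ε ^ 2 * m2 / A0) (𝓝[>] 0) (𝓝 0) := by
      have : Continuous (fun ε : ℝ => ε ^ 2 * m2 / A0) := by fun_prop
      have := this.tendsto 0
      simp at this
      exact this.mono_left nhdsWithin_le_nhds
    obtain ⟨ε, h1, h2⟩ := ((hc.eventually_lt_const hz0).and (Ioo_mem_nhdsGT hη)).exists
    exact ⟨ε, h2.1, h2.2.le, h1⟩
  set z := ε ^ 2 * m2 / A0 with hzdef
  have hzpos : 0 < z := by positivity
  have hz1 := hz z hzpos hεz
  have hκpos : 0 < κ * S := hQ0.trans_lt hκ1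
  have hzA : z * A0 = ε ^ 2 * m2 := by rw [hzdef]; field_simp
  have hbpos : 0 < 1 + z * (p / 2 * (κ * S)) := by positivity
  obtain ⟨l, hl, hle⟩ := sc2 hp (by positivity) hbpos hz1
  have hA := (vt_integrals hN hn hm h hd ε hu).2
  have hB := vt_B hN hn hm h hd hε0.le hεη hη1 hb hu huc hu0
  have hAeq : ∫ x in ball (0 : Euc N) 1, ‖gradient (vt n d ε u) x‖ ^ 2 = A0 * (1 + z * Q) := by
    rw [hA, ← hQ, ← hA0]
    linear_combination (-Q) * hzA
  have hBge : A0 * (1 + z * (p / 2 * (κ * S))) ≤ ∫ x in ball (0 : Euc N) 1, ‖x‖ ^ α * |vt n d ε u x| ^ p := by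
    refine le_trans (le_of_eq ?_) hB
    rw [← hA0', ← hS]
    linear_combination (p / 2 * (κ * S)) * hzA
  have hmp := mp (C := A0 * (l * (1 / 2 - 1 / p))) (vt_K hN hn hm h hd hε0.le (hεη.trans hη1.le) hu huc hu0 hud hbc)
    (a := fun x => ‖x‖ ^ α) hp (fun x => by positivity) hAeq rfl
    (lt_of_lt_of_le (by positivity) hBge) (fun τ hτ => by
      have h1 := mul_le_mul_of_nonneg_left (hle τ hτ) hA0pos.le
      have h2 : τ ^ p * (A0 * (1 + z * (p / 2 * (κ * S)))) / p ≤
        τ ^ p * (∫ x in ball (0 : Euc N) 1, ‖x‖ ^ α * |vt n d ε u x| ^ p) / p := by gcongr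
      calc _ ≤ τ ^ 2 * (A0 * (1 + z * Q)) / 2 - τ ^ p * (A0 * (1 + z * (p / 2 * (κ * S)))) / p := by
            linarith
        _ = A0 * (τ ^ 2 * (1 + z * Q) / 2 - τ ^ p * (1 + z * (p / 2 * (κ * S))) / p) := by ring
        _ ≤ _ := h1)
  refine hmp.trans_lt ?_
  rw [hE]
  have := mul_pos hA0pos hp'
  nlinarith

/-- Theorem 5.1, part 2: for `16(N+2)/(N−2)² + 2 < p < (2N+2α)/(N−2)`,
the positive classical `K₊` ground state solution of the Hénon equation
`−Δu = |x|^α u^{p−1}` on the unit ball of `ℝ^N`, `N = 2n ≥ 4` even, `α > 0`, is nonradial. -/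
theorem statement9
    (n N : ℕ) (hn : 2 ≤ n) (hN : N = 2 * n)
    (B1 : Set (Euc N)) (hB1 : B1 = Metric.ball (0 : Euc N) 1)
    (α : ℝ) (hα : 0 < α)
    (p : ℝ) (hp1 : 16 * ((N : ℝ) + 2) / ((N : ℝ) - 2) ^ 2 + 2 < p)
    (hp2 : p < (2 * N + 2 * α) / ((N : ℝ) - 2))
    (u : Euc N → ℝ)
    (hu_gs : IsGroundState B1 (fun x => ‖x‖ ^ α) p (Kplus n B1) u)
    (hu_pos : ∀ x ∈ B1, 0 < u x)
    (hu_reg : ∀ x ∈ B1, ContDiffAt ℝ 2 u x)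
    (hu_eq : ∀ x ∈ B1, - lap u x = ‖x‖ ^ α * u x ^ (p - 1))
    (hu_bc : ∀ x ∉ B1, u x = 0) :
    ¬ IsRadial u := by
  rintro ⟨f, hu⟩
  subst hB1
  have hn' : (2:ℝ) ≤ n := by exact_mod_cast hn
  have hNr : (N:ℝ) = 2 * n := by rw [hN]; push_cast; ring
  have hN2 : (0:ℝ) < ((N:ℝ) - 2) ^ 2 := by
    have : (0:ℝ) < (N:ℝ) - 2 := by linarith
    positivity
  have hμ : 4 * ((N:ℝ) + 2) < (p - 2) * (((N - 2 : ℕ) : ℝ) ^ 2 / 4) := by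
    have e : ((N - 2 : ℕ) : ℝ) = N - 2 := by rw [Nat.cast_sub (by omega)]; norm_num
    rw [e]
    have h1 : 16 * ((N : ℝ) + 2) / ((N : ℝ) - 2) ^ 2 < p - 2 := by linarith
    rw [div_lt_iff₀ hN2] at h1
    linarith
  have hp : 2 < p := by
    have : 0 < 16 * ((N : ℝ) + 2) / ((N : ℝ) - 2) ^ 2 := by positivity
    linarith
  obtain ⟨hK, hpos, hlev⟩ := hu_gs
  obtain ⟨f1, h⟩ := radial_sol (by omega) hα hp hu hK.1.1 hu_pos hu_reg hu_eq hu_bc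
  have := final_aux hN hn (by omega) h hμ hu hK.1.1 hK.2.1 hK.1.2.1 hu_bc hpos
  linarith

end
end

section
/- Let N = 2n ≥ 4, let B_1 be the unit ball in ℝ^N, and let α > 0. If 1 < p ≤ (2N+2α)/(N−2), then K_+ embeds continuously into L^p(B_1, |x|^α dx): there exists C > 0 such that (∫_{B_1} u^p |x|^α dx)^{1/p} ≤ C‖∇u‖_{L²(B_1)} for all u ∈ K_+. -/
open MeasureTheory Real Set Filter

noncomputable section

variable {N : ℕ}

lemma ftc_aux {a b : ℝ} (hab : a ≤ b) {F φ₁ φ₂ : ℝ → ℝ} (hF : Continuous F)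
    (hd : ∀ x ∈ Ioo a b, ∃ d, HasDerivAt F d x ∧ d ≤ φ₁ x - φ₂ x)
    (h1 : Measurable φ₁) (h2 : Continuous φ₂)
    (p1 : ∀ x ∈ Ioo a b, 0 ≤ φ₁ x) (p2 : ∀ x ∈ Ioo a b, 0 ≤ φ₂ x)
    (hFn : F a ≤ F b) :
    ENNReal.ofReal (F b - F a) + ∫⁻ x in Ioo a b, ENNReal.ofReal (φ₂ x)
      ≤ ∫⁻ x in Ioo a b, ENNReal.ofReal (φ₁ x) := by
  by_cases htop : ∫⁻ x in Ioo a b, ENNReal.ofReal (φ₁ x) = ⊤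
  · rw [htop]; exact le_top
  have ae1 : 0 ≤ᵐ[volume.restrict (Ioo a b)] φ₁ :=
    (ae_restrict_iff' measurableSet_Ioo).2 (Eventually.of_forall p1)
  have ae2 : 0 ≤ᵐ[volume.restrict (Ioo a b)] φ₂ :=
    (ae_restrict_iff' measurableSet_Ioo).2 (Eventually.of_forall p2)
  have i1 : IntegrableOn φ₁ (Ioo a b) := by
    refine ⟨h1.aestronglyMeasurable, ?_⟩
    rw [hasFiniteIntegral_iff_ofReal ae1]
    exact lt_top_iff_ne_top.2 htop
  have i2 : IntegrableOn φ₂ (Icc a b) := h2.continuousOn.integrableOn_Icc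
  have i2' : IntegrableOn φ₂ (Ioo a b) := i2.mono_set Ioo_subset_Icc_self
  have i1' : IntegrableOn φ₁ (Icc a b) := by rwa [integrableOn_Icc_iff_integrableOn_Ioo]
  choose! F' hF' using hd
  have key := intervalIntegral.sub_le_integral_of_hasDeriv_right_of_le (g := F) (g' := F')
    (φ := fun x => φ₁ x - φ₂ x) hab hF.continuousOn
    (fun x hx => (hF' x hx).1.hasDerivWithinAt) (i1'.sub i2) (fun x hx => (hF' x hx).2)
  rw [intervalIntegral.integral_of_le hab, integral_Ioc_eq_integral_Ioo,
    integral_sub i1 i2'] at key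
  rw [← ofReal_integral_eq_lintegral_ofReal i1 ae1, ← ofReal_integral_eq_lintegral_ofReal i2' ae2,
    ← ENNReal.ofReal_add (by linarith) (integral_nonneg_of_ae ae2)]
  exact ENNReal.ofReal_le_ofReal (by linarith)

lemma hardy1 {k b : ℕ} (hb : 1 ≤ b) {f g : ℝ → ℝ} (hf : Continuous f)
    (f0 : ∀ r, 0 ≤ f r) (f1 : f 1 = 0) (hk : 1 ≤ k) (hg : Measurable g)
    (hd : ∀ r ∈ Ioo (0:ℝ) 1, ∃ d, HasDerivAt f d r ∧ |d| ≤ g r) {r : ℝ} (hr : r ∈ Icc (0:ℝ) 1) :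
    ENNReal.ofReal (f r ^ k * r ^ b) + ∫⁻ x in Ioo r 1, ENNReal.ofReal (b * (f x ^ k * x ^ (b - 1)))
      ≤ ∫⁻ x in Ioo r 1, ENNReal.ofReal (k * f x ^ (k - 1) * g x * x ^ b) := by
  have hsub : ∀ x ∈ Ioo r 1, x ∈ Ioo (0:ℝ) 1 := fun x hx => ⟨lt_of_le_of_lt hr.1 hx.1, hx.2⟩
  have hg0 : ∀ x ∈ Ioo r 1, 0 ≤ g x := fun x hx => by
    obtain ⟨d, _, h⟩ := hd x (hsub x hx); exact (abs_nonneg d).trans h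
  have := ftc_aux (F := fun x => - (f x ^ k * x ^ b)) (a := r) (b := 1)
    (φ₁ := fun x => k * f x ^ (k - 1) * g x * x ^ b) (φ₂ := fun x => b * (f x ^ k * x ^ (b - 1)))
    hr.2 (by fun_prop) ?_ (by fun_prop) (by fun_prop) ?_ ?_ ?_
  · simpa [f1, zero_pow (by omega : k ≠ 0)] using this
  · intro x hx
    obtain ⟨d, h, hle⟩ := hd x (hsub x hx)
    refine ⟨_, ((h.pow k).mul (hasDerivAt_pow b x)).neg, ?_⟩
    have hx0 := (hsub x hx).1.le
    have h1 : 0 ≤ (k:ℝ) * f x ^ (k - 1) * x ^ b := by have := f0 x; positivity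
    have := mul_le_mul_of_nonneg_left ((neg_le_abs d).trans hle) h1
    simp only [Pi.pow_apply]
    linarith
  · intro x hx
    have := f0 x; have := hg0 x hx; have := (hsub x hx).1.le; positivity
  · intro x hx
    have := f0 x; have := hg0 x hx; have := (hsub x hx).1.le; positivity
  · have := f0 r; have := hr.1
    simp [f1, zero_pow (by omega : k ≠ 0)]; positivity

lemma theta1 {k : ℕ} {a b : ℝ} {f g : ℝ → ℝ} (hf : Continuous f)
    (f0 : ∀ r, 0 ≤ f r) (hg : Measurable g)
    (hd : ∀ x ∈ Ioo a b, ∃ d, HasDerivAt f d x ∧ |d| ≤ g x) {x y : ℝ}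
    (hx : x ∈ Ioo a b) (hy : y ∈ Ioo a b) :
    ENNReal.ofReal (f y ^ k) ≤ ENNReal.ofReal (f x ^ k) +
      ∫⁻ z in Ioo a b, ENNReal.ofReal (k * f z ^ (k - 1) * g z) := by
  have hg0 : ∀ x ∈ Ioo a b, 0 ≤ g x := fun x hx => by
    obtain ⟨d, _, h⟩ := hd x hx; exact (abs_nonneg d).trans h
  have gen : ∀ σ : ℝ, |σ| = 1 → ∀ c ∈ Ioo a b, ∀ e ∈ Ioo a b, c ≤ e →
      σ * f c ^ k ≤ σ * f e ^ k → 
      ENNReal.ofReal (σ * f e ^ k - σ * f c ^ k) ≤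
        ∫⁻ z in Ioo a b, ENNReal.ofReal (k * f z ^ (k - 1) * g z) := by
    intro σ hσ c hc e he hce hle
    have hs : Ioo c e ⊆ Ioo a b := Ioo_subset_Ioo hc.1.le he.2.le
    have := ftc_aux (F := fun x => σ * f x ^ k) (a := c) (b := e)
      (φ₁ := fun x => k * f x ^ (k - 1) * g x) (φ₂ := fun x => 0)
      hce (by fun_prop) ?_ (by fun_prop) (by fun_prop) ?_ ?_ hle
    · simp only [ENNReal.ofReal_zero, lintegral_zero, add_zero] at this
      exact this.trans (lintegral_mono_set hs)
    · intro x hx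
      obtain ⟨d, h, hle⟩ := hd x (hs hx)
      refine ⟨_, (h.pow k).const_mul σ, ?_⟩
      have h1 : 0 ≤ (k:ℝ) * f x ^ (k - 1) := by have := f0 x; positivity
      have h2 : σ * d ≤ g x := (le_abs_self _).trans (by rw [abs_mul, hσ, one_mul]; exact hle)
      have := mul_le_mul_of_nonneg_left h2 h1
      linarith
    · intro x hx
      have := f0 x; have := hg0 x (hs hx); positivity
    · intro x hx; exact le_rfl
  rcases le_total (f y ^ k) (f x ^ k) with h | h
  · exact (ENNReal.ofReal_le_ofReal h).trans le_self_add
  have h3 : ENNReal.ofReal (f y ^ k - f x ^ k) ≤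
        ∫⁻ z in Ioo a b, ENNReal.ofReal (k * f z ^ (k - 1) * g z) := by
    rcases le_total x y with hxy | hxy
    · simpa using gen 1 (by simp) x hx y hy hxy (by simpa using h)
    · have := gen (-1) (by simp) y hy x hx hxy (by simpa using h)
      rwa [show -1 * f x ^ k - -1 * f y ^ k = f y ^ k - f x ^ k by ring] at this
  have h4 : ENNReal.ofReal (f y ^ k) = ENNReal.ofReal (f x ^ k) + ENNReal.ofReal (f y ^ k - f x ^ k) := by
    rw [← ENNReal.ofReal_add (by have := f0 x; positivity) (by linarith)]; congr 1; ring
  rw [h4]; gcongr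

lemma cs_aux {α : Type*} [MeasurableSpace α] (μ : Measure α) {f g : α → ENNReal}
    (hf : AEMeasurable f μ) (hg : AEMeasurable g μ) :
    (∫⁻ x, f x * g x ∂μ) ^ 2 ≤ (∫⁻ x, f x ^ 2 ∂μ) * ∫⁻ x, g x ^ 2 ∂μ := by
  have h := ENNReal.lintegral_mul_le_Lp_mul_Lq μ Real.HolderConjugate.two_two hf hg
  simp only [Pi.mul_apply, ENNReal.rpow_two] at h
  calc (∫⁻ x, f x * g x ∂μ) ^ 2 ≤ _ := pow_le_pow_left' h 2
    _ = _ := by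
      rw [mul_pow]
      simp only [← ENNReal.rpow_two, ← ENNReal.rpow_mul]
      norm_num

structure Prof (a b : ℝ) (V G : ℝ → ℝ → ℝ) : Prop where
  cont : Continuous (fun z : ℝ × ℝ => V z.1 z.2)
  nn : ∀ r θ, 0 ≤ V r θ
  one : ∀ θ, V 1 θ = 0
  meas : Measurable (fun z : ℝ × ℝ => G z.1 z.2)
  dr : ∀ θ ∈ Ioo a b, ∀ r ∈ Ioo (0:ℝ) 1, ∃ d, HasDerivAt (fun r => V r θ) d r ∧ |d| ≤ G r θ
  dθ : ∀ r ∈ Ioo (0:ℝ) 1, ∀ θ ∈ Ioo a b, ∃ d, HasDerivAt (V r) d θ ∧ |d| ≤ r * G r θ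

def rect (a b : ℝ) : Measure (ℝ × ℝ) :=
  (volume.restrict (Ioo (0:ℝ) 1)).prod (volume.restrict (Ioo a b))

def Xint (a b : ℝ) (V G : ℝ → ℝ → ℝ) (k e : ℕ) : ENNReal :=
  ∫⁻ z, ENNReal.ofReal (k * V z.1 z.2 ^ (k - 1) * G z.1 z.2 * z.1 ^ e) ∂(rect a b)

def Qint (a b : ℝ) (V : ℝ → ℝ → ℝ) (k e : ℕ) : ENNReal :=
  ∫⁻ z, ENNReal.ofReal (V z.1 z.2 ^ k * z.1 ^ e) ∂(rect a b)

def Dint (a b : ℝ) (G : ℝ → ℝ → ℝ) (m : ℕ) : ENNReal :=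
  ∫⁻ z, ENNReal.ofReal (G z.1 z.2 ^ 2 * z.1 ^ (2 * m + 1)) ∂(rect a b)

namespace Prof
variable {a b : ℝ} {V G : ℝ → ℝ → ℝ}

lemma mV (h : Prof a b V G) : Measurable (fun z : ℝ × ℝ => V z.1 z.2) := h.cont.measurable

lemma mK (h : Prof a b V G) (k e : ℕ) : Measurable (fun z : ℝ × ℝ =>
    ENNReal.ofReal (k * V z.1 z.2 ^ (k - 1) * G z.1 z.2 * z.1 ^ e)) := by
  have := h.mV; have := h.meas
  fun_prop

lemma mQ (h : Prof a b V G) (k e : ℕ) : Measurable (fun z : ℝ × ℝ =>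
    ENNReal.ofReal (V z.1 z.2 ^ k * z.1 ^ e)) := by
  have := h.mV
  fun_prop

lemma hardy (h : Prof a b V G) {k e : ℕ} (hk : 1 ≤ k) (he : 1 ≤ e) :
    Qint a b V k (e - 1) ≤ Xint a b V G k e := by
  unfold Qint Xint rect
  rw [lintegral_prod_symm _ (h.mQ _ _).aemeasurable, lintegral_prod_symm _ (h.mK _ _).aemeasurable]
  refine setLIntegral_mono' measurableSet_Ioo fun θ hθ => ?_
  have := hardy1 (k := k) (b := e) he (f := fun r => V r θ) (g := fun r => G r θ)
    (h.cont.comp (by fun_prop : Continuous fun r : ℝ => (r, θ))) (fun r => h.nn r θ) (h.one θ) hk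
    (h.meas.comp (by fun_prop : Measurable fun r : ℝ => (r, θ))) (h.dr θ hθ)
    (r := 0) (by simp)
  refine le_trans (setLIntegral_mono' measurableSet_Ioo fun x hx => ?_) (le_add_self.trans this)
  apply ENNReal.ofReal_le_ofReal
  have h1 : (1:ℝ) ≤ e := by exact_mod_cast he
  have h2 : 0 ≤ V x θ ^ k * x ^ (e - 1) := by
    have := h.nn x θ; have := hx.1.le; positivity
  nlinarith

lemma gnn (h : Prof a b V G) {r θ : ℝ} (hr : r ∈ Ioo (0:ℝ) 1) (hθ : θ ∈ Ioo a b) : 0 ≤ G r θ := by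
  obtain ⟨d, _, hd⟩ := h.dr θ hθ r hr
  exact (abs_nonneg d).trans hd

lemma ae_mem (a b : ℝ) : ∀ᵐ z ∂(rect a b), z.1 ∈ Ioo (0:ℝ) 1 ∧ z.2 ∈ Ioo a b := by
  unfold rect
  rw [Measure.prod_restrict]
  exact (ae_restrict_iff' (measurableSet_Ioo.prod measurableSet_Ioo)).2
    (Eventually.of_forall fun z hz => hz)

lemma cs (h : Prof a b V G) {k e f m : ℕ} (hk : f + (2 * m + 1) = 2 * e) :
    Xint a b V G k e ^ 2 ≤ ENNReal.ofReal (k ^ 2) * Qint a b V (2 * (k - 1)) f * Dint a b G m := by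
  have hV := h.mV; have hG := h.meas
  unfold Xint Qint Dint
  rw [← lintegral_const_mul _ (h.mQ _ _)]
  have e1 : ∀ᵐ z ∂(rect a b), ENNReal.ofReal (k * V z.1 z.2 ^ (k - 1) * G z.1 z.2 * z.1 ^ e) =
      ENNReal.ofReal (k * V z.1 z.2 ^ (k - 1) * √(z.1 ^ f)) *
        ENNReal.ofReal (G z.1 z.2 * √(z.1 ^ (2 * m + 1))) := by
    filter_upwards [ae_mem a b] with z hz
    have := h.nn z.1 z.2
    rw [← ENNReal.ofReal_mul (by positivity)]
    have : √(z.1 ^ f) * √(z.1 ^ (2 * m + 1)) = z.1 ^ e := by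
      rw [← Real.sqrt_mul (pow_nonneg hz.1.1.le _), ← pow_add, hk, mul_comm, pow_mul,
        Real.sqrt_sq (pow_nonneg hz.1.1.le _)]
    rw [← this]; congr 1; ring
  rw [lintegral_congr_ae e1]
  refine (cs_aux _ (by fun_prop) (by fun_prop)).trans ?_
  gcongr ?_ * ?_
  · refine lintegral_mono_ae ?_
    filter_upwards [ae_mem a b] with z hz
    have := h.nn z.1 z.2
    rw [← ENNReal.ofReal_pow (by positivity), ← ENNReal.ofReal_mul (by positivity)]
    apply ENNReal.ofReal_le_ofReal
    rw [mul_pow, Real.sq_sqrt (pow_nonneg hz.1.1.le _)]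
    apply le_of_eq; ring
  · refine lintegral_mono_ae ?_
    filter_upwards [ae_mem a b] with z hz
    have := h.gnn hz.1 hz.2
    rw [← ENNReal.ofReal_pow (by positivity)]
    apply ENNReal.ofReal_le_ofReal
    rw [mul_pow, Real.sq_sqrt (pow_nonneg hz.1.1.le _)]

lemma step (h : Prof a b V G) {k e : ℕ} (hk : 1 ≤ k) (he : 1 ≤ e) :
    ENNReal.ofReal (b - a) * Qint a b V (2 * k) (2 * e - 1) ≤
      (1 + ENNReal.ofReal (b - a)) * Xint a b V G k e ^ 2 := by
  have hV := h.mV; have hG := h.meas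
  set L := ENNReal.ofReal (b - a) with hL
  -- angular bound
  let A : ℝ → ENNReal := fun r => ∫⁻ θ in Ioo a b, (ENNReal.ofReal (V r θ ^ k * r ^ (e - 1)) +
    L * ENNReal.ofReal (k * V r θ ^ (k - 1) * G r θ * r ^ e))
  let B : ℝ → ENNReal := fun θ => ∫⁻ r in Ioo (0:ℝ) 1,
    ENNReal.ofReal (k * V r θ ^ (k - 1) * G r θ * r ^ e)
  have hmA : Measurable (fun z : ℝ × ℝ => (ENNReal.ofReal (V z.1 z.2 ^ k * z.1 ^ (e - 1)) +
    L * ENNReal.ofReal (k * V z.1 z.2 ^ (k - 1) * G z.1 z.2 * z.1 ^ e))) := by fun_prop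
  have hA : ∫⁻ r in Ioo (0:ℝ) 1, A r ≤ (1 + L) * Xint a b V G k e := by
    have : ∫⁻ r in Ioo (0:ℝ) 1, A r = Qint a b V k (e - 1) + L * Xint a b V G k e := by
      unfold Qint Xint
      rw [← lintegral_const_mul _ (h.mK _ _), ← lintegral_add_left (h.mQ _ _), rect,
        lintegral_prod _ hmA.aemeasurable]
    rw [this, add_mul, one_mul]
    gcongr
    exact h.hardy hk he
  have hB : ∫⁻ θ in Ioo a b, B θ = Xint a b V G k e := by
    unfold Xint rect
    rw [lintegral_prod_symm _ (h.mK _ _).aemeasurable]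
  have hAm : Measurable A := hmA.lintegral_prod_right'
  have hBm : Measurable B := (h.mK k e).lintegral_prod_left'
  have bB : ∀ θ ∈ Ioo a b, ∀ r ∈ Ioo (0:ℝ) 1, ENNReal.ofReal (V r θ ^ k * r ^ e) ≤ B θ := by
    intro θ hθ r hr
    have := hardy1 (k := k) (b := e) he (f := fun r => V r θ) (g := fun r => G r θ)
      (h.cont.comp (by fun_prop : Continuous fun r : ℝ => (r, θ))) (fun r => h.nn r θ) (h.one θ) hk
      (h.meas.comp (by fun_prop : Measurable fun r : ℝ => (r, θ))) (h.dr θ hθ)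
      (r := r) ⟨hr.1.le, hr.2.le⟩
    exact (le_self_add.trans this).trans (lintegral_mono_set (Ioo_subset_Ioo_left hr.1.le))
  have bA : ∀ θ ∈ Ioo a b, ∀ r ∈ Ioo (0:ℝ) 1,
      L * ENNReal.ofReal (V r θ ^ k * r ^ (e - 1)) ≤ A r := by
    intro θ hθ r hr
    have hr0 := hr.1.le
    have hmr : Measurable fun t : ℝ => (r, t) := by fun_prop
    have hVr : Measurable (V r) := hV.comp hmr
    have hGr : Measurable (G r) := hG.comp hmr
    have key : ∀ y ∈ Ioo a b, ENNReal.ofReal (V r θ ^ k * r ^ (e - 1)) ≤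
        ENNReal.ofReal (V r y ^ k * r ^ (e - 1)) +
        ∫⁻ z in Ioo a b, ENNReal.ofReal (k * V r z ^ (k - 1) * G r z * r ^ e) := by
      intro y hy
      have := theta1 (k := k) (f := V r) (g := fun z => r * G r z)
        (h.cont.comp (by fun_prop : Continuous fun t : ℝ => (r, t))) (h.nn r)
        (hGr.const_mul r) (h.dθ r hr) hy hθ
      have h2 := mul_le_mul_left this (ENNReal.ofReal (r ^ (e - 1)))
      rw [add_mul, ← ENNReal.ofReal_mul (pow_nonneg (h.nn _ _) _),
        ← ENNReal.ofReal_mul (pow_nonneg (h.nn _ _) _), ← lintegral_mul_const _ (by fun_prop)] at h2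
      refine h2.trans (le_of_eq ?_)
      congr 1
      refine setLIntegral_congr_fun measurableSet_Ioo fun z hz => ?_
      have := h.nn r z; have := h.gnn hr hz
      rw [← ENNReal.ofReal_mul (by positivity)]
      congr 1
      obtain ⟨e', rfl⟩ : ∃ e', e = e' + 1 := ⟨e - 1, by omega⟩
      simp only [Nat.add_sub_cancel]; ring
    have h3 := setLIntegral_mono' measurableSet_Ioo key (μ := volume)
    rw [setLIntegral_const, lintegral_add_left (by fun_prop), setLIntegral_const, Real.volume_Ioo,
      ← hL] at h3
    simp only [A]
    rw [lintegral_add_left (by fun_prop), lintegral_const_mul _ (by fun_prop), mul_comm L]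
    rw [mul_comm L]
    exact h3
  calc L * Qint a b V (2 * k) (2 * e - 1) 
      ≤ ∫⁻ z, A z.1 * B z.2 ∂(rect a b) := by
        unfold Qint
        rw [← lintegral_const_mul _ (h.mQ _ _)]
        refine lintegral_mono_ae ?_
        filter_upwards [ae_mem a b] with z hz
        have hr0 := hz.1.1.le
        have := h.nn z.1 z.2
        refine le_trans (le_of_eq ?_) (mul_le_mul' (bA z.2 hz.2 z.1 hz.1) (bB z.2 hz.2 z.1 hz.1))
        have hp : 0 ≤ V z.1 z.2 ^ k * z.1 ^ (e - 1) := by positivity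
        rw [mul_assoc, ← ENNReal.ofReal_mul hp]
        congr 2
        obtain ⟨e', rfl⟩ : ∃ e', e = e' + 1 := ⟨e - 1, by omega⟩
        rw [show 2 * (e' + 1) - 1 = 2 * e' + 1 by omega]
        simp only [Nat.add_sub_cancel]; ring
    _ = (∫⁻ r in Ioo (0:ℝ) 1, A r) * ∫⁻ θ in Ioo a b, B θ :=
        lintegral_prod_mul hAm.aemeasurable hBm.aemeasurable
    _ ≤ _ := by rw [hB, sq, ← mul_assoc]; gcongr

lemma Q_lt_top (h : Prof a b V G) (k e : ℕ) : Qint a b V k e < ⊤ := by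
  unfold Qint rect
  rw [Measure.prod_restrict]
  have hc : Continuous fun z : ℝ × ℝ => V z.1 z.2 ^ k * z.1 ^ e := by
    have := h.cont; fun_prop
  have : IntegrableOn (fun z : ℝ × ℝ => V z.1 z.2 ^ k * z.1 ^ e) (Icc 0 1 ×ˢ Icc a b) :=
    hc.continuousOn.integrableOn_compact (isCompact_Icc.prod isCompact_Icc)
  have h2 := this.mono_set (prod_mono (Ioo_subset_Icc_self (a := (0:ℝ)) (b := 1))
    (Ioo_subset_Icc_self (a := a) (b := b)))
  exact (lintegral_ofReal_le_lintegral_enorm _).trans_lt h2.2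

end Prof

lemma core (m : ℕ) (hm : 1 ≤ m) {a b : ℝ} (hab : a < b) (k : ℕ) :
    ∃ C : ENNReal, C ≠ ⊤ ∧ ∀ V G, Prof a b V G →
      Qint a b V (2 * (k + 1)) (2 * (k + 1) * m - 1) ≤ C * Dint a b G m ^ (k + 1) := by
  induction k with
  | zero =>
    refine ⟨4, by simp, fun V G h => ?_⟩
    have h1 := h.hardy (k := 2) (e := 2 * m) (by norm_num) (by omega)
    have h2 := h.cs (k := 2) (e := 2 * m) (f := 2 * m - 1) (m := m) (by omega)
    have h3 := (pow_le_pow_left' h1 2).trans h2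
    simp only [zero_add, mul_one, pow_one] at *
    have hq := h.Q_lt_top 2 (2 * m - 1)
    have h4 : ENNReal.ofReal (((2:ℕ):ℝ) ^ 2) = 4 := by norm_num
    rw [h4] at h3
    norm_num at h3
    by_cases h0 : Qint a b V 2 (2 * m - 1) = 0
    · rw [h0]; exact zero_le
    rw [sq, mul_right_comm] at h3
    exact (ENNReal.mul_le_mul_iff_left h0 hq.ne).1 h3
  | succ k ih =>
    obtain ⟨C, hC, H⟩ := ih
    have hL : ENNReal.ofReal (b - a) ≠ 0 := by simpa using hab
    refine ⟨(1 + ENNReal.ofReal (b - a)) * (ENNReal.ofReal (((k + 2 : ℕ):ℝ) ^ 2) * C) /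
      ENNReal.ofReal (b - a), ?_, fun V G h => ?_⟩
    · refine ENNReal.div_ne_top (ENNReal.mul_ne_top (by simp) (ENNReal.mul_ne_top (by simp) hC)) hL
    have h1 := h.step (k := k + 2) (e := (k + 2) * m) (by omega) (by nlinarith)
    have h2 := h.cs (k := k + 2) (e := (k + 2) * m) (f := 2 * (k + 1) * m - 1) (m := m)
      (by have : 1 ≤ 2 * (k + 1) * m := by nlinarith
          zify [this]; ring)
    have h3 := H V G h
    rw [show k + 2 - 1 = k + 1 by omega] at h2
    rw [show k + 1 + 1 = k + 2 by omega]
    rw [ENNReal.div_eq_inv_mul, mul_assoc _ _ (Dint a b G m ^ (k + 2)), ← ENNReal.div_eq_inv_mul]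
    rw [ENNReal.le_div_iff_mul_le (Or.inl hL) (Or.inl (by simp)), mul_comm]
    rw [show 2 * (k + 2) * m = 2 * ((k + 2) * m) by ring]
    refine h1.trans ?_
    rw [mul_assoc]
    gcongr
    refine h2.trans ?_
    calc _ ≤ ENNReal.ofReal (((k + 2 : ℕ):ℝ) ^ 2) * (C * Dint a b G m ^ (k + 1)) * Dint a b G m := by
          gcongr
      _ = _ := by rw [pow_succ (Dint a b G m) (k + 1)]; ring

lemma radial_lintegral (n : ℕ) (hn : 1 ≤ n) : ∃ c : ENNReal, c ≠ 0 ∧ c ≠ ⊤ ∧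
    ∀ f : ℝ → ENNReal, Measurable f → ∫⁻ x : Euc n, f ‖x‖ =
      c * ∫⁻ y in Ioi (0:ℝ), ENNReal.ofReal (y ^ (n - 1)) * f y := by
  have : Nonempty (Fin n) := ⟨⟨0, hn⟩⟩
  let μ : Measure (Euc n) := volume
  refine ⟨μ.toSphere univ, ?_, measure_ne_top _ _, fun f hf => ?_⟩
  · intro h0
    exact μ.toSphere_ne_zero (Measure.measure_univ_eq_zero.1 h0)
  have hdim : Module.finrank ℝ (Euc n) = n := by simp
  calc ∫⁻ x : Euc n, f ‖x‖ = ∫⁻ x : ({(0 : Euc n)}ᶜ : Set (Euc n)), f ‖x.1‖ ∂(μ.comap (↑)) := by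
        rw [lintegral_subtype_comap (measurableSet_singleton _).compl (fun x : Euc n ↦ f ‖x‖),
          restrict_compl_singleton]
    _ = ∫⁻ x, f x.2 ∂μ.toSphere.prod (.volumeIoiPow (Module.finrank ℝ (Euc n) - 1)) := by
        simpa using μ.measurePreserving_homeomorphUnitSphereProd.lintegral_comp_emb
          (Homeomorph.measurableEmbedding _) (f ∘ Subtype.val ∘ Prod.snd)
    _ = μ.toSphere univ * ∫⁻ y : Ioi (0:ℝ), f y ∂(.volumeIoiPow (n - 1)) := by
        rw [hdim, lintegral_prod _ (by fun_prop)]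
        simp [mul_comm]
    _ = _ := by
        congr 1
        rw [Measure.volumeIoiPow, lintegral_withDensity_eq_lintegral_mul _ (by fun_prop) (by fun_prop)]
        rw [← lintegral_subtype_comap measurableSet_Ioi (fun y : ℝ => ENNReal.ofReal (y ^ (n - 1)) * f y)]
        rfl

def splitEuc (n : ℕ) : Euc (n + n) ≃ₗᵢ[ℝ] WithLp 2 (Euc n × Euc n) :=
  (LinearIsometryEquiv.piLpCongrLeft 2 ℝ ℝ finSumFinEquiv.symm).trans
    (PiLp.sumPiLpEquivProdLpPiLp 2 (fun _ : Fin n ⊕ Fin n => ℝ)) 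

lemma splitEuc_fst (n : ℕ) (x : Euc (n + n)) : ‖(splitEuc n x).fst‖ = sVar n x := by
  unfold sVar
  rw [EuclideanSpace.norm_eq]
  congr 1
  rw [Fin.sum_univ_add]
  simp [splitEuc]
  rfl

lemma splitEuc_snd (n : ℕ) (x : Euc (n + n)) : ‖(splitEuc n x).snd‖ = tVar n x := by
  unfold tVar
  rw [EuclideanSpace.norm_eq]
  congr 1
  rw [Fin.sum_univ_add]
  have h1 : ∀ i : Fin n, ¬ n ≤ (Fin.castAdd n i : ℕ) := fun i => by simp
  have h2 : ∀ i : Fin n, n ≤ (Fin.natAdd n i : ℕ) := fun i => by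
    rw [Fin.val_natAdd]; omega
  simp only [h1, h2, if_true, if_false, Finset.sum_const_zero, zero_add, Real.norm_eq_abs, sq_abs]
  rfl

lemma st_lintegral (n : ℕ) (hn : 1 ≤ n) : ∃ c : ENNReal, c ≠ 0 ∧ c ≠ ⊤ ∧
    ∀ F : ℝ × ℝ → ENNReal, Measurable F → ∫⁻ x : Euc (n + n), F (sVar n x, tVar n x) =
      c * ∫⁻ z in Ioi (0:ℝ) ×ˢ Ioi (0:ℝ), ENNReal.ofReal (z.1 ^ (n - 1) * z.2 ^ (n - 1)) * F z := by
  obtain ⟨c, c0, ct, hc⟩ := radial_lintegral n hn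
  refine ⟨c * c, mul_ne_zero c0 c0, ENNReal.mul_ne_top ct ct, fun F hF => ?_⟩
  have mp : MeasurePreserving (fun x : Euc (n + n) => WithLp.ofLp (splitEuc n x)) :=
    (WithLp.volume_preserving_ofLp _ _).comp (splitEuc n).measurePreserving
  have e1 : ∀ x : Euc (n + n), F (sVar n x, tVar n x) =
    (fun y : Euc n × Euc n => F (‖y.1‖, ‖y.2‖)) (WithLp.ofLp (splitEuc n x)) := by
    intro x
    rw [← splitEuc_fst, ← splitEuc_snd]; rfl
  simp_rw [e1]
  rw [mp.lintegral_comp (f := fun y : Euc n × Euc n => F (‖y.1‖, ‖y.2‖)) (by fun_prop)]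
  rw [Measure.volume_eq_prod, lintegral_prod _ (by fun_prop)]
  have e2 : ∀ x : Euc n, ∫⁻ y : Euc n, F (‖x‖, ‖y‖) = 
      (fun s : ℝ => c * ∫⁻ t in Ioi (0:ℝ), ENNReal.ofReal (t ^ (n - 1)) * F (s, t)) ‖x‖ :=
    fun x => hc (fun t => F (‖x‖, t)) (by fun_prop)
  simp only [e2]
  have hm : Measurable fun z : ℝ × ℝ => ENNReal.ofReal (z.2 ^ (n - 1)) * F z := by fun_prop
  have hm2 : Measurable fun s : ℝ => ∫⁻ t in Ioi (0:ℝ), ENNReal.ofReal (t ^ (n - 1)) * F (s, t) :=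
    hm.lintegral_prod_right'
  rw [hc (fun s : ℝ => c * ∫⁻ t in Ioi (0:ℝ), ENNReal.ofReal (t ^ (n - 1)) * F (s, t)) (by fun_prop)]
  rw [mul_assoc]
  congr 1
  rw [Measure.volume_eq_prod, ← Measure.prod_restrict, lintegral_prod _ (by fun_prop)]
  rw [← lintegral_const_mul _ (by
    have hm' : Measurable fun z : ℝ × ℝ => ENNReal.ofReal (z.1 ^ (n - 1) * z.2 ^ (n - 1)) * F z := by
      fun_prop
    exact hm'.lintegral_prod_right')]
  refine setLIntegral_congr_fun measurableSet_Ioi fun s hs => ?_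
  have hs0 : (0:ℝ) ≤ s := le_of_lt hs
  rw [mul_left_comm, ← lintegral_const_mul _ (by fun_prop)]
  congr 1
  refine setLIntegral_congr_fun measurableSet_Ioi fun t ht => ?_
  simp only
  rw [ENNReal.ofReal_mul (by positivity), mul_assoc]

lemma polar_quadrant (f : ℝ × ℝ → ENNReal) :
    ∫⁻ z in Ioi (0:ℝ) ×ˢ Ioi (0:ℝ), f z =
      ∫⁻ z in Ioi (0:ℝ) ×ˢ Ioo 0 (π / 2), ENNReal.ofReal z.1 * f (z.1 * cos z.2, z.1 * sin z.2) := by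
  have hms : MeasurableSet (Ioi (0:ℝ) ×ˢ Ioi (0:ℝ)) := measurableSet_Ioi.prod measurableSet_Ioi
  have hms2 : MeasurableSet (Ioi (0:ℝ) ×ˢ Ioo 0 (π / 2)) := measurableSet_Ioi.prod measurableSet_Ioo
  have hsub : Ioi (0:ℝ) ×ˢ Ioo 0 (π / 2) ⊆ polarCoord.target := by
    rintro ⟨r, θ⟩ ⟨h1, h2, h3⟩
    simp only [polarCoord_target]
    simp only at h2 h3
    exact ⟨h1, by simp only; constructor <;> linarith [pi_pos]⟩
  rw [← lintegral_indicator hms, ← lintegral_comp_polarCoord_symm,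
    ← lintegral_indicator polarCoord.open_target.measurableSet, ← lintegral_indicator hms2]
  congr 1
  ext ⟨r, θ⟩
  by_cases hin : (r, θ) ∈ Ioi (0:ℝ) ×ˢ Ioo 0 (π / 2)
  · rw [indicator_of_mem hin, indicator_of_mem (hsub hin), smul_eq_mul]
    congr 1
    rw [indicator_of_mem]
    · rfl
    · obtain ⟨h1, h2, h3⟩ := hin
      simp only [mem_Ioi] at h1 h2 h3
      exact ⟨mul_pos h1 (cos_pos_of_mem_Ioo ⟨by linarith [pi_pos], h3⟩),
        mul_pos h1 (sin_pos_of_pos_of_lt_pi h2 (by linarith [pi_pos]))⟩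
  · rw [indicator_of_notMem hin]
    by_cases ht : (r, θ) ∈ polarCoord.target
    · rw [indicator_of_mem ht, indicator_of_notMem, smul_zero]
      rintro ⟨h1, h2⟩
      apply hin
      simp only [polarCoord_target] at ht
      obtain ⟨hr, ht1, ht2⟩ := ht
      simp only [mem_Ioi, polarCoord_symm_apply] at hr ht1 ht2 h1 h2
      have hc := (pos_iff_pos_of_mul_pos h1).1 hr
      have hs := (pos_iff_pos_of_mul_pos h2).1 hr
      refine ⟨hr, ?_, ?_⟩
      · by_contra hθ
        simp only [not_lt] at hθ
        exact absurd (sin_nonpos_of_nonpos_of_neg_pi_le hθ ht1.le) (not_le.2 hs)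
      · by_contra hθ
        simp only [not_lt] at hθ
        exact absurd (cos_nonpos_of_pi_div_two_le_of_le hθ (by linarith)) (not_le.2 hc)
    · rw [indicator_of_notMem ht]

lemma full_polar (n : ℕ) (hn : 1 ≤ n) : ∃ c : ENNReal, c ≠ 0 ∧ c ≠ ⊤ ∧
    ∀ F : ℝ × ℝ → ENNReal, Measurable F → ∫⁻ x : Euc (n + n), F (sVar n x, tVar n x) =
      c * ∫⁻ z in Ioi (0:ℝ) ×ˢ Ioo 0 (π / 2),
        ENNReal.ofReal (z.1 ^ (2 * (n - 1) + 1) * (cos z.2 * sin z.2) ^ (n - 1)) *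
          F (z.1 * cos z.2, z.1 * sin z.2) := by
  obtain ⟨c, c0, ct, hc⟩ := st_lintegral n hn
  refine ⟨c, c0, ct, fun F hF => ?_⟩
  rw [hc F hF, polar_quadrant]
  congr 1
  refine setLIntegral_congr_fun (measurableSet_Ioi.prod measurableSet_Ioo) fun z hz => ?_
  simp only
  rw [← mul_assoc, ← ENNReal.ofReal_mul (le_of_lt hz.1)]
  congr 2
  ring

def Pt (n : ℕ) (ξ η : Euc n) : ℝ × ℝ →ₗ[ℝ] Euc (n + n) where
  toFun z := (splitEuc n).symm (WithLp.toLp 2 (z.1 • ξ, z.2 • η))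
  map_add' z w := by
    rw [← map_add]; congr 1
    rw [← WithLp.toLp_add]; simp [add_smul]
  map_smul' c z := by
    simp only [RingHom.id_apply]
    rw [← map_smul]; congr 1
    rw [← WithLp.toLp_smul]; simp [mul_smul]; rfl

lemma norm_sq_st (n : ℕ) (x : Euc (n + n)) : ‖x‖ ^ 2 = sVar n x ^ 2 + tVar n x ^ 2 := by
  rw [← splitEuc_fst, ← splitEuc_snd, ← WithLp.prod_norm_sq_eq_of_L2, LinearIsometryEquiv.norm_map]

lemma sVar_Pt (n : ℕ) {ξ η : Euc n} (hξ : ‖ξ‖ = 1) (z : ℝ × ℝ) : sVar n (Pt n ξ η z) = |z.1| := by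
  rw [← splitEuc_fst]
  simp [Pt, norm_smul, hξ]

lemma tVar_Pt (n : ℕ) {ξ η : Euc n} (hη : ‖η‖ = 1) (z : ℝ × ℝ) : tVar n (Pt n ξ η z) = |z.2| := by
  rw [← splitEuc_snd]
  simp [Pt, norm_smul, hη]

lemma norm_Pt (n : ℕ) {ξ η : Euc n} (hξ : ‖ξ‖ = 1) (hη : ‖η‖ = 1) (z : ℝ × ℝ) :
    ‖Pt n ξ η z‖ ^ 2 = z.1 ^ 2 + z.2 ^ 2 := by
  rw [norm_sq_st, sVar_Pt n hξ, tVar_Pt n hη, sq_abs, sq_abs]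

lemma norm_Pt_le (n : ℕ) {ξ η : Euc n} (hξ : ‖ξ‖ = 1) (hη : ‖η‖ = 1) (z : ℝ × ℝ) :
    ‖Pt n ξ η z‖ ≤ 2 * ‖z‖ := by
  have h := norm_Pt n hξ hη z
  have h1 : |z.1| ≤ ‖z‖ := by simpa using norm_fst_le z
  have h2 : |z.2| ≤ ‖z‖ := by simpa using norm_snd_le z
  have h3 := norm_nonneg z
  apply le_of_sq_le_sq _ (by positivity)
  rw [h, ← sq_abs z.1, ← sq_abs z.2]
  have := abs_nonneg z.1; have := abs_nonneg z.2
  nlinarith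

def PtC (n : ℕ) {ξ η : Euc n} (hξ : ‖ξ‖ = 1) (hη : ‖η‖ = 1) : ℝ × ℝ →L[ℝ] Euc (n + n) :=
  (Pt n ξ η).mkContinuous 2 (norm_Pt_le n hξ hη)

lemma PtC_norm (n : ℕ) {ξ η : Euc n} (hξ : ‖ξ‖ = 1) (hη : ‖η‖ = 1) : ‖PtC n hξ hη‖ ≤ 2 :=
  LinearMap.mkContinuous_norm_le _ (by norm_num) _

lemma exists_Pt (n : ℕ) (x : Euc (n + n)) (hs : 0 < sVar n x) (ht : 0 < tVar n x) :
    ∃ ξ η : Euc n, ‖ξ‖ = 1 ∧ ‖η‖ = 1 ∧ Pt n ξ η (sVar n x, tVar n x) = x := by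
  refine ⟨(sVar n x)⁻¹ • (splitEuc n x).fst, (tVar n x)⁻¹ • (splitEuc n x).snd, ?_, ?_, ?_⟩
  · rw [norm_smul, splitEuc_fst, norm_inv, Real.norm_of_nonneg hs.le, inv_mul_cancel₀ hs.ne']
  · rw [norm_smul, splitEuc_snd, norm_inv, Real.norm_of_nonneg ht.le, inv_mul_cancel₀ ht.ne']
  · simp only [Pt, LinearMap.coe_mk, AddHom.coe_mk, smul_smul, mul_inv_cancel₀ hs.ne',
      mul_inv_cancel₀ ht.ne', one_smul]
    rw [LinearIsometryEquiv.symm_apply_eq]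
    rfl

lemma exists_unit (n : ℕ) (hn : 1 ≤ n) : ∃ ξ : Euc n, ‖ξ‖ = 1 :=
  ⟨EuclideanSpace.single ⟨0, hn⟩ 1, by simp⟩

lemma measurable_sVar (n : ℕ) : Measurable (sVar (N := N) n) := by
  unfold sVar
  refine Measurable.sqrt (Finset.measurable_sum _ fun j _ => ?_)
  split_ifs <;> fun_prop

lemma measurable_tVar (n : ℕ) : Measurable (tVar (N := N) n) := by
  unfold tVar
  refine Measurable.sqrt (Finset.measurable_sum _ fun j _ => ?_)
  split_ifs <;> fun_prop

lemma angle_lemma (φ : ℝ → ENNReal) (hsym : ∀ θ, φ (π / 2 - θ) = φ θ)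
    (hmono : ∀ x y, 0 < x → x ≤ y → y < π / 4 → φ x ≤ φ y) :
    ∫⁻ θ in Ioo 0 (π / 2), φ θ ≤ 4 * ∫⁻ θ in Ioo (π / 8) (π / 4), φ θ := by
  have hpi := pi_pos
  have h1 : Ioo 0 (π / 2) ⊆ Ioo 0 (π / 4) ∪ ({π / 4} ∪ Ioo (π / 4) (π / 2)) := by
    intro x hx
    rcases lt_trichotomy x (π / 4) with h | h | h
    · exact Or.inl ⟨hx.1, h⟩
    · exact Or.inr (Or.inl h)
    · exact Or.inr (Or.inr ⟨h, hx.2⟩)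
  have h2 : Ioo 0 (π / 4) ⊆ Ioo 0 (π / 8) ∪ ({π / 8} ∪ Ioo (π / 8) (π / 4)) := by
    intro x hx
    rcases lt_trichotomy x (π / 8) with h | h | h
    · exact Or.inl ⟨hx.1, h⟩
    · exact Or.inr (Or.inl h)
    · exact Or.inr (Or.inr ⟨h, hx.2⟩)
  have hrefl : ∫⁻ θ in Ioo (π / 4) (π / 2), φ θ = ∫⁻ θ in Ioo 0 (π / 4), φ θ := by
    rw [← lintegral_indicator measurableSet_Ioo, ← lintegral_indicator measurableSet_Ioo,
      ← lintegral_sub_left_eq_self _ (π / 2)]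
    congr 1; ext θ
    simp only [indicator, mem_Ioo, hsym]
    congr 1
    simp only [eq_iff_iff]
    constructor <;> rintro ⟨h, h'⟩ <;> constructor <;> linarith
  have sh : ∫⁻ θ in Ioo 0 (π / 8), φ θ ≤ ∫⁻ θ in Ioo (π / 8) (π / 4), φ θ := by
    rw [← lintegral_indicator measurableSet_Ioo, ← lintegral_indicator measurableSet_Ioo,
      ← lintegral_add_right_eq_self (fun x => (Ioo (π / 8) (π / 4)).indicator (fun θ => φ θ) x) (π / 8)]
    refine lintegral_mono fun θ => ?_
    by_cases h : θ ∈ Ioo 0 (π / 8)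
    · rw [indicator_of_mem h, indicator_of_mem]
      · exact hmono _ _ h.1 (by linarith) (by linarith [h.2])
      · exact ⟨by linarith [h.1], by linarith [h.2]⟩
    · rw [indicator_of_notMem h]; exact zero_le
  have q : ∫⁻ θ in Ioo 0 (π / 4), φ θ ≤ 2 * ∫⁻ θ in Ioo (π / 8) (π / 4), φ θ := by
    refine (lintegral_mono_set h2).trans ((lintegral_union_le _ _ _).trans ?_)
    rw [two_mul]
    refine add_le_add sh ((lintegral_union_le _ _ _).trans ?_)
    simp
  refine (lintegral_mono_set h1).trans ((lintegral_union_le _ _ _).trans ?_)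
  rw [show (4 : ENNReal) = 2 + 2 by norm_num, add_mul]
  refine add_le_add q ((lintegral_union_le _ _ _).trans ?_)
  rw [hrefl]
  simpa using q

lemma polar_sq (r θ : ℝ) : (r * cos θ) ^ 2 + (r * sin θ) ^ 2 = r ^ 2 := by
  linear_combination r ^ 2 * sin_sq_add_cos_sq θ

lemma ptw {m k : ℕ} (hm : 1 ≤ m) {α p q r y : ℝ} (hα : 0 < α) (hp : 1 < p) (hpq : p ≤ q)
    (hq : q * m = 2 * m + 2 + α) (hk : q ≤ 2 * k) (hr : r ∈ Ioo (0:ℝ) 1) (hy : 0 ≤ y) :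
    y ^ p * r ^ α * r ^ (2 * m + 1) ≤
      1 + y ^ 2 * r ^ (2 * m - 1) + y ^ (2 * k) * r ^ (2 * k * m - 1) := by
  have hr0 := hr.1
  have hm' : (1:ℝ) ≤ m := by exact_mod_cast hm
  have hq2 : 2 ≤ q := by
    by_contra hcon
    push Not at hcon
    nlinarith
  have hk1 : 1 ≤ k := by
    by_contra hcon
    have : k = 0 := by omega
    subst this; norm_num at hk; linarith
  have t1 : 0 ≤ y ^ 2 * r ^ (2 * m - 1) := by positivity
  have t2 : 0 ≤ y ^ (2 * k) * r ^ (2 * k * m - 1) := by positivity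
  have hrα : r ^ α ≤ 1 := rpow_le_one hr0.le hr.2.le hα.le
  have hrm : r ^ (2 * m + 1) ≤ 1 := pow_le_one₀ hr0.le hr.2.le
  rcases le_total y 1 with h | h
  · have : y ^ p ≤ 1 := rpow_le_one hy h (by linarith)
    have h1 : y ^ p * r ^ α ≤ 1 := mul_le_one₀ this (by positivity) hrα
    have h2 : y ^ p * r ^ α * r ^ (2 * m + 1) ≤ 1 := mul_le_one₀ h1 (by positivity) hrm
    linarith
  have h1 : y ^ p ≤ y ^ q := rpow_le_rpow_of_exponent_le h hpq
  set g := y * r ^ m with hg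
  have hg0 : 0 < g := by positivity
  have hgq : g ^ q ≤ g ^ 2 + g ^ (2 * k) := by
    rcases le_total g 1 with h' | h'
    · have : g ^ q ≤ g ^ (2:ℝ) := rpow_le_rpow_of_exponent_ge hg0 h' hq2
      rw [rpow_two] at this
      have : 0 ≤ g ^ (2 * k) := by positivity
      linarith
    · have : g ^ q ≤ g ^ (((2 * k : ℕ)) : ℝ) := rpow_le_rpow_of_exponent_le h' (by push_cast; exact hk)
      rw [rpow_natCast] at this
      have : 0 ≤ g ^ 2 := by positivity
      linarith
  have e1 : y ^ q * r ^ α * r ^ (2 * m + 1) * r = g ^ q := by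
    rw [hg, mul_rpow hy (by positivity), ← rpow_natCast r m, ← rpow_mul hr0.le, mul_comm (m:ℝ), hq,
      mul_assoc, mul_assoc, ← pow_succ, ← rpow_natCast r, ← rpow_add hr0]
    congr 2; push_cast; ring
  have e2 : y ^ 2 * r ^ (2 * m - 1) * r = g ^ 2 := by
    rw [hg, mul_pow, mul_assoc, ← pow_succ, ← pow_mul]
    congr 2; omega
  have e3 : y ^ (2 * k) * r ^ (2 * k * m - 1) * r = g ^ (2 * k) := by
    rw [hg, mul_pow, mul_assoc, ← pow_succ, ← pow_mul]
    have : 1 ≤ 2 * k * m := by nlinarith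
    congr 2; rw [Nat.sub_add_cancel this]; ring
  have h2 : y ^ p * r ^ α * r ^ (2 * m + 1) ≤ y ^ q * r ^ α * r ^ (2 * m + 1) := by gcongr
  have h3 : y ^ q * r ^ α * r ^ (2 * m + 1) ≤ y ^ 2 * r ^ (2 * m - 1) + y ^ (2 * k) * r ^ (2 * k * m - 1) := by
    refine le_of_mul_le_mul_right ?_ hr0
    rw [e1, add_mul, e2, e3]; exact hgq
  linarith

structure Red (n : ℕ) (u : Euc (n + n) → ℝ) (W : ℝ × ℝ → ℝ) : Prop where
  cont : Continuous W
  nn : ∀ z, 0 ≤ W z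
  eq : ∀ x, u x = W (sVar n x, tVar n x)
  zero : ∀ z : ℝ × ℝ, 1 ≤ z.1 ^ 2 + z.2 ^ 2 → W z = 0
  diff : ∀ z : ℝ × ℝ, z.1 ^ 2 + z.2 ^ 2 < 1 → DifferentiableAt ℝ W z
  grad : ∀ x, ‖x‖ < 1 → 0 < sVar n x → 0 < tVar n x →
    ‖fderiv ℝ W (sVar n x, tVar n x)‖ ≤ 2 * ‖gradient u x‖
  symm : ∀ a b, W (a, b) = W (b, a)
  mono : ∀ r ∈ Ioo (0:ℝ) 1, ∀ θ₁ θ₂, 0 < θ₁ → θ₁ ≤ θ₂ → θ₂ < π / 4 →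
    W (r * cos θ₁, r * sin θ₁) ≤ W (r * cos θ₂, r * sin θ₂)

lemma exists_red (n : ℕ) (hn : 1 ≤ n) (u : Euc (n + n) → ℝ)
    (hu : u ∈ Kplus n (Metric.ball (0 : Euc (n + n)) 1)) : ∃ W, Red n u W := by
  obtain ⟨⟨hc, hdiff, hzero, -, -⟩, hnn, w, hw, hsymm, hmono⟩ := hu
  obtain ⟨ξ, hξ⟩ := exists_unit n hn
  have hWeq : ∀ {ξ η : Euc n} (hξ : ‖ξ‖ = 1) (hη : ‖η‖ = 1),
      (fun z : ℝ × ℝ => w |z.1| |z.2|) = fun z => u (PtC n hξ hη z) := by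
    intro ξ η hξ hη
    ext z
    rw [hw, ← sVar_Pt n (η := η) hξ, ← tVar_Pt n (ξ := ξ) hη]; rfl
  have hnP : ∀ z, ‖PtC n hξ hξ z‖ ^ 2 = z.1 ^ 2 + z.2 ^ 2 := norm_Pt n hξ hξ
  have hball : ∀ z : ℝ × ℝ, z.1 ^ 2 + z.2 ^ 2 < 1 → PtC n hξ hξ z ∈ Metric.ball (0 : Euc (n+n)) 1 := by
    intro z hz
    rw [mem_ball_zero_iff]
    have := hnP z
    have := norm_nonneg (PtC n hξ hξ z)
    nlinarith
  have hWd : ∀ z : ℝ × ℝ, z.1 ^ 2 + z.2 ^ 2 < 1 →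
      DifferentiableAt ℝ (fun z : ℝ × ℝ => w |z.1| |z.2|) z := by
    intro z hz
    rw [hWeq hξ hξ]
    exact (hdiff _ (hball z hz)).comp z (PtC n hξ hξ).differentiableAt
  have hst : ∀ x : Euc (n+n), 0 ≤ sVar n x ∧ 0 ≤ tVar n x :=
    fun x => ⟨Real.sqrt_nonneg _, Real.sqrt_nonneg _⟩
  refine ⟨fun z => w |z.1| |z.2|, ?_, ?_, ?_, ?_, hWd, ?_, ?_, ?_⟩
  · rw [hWeq hξ hξ]; exact hc.comp (PtC n hξ hξ).continuous
  · intro z; rw [congrFun (hWeq hξ hξ) z]; exact hnn _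
  · intro x
    simp only [abs_of_nonneg (hst x).1, abs_of_nonneg (hst x).2]
    exact hw x
  · intro z hz
    rw [congrFun (hWeq hξ hξ) z]
    apply hzero
    rw [mem_ball_zero_iff]
    intro hlt
    have := hnP z
    have := norm_nonneg (PtC n hξ hξ z)
    nlinarith
  · intro x hx hs ht
    obtain ⟨ξ', η', hξ', hη', hP⟩ := exists_Pt n x hs ht
    have hP' : PtC n hξ' hη' (sVar n x, tVar n x) = x := hP
    rw [hWeq hξ' hη']
    have hd : DifferentiableAt ℝ u (PtC n hξ' hη' (sVar n x, tVar n x)) := by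
      rw [hP']; exact hdiff x (by rwa [mem_ball_zero_iff])
    have hf := (hd.hasFDerivAt.comp (sVar n x, tVar n x) (PtC n hξ' hη').hasFDerivAt).fderiv
    rw [show (fun z => u (PtC n hξ' hη' z)) = u ∘ (PtC n hξ' hη') from rfl, hf, hP']
    refine (ContinuousLinearMap.opNorm_comp_le _ _).trans ?_
    have hg : ‖gradient u x‖ = ‖fderiv ℝ u x‖ := by simp [gradient]
    rw [hg, mul_comm]
    gcongr
    exact PtC_norm n hξ' hη'
  · intro a b; exact hsymm _ _
  · intro r hr θ₁ θ₂ h1 h12 h2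
    have hpi := pi_pos
    have hpos : ∀ θ, 0 < θ → θ < π / 4 → 0 ≤ r * cos θ ∧ 0 ≤ r * sin θ := fun θ a b =>
      ⟨mul_nonneg hr.1.le (cos_nonneg_of_mem_Icc ⟨by linarith, by linarith⟩),
       mul_nonneg hr.1.le (sin_nonneg_of_nonneg_of_le_pi a.le (by linarith))⟩
    have hin : ∀ θ, 0 < θ → θ < π / 4 →
        inCross n (Metric.ball (0 : Euc (n + n)) 1) (r * cos θ) (r * sin θ) := by
      intro θ a b
      refine ⟨PtC n hξ hξ (r * cos θ, r * sin θ), hball _ ?_, ?_, ?_⟩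
      · have := hr.1; have := hr.2
        simp only
        rw [polar_sq]
        nlinarith
      · exact (sVar_Pt n hξ _).trans (abs_of_nonneg (hpos θ a b).1)
      · exact (tVar_Pt n hξ _).trans (abs_of_nonneg (hpos θ a b).2)
    have A1 := hpos θ₁ h1 (by linarith); have A2 := hpos θ₂ (by linarith) h2
    simp only [abs_of_nonneg A1.1, abs_of_nonneg A1.2, abs_of_nonneg A2.1, abs_of_nonneg A2.2]
    exact hmono r θ₁ θ₂ h1 h12 h2 (hin _ h1 (by linarith)) (hin _ (by linarith) h2)

namespace Red
variable {n : ℕ} {u : Euc (n + n) → ℝ} {W : ℝ × ℝ → ℝ}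

lemma prof (h : Red n u W) (a b : ℝ) : Prof a b (fun r θ => W (r * cos θ, r * sin θ))
    (fun r θ => ‖fderiv ℝ W (r * cos θ, r * sin θ)‖) where
  cont := h.cont.comp (by fun_prop)
  nn r θ := h.nn _
  one θ := h.zero _ (by simp only; rw [polar_sq]; norm_num)
  meas := ((measurable_fderiv ℝ W).comp
    (by fun_prop : Measurable fun z : ℝ × ℝ => (z.1 * cos z.2, z.1 * sin z.2))).norm
  dr := by
    intro θ _ r hr
    have hd : DifferentiableAt ℝ W (r * cos θ, r * sin θ) :=
      h.diff _ (by simp only; rw [polar_sq]; nlinarith [hr.1, hr.2])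
    have hc : HasDerivAt (fun r : ℝ => (r * cos θ, r * sin θ)) (cos θ, sin θ) r := by
      have h1 : HasDerivAt (fun r : ℝ => r * cos θ) (cos θ) r := by
        simpa using (hasDerivAt_id r).mul_const (cos θ)
      have h2 : HasDerivAt (fun r : ℝ => r * sin θ) (sin θ) r := by
        simpa using (hasDerivAt_id r).mul_const (sin θ)
      exact h1.prodMk h2
    refine ⟨_, hd.hasFDerivAt.comp_hasDerivAt r hc, ?_⟩
    rw [← Real.norm_eq_abs]
    refine (ContinuousLinearMap.le_opNorm _ _).trans ?_
    have : ‖(cos θ, sin θ)‖ ≤ 1 := by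
      rw [Prod.norm_def]; exact max_le (abs_cos_le_one θ) (abs_sin_le_one θ)
    exact mul_le_of_le_one_right (norm_nonneg _) this
  dθ := by
    intro r hr θ _
    have hd : DifferentiableAt ℝ W (r * cos θ, r * sin θ) :=
      h.diff _ (by simp only; rw [polar_sq]; nlinarith [hr.1, hr.2])
    have hc : HasDerivAt (fun θ : ℝ => (r * cos θ, r * sin θ)) (r * -sin θ, r * cos θ) θ :=
      ((hasDerivAt_cos θ).const_mul r).prodMk ((hasDerivAt_sin θ).const_mul r)
    refine ⟨_, hd.hasFDerivAt.comp_hasDerivAt θ hc, ?_⟩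
    rw [← Real.norm_eq_abs]
    refine (ContinuousLinearMap.le_opNorm _ _).trans ?_
    rw [mul_comm]
    have hs : ‖(r * -sin θ, r * cos θ)‖ ≤ r := by
      rw [Prod.norm_def]
      refine max_le ?_ ?_
      · simp only [norm_mul, norm_neg, Real.norm_eq_abs, abs_of_pos hr.1]
        exact mul_le_of_le_one_right hr.1.le (abs_sin_le_one θ)
      · simp only [norm_mul, Real.norm_eq_abs, abs_of_pos hr.1]
        exact mul_le_of_le_one_right hr.1.le (abs_cos_le_one θ)
    gcongr

end Red

lemma D_bound (n : ℕ) (hn : 1 ≤ n) : ∃ C : ENNReal, C ≠ ⊤ ∧ ∀ u W, Red n u W →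
    Dint (π / 8) (π / 4) (fun r θ => ‖fderiv ℝ W (r * cos θ, r * sin θ)‖) (n - 1) ≤
      C * ∫⁻ x in Metric.ball (0 : Euc (n + n)) 1, ENNReal.ofReal (‖gradient u x‖ ^ 2) := by
  obtain ⟨c, c0, ct, hc⟩ := full_polar n hn
  have hpi := pi_pos
  have hcp : 0 < cos (π / 4) := cos_pos_of_mem_Ioo ⟨by linarith, by linarith⟩
  have hsp : 0 < sin (π / 8) := sin_pos_of_pos_of_lt_pi (by linarith) (by linarith)
  set δ : ℝ := (cos (π / 4) * sin (π / 8)) ^ (n - 1) with hδ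
  have hδ0 : 0 < δ := by positivity
  have hδE : c * ENNReal.ofReal δ ≠ 0 := mul_ne_zero c0 (by simpa using hδ0)
  have hδT : c * ENNReal.ofReal δ ≠ ⊤ := ENNReal.mul_ne_top ct (by simp)
  refine ⟨4 / (c * ENNReal.ofReal δ), ENNReal.div_ne_top (by simp) hδE, fun u W h => ?_⟩
  rw [ENNReal.div_eq_inv_mul, mul_assoc, ← ENNReal.div_eq_inv_mul,
    ENNReal.le_div_iff_mul_le (Or.inl hδE) (Or.inl hδT)]
  let S : Set (ℝ × ℝ) := {z | 0 < z.1 ∧ 0 < z.2 ∧ z.1 ^ 2 + z.2 ^ 2 < 1}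
  have hS : MeasurableSet S := by
    have o1 : IsOpen {z : ℝ × ℝ | 0 < z.1} := isOpen_lt (by fun_prop) (by fun_prop)
    have o2 : IsOpen {z : ℝ × ℝ | 0 < z.2} := isOpen_lt (by fun_prop) (by fun_prop)
    have o3 : IsOpen {z : ℝ × ℝ | z.1 ^ 2 + z.2 ^ 2 < 1} := isOpen_lt (by fun_prop) (by fun_prop)
    exact (o1.inter (o2.inter o3)).measurableSet
  let F : ℝ × ℝ → ENNReal := S.indicator fun z => ENNReal.ofReal (‖fderiv ℝ W z‖ ^ 2)
  have hF : Measurable F :=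
    (((measurable_fderiv ℝ W).norm.pow_const 2).ennreal_ofReal).indicator hS
  have low : ∫⁻ x : Euc (n + n), F (sVar n x, tVar n x) ≤
      4 * ∫⁻ x in Metric.ball (0 : Euc (n + n)) 1, ENNReal.ofReal (‖gradient u x‖ ^ 2) := by
    rw [← lintegral_const_mul' _ _ (by simp), ← lintegral_indicator Metric.isOpen_ball.measurableSet]
    refine lintegral_mono fun x => ?_
    by_cases hx : (sVar n x, tVar n x) ∈ S
    · have hxn : ‖x‖ < 1 := by
        have := norm_sq_st n x
        have h3 : sVar n x ^ 2 + tVar n x ^ 2 < 1 := hx.2.2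
        nlinarith [norm_nonneg x]
      simp only [F]
      rw [indicator_of_mem hx, indicator_of_mem (by rwa [mem_ball_zero_iff])]
      rw [show (4 : ENNReal) = ENNReal.ofReal 4 by norm_num, ← ENNReal.ofReal_mul (by norm_num)]
      apply ENNReal.ofReal_le_ofReal
      have := h.grad x hxn hx.1 hx.2.1
      calc _ ≤ (2 * ‖gradient u x‖) ^ 2 := by gcongr
        _ = _ := by ring
    · simp only [F]; rw [indicator_of_notMem hx]; exact zero_le
  refine le_trans ?_ low
  rw [hc F hF, mul_comm, mul_assoc]
  gcongr c * ?_
  unfold Dint rect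
  rw [Measure.prod_restrict, ← lintegral_const_mul' _ _ (by simp), ← Measure.volume_eq_prod]
  refine le_trans ?_ (lintegral_mono_set (s := Ioo (0:ℝ) 1 ×ˢ Ioo (π / 8) (π / 4))
    (prod_mono (fun x hx => hx.1) (Ioo_subset_Ioo (by linarith) (by linarith))))
  refine setLIntegral_mono' (measurableSet_Ioo.prod measurableSet_Ioo) ?_
  rintro ⟨r, θ⟩ ⟨⟨hr0, hr1⟩, ⟨ha, hb⟩⟩
  simp only at hr0 hr1 ha hb ⊢
  have hcθ : cos (π / 4) ≤ cos θ := cos_le_cos_of_nonneg_of_le_pi (by linarith) (by linarith) hb.le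
  have hsθ : sin (π / 8) ≤ sin θ := sin_le_sin_of_le_of_le_pi_div_two (by linarith) (by linarith) ha.le
  have hmem : (r * cos θ, r * sin θ) ∈ S :=
    ⟨mul_pos hr0 (hcp.trans_le hcθ), mul_pos hr0 (hsp.trans_le hsθ), by
      simp only; rw [polar_sq]; nlinarith⟩
  simp only [F]
  rw [indicator_of_mem hmem, ← ENNReal.ofReal_mul hδ0.le, ← ENNReal.ofReal_mul (by
    have := hcp.trans_le hcθ; have := hsp.trans_le hsθ; positivity)]
  apply ENNReal.ofReal_le_ofReal
  have : δ ≤ (cos θ * sin θ) ^ (n - 1) := by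
    rw [hδ]; have := hcp.trans_le hcθ; gcongr
  calc δ * (‖fderiv ℝ W (r * cos θ, r * sin θ)‖ ^ 2 * r ^ (2 * (n - 1) + 1))
      ≤ (cos θ * sin θ) ^ (n - 1) * (‖fderiv ℝ W (r * cos θ, r * sin θ)‖ ^ 2 * r ^ (2 * (n - 1) + 1)) := by
        gcongr
    _ = _ := by ring

lemma U_bound (n : ℕ) (hn : 1 ≤ n) : ∃ C : ENNReal, C ≠ ⊤ ∧ ∀ u W, Red n u W → ∀ α p : ℝ, 0 < p →
    0 < α → ∫⁻ x in Metric.ball (0 : Euc (n + n)) 1, ENNReal.ofReal (u x ^ p * ‖x‖ ^ α) ≤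
    C * ∫⁻ z, ENNReal.ofReal (W (z.1 * cos z.2, z.1 * sin z.2) ^ p * z.1 ^ α * z.1 ^ (2 * (n - 1) + 1))
      ∂(rect (π / 8) (π / 4)) := by
  obtain ⟨c, c0, ct, hc⟩ := full_polar n hn
  have hpi := pi_pos
  refine ⟨c * 4, ENNReal.mul_ne_top ct (by simp), fun u W h α p hp hα => ?_⟩
  let S : Set (ℝ × ℝ) := {z | z.1 ^ 2 + z.2 ^ 2 < 1}
  have hS : MeasurableSet S := (isOpen_lt (by fun_prop) (by fun_prop)).measurableSet
  have hWm := h.cont.measurable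
  let F : ℝ × ℝ → ENNReal := S.indicator fun z =>
    ENNReal.ofReal (W z ^ p * √(z.1 ^ 2 + z.2 ^ 2) ^ α)
  have hF : Measurable F := Measurable.indicator (by fun_prop) hS
  have e1 : ∫⁻ x in Metric.ball (0 : Euc (n + n)) 1, ENNReal.ofReal (u x ^ p * ‖x‖ ^ α) =
      ∫⁻ x : Euc (n + n), F (sVar n x, tVar n x) := by
    rw [← lintegral_indicator Metric.isOpen_ball.measurableSet]
    congr 1; ext x
    have hx : ‖x‖ = √(sVar n x ^ 2 + tVar n x ^ 2) := by
      rw [← norm_sq_st, Real.sqrt_sq (norm_nonneg x)]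
    have hiff : x ∈ Metric.ball (0 : Euc (n + n)) 1 ↔ (sVar n x, tVar n x) ∈ S := by
      rw [mem_ball_zero_iff]
      simp only [S, mem_ofPred_eq]
      rw [← norm_sq_st]
      constructor <;> intro h <;> nlinarith [norm_nonneg x]
    simp only [F]
    by_cases hb : x ∈ Metric.ball (0 : Euc (n + n)) 1
    · rw [indicator_of_mem hb, indicator_of_mem (hiff.1 hb), hx, h.eq]
    · rw [indicator_of_notMem hb, indicator_of_notMem (fun h' => hb (hiff.2 h'))]
  rw [e1, hc F hF, mul_assoc]
  gcongr c * ?_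
  let Φ : ℝ × ℝ → ENNReal := fun z =>
    ENNReal.ofReal (W (z.1 * cos z.2, z.1 * sin z.2) ^ p * z.1 ^ α * z.1 ^ (2 * (n - 1) + 1))
  have hΦ : Measurable Φ := by
    have : Measurable fun z : ℝ × ℝ => W (z.1 * cos z.2, z.1 * sin z.2) := hWm.comp (by fun_prop)
    fun_prop
  calc _ ≤ ∫⁻ z in Ioo (0:ℝ) 1 ×ˢ Ioo 0 (π / 2), Φ z := by
        have hI : MeasurableSet (Ioi (0:ℝ) ×ˢ Ioo 0 (π / 2)) := measurableSet_Ioi.prod measurableSet_Ioo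
        have hJ : MeasurableSet (Ioo (0:ℝ) 1 ×ˢ Ioo 0 (π / 2)) := measurableSet_Ioo.prod measurableSet_Ioo
        rw [← lintegral_indicator hI, ← lintegral_indicator hJ]
        refine lintegral_mono ?_
        rintro ⟨r, θ⟩
        by_cases hz : (r, θ) ∈ Ioi (0:ℝ) ×ˢ Ioo 0 (π / 2)
        · rw [indicator_of_mem hz]
          obtain ⟨hr0, ha, hb⟩ := hz
          simp only [mem_Ioi] at hr0 ha hb ⊢
          by_cases hr1 : r < 1
          · have hmem : (r * cos θ, r * sin θ) ∈ S := by
              simp only [S, mem_ofPred_eq]; rw [polar_sq]; nlinarith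
            have hmem2 : (r, θ) ∈ Ioo (0:ℝ) 1 ×ˢ Ioo 0 (π / 2) := ⟨⟨hr0, hr1⟩, ha, hb⟩
            have hcθ : 0 < cos θ := cos_pos_of_mem_Ioo ⟨by linarith, by linarith⟩
            have hsθ : 0 < sin θ := sin_pos_of_pos_of_lt_pi (by linarith) (by linarith)
            simp only [F, Φ]
            rw [indicator_of_mem hmem, indicator_of_mem hmem2, ← ENNReal.ofReal_mul (by positivity)]
            apply ENNReal.ofReal_le_ofReal
            simp only
            rw [polar_sq, Real.sqrt_sq hr0.le]
            have hle : (cos θ * sin θ) ^ (n - 1) ≤ 1 :=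
              pow_le_one₀ (by positivity) (mul_le_one₀ (cos_le_one θ) hsθ.le (sin_le_one θ))
            have hWn := h.nn (r * cos θ, r * sin θ)
            have hX : 0 ≤ W (r * cos θ, r * sin θ) ^ p * r ^ α * r ^ (2 * (n - 1) + 1) := by positivity
            calc _ = (W (r * cos θ, r * sin θ) ^ p * r ^ α * r ^ (2 * (n - 1) + 1)) *
                  (cos θ * sin θ) ^ (n - 1) := by ring
              _ ≤ _ := mul_le_of_le_one_right hX hle
          · have hmem : (r * cos θ, r * sin θ) ∉ S := by
              simp only [S, mem_ofPred_eq]; rw [polar_sq]; push Not at hr1 ⊢; nlinarith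
            simp only [F]
            rw [indicator_of_notMem hmem, mul_zero]; exact zero_le
        · rw [indicator_of_notMem hz]; exact zero_le
    _ = ∫⁻ r in Ioo (0:ℝ) 1, ∫⁻ θ in Ioo 0 (π / 2), Φ (r, θ) := by
        rw [Measure.volume_eq_prod, ← Measure.prod_restrict, lintegral_prod _ hΦ.aemeasurable]
    _ ≤ ∫⁻ r in Ioo (0:ℝ) 1, 4 * ∫⁻ θ in Ioo (π / 8) (π / 4), Φ (r, θ) := by
        refine setLIntegral_mono' measurableSet_Ioo fun r hr => angle_lemma (fun θ => Φ (r, θ)) ?_ ?_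
        · intro θ
          simp only [Φ]
          rw [cos_pi_div_two_sub, sin_pi_div_two_sub, h.symm]
        · intro x y h1 h2 h3
          apply ENNReal.ofReal_le_ofReal
          have := h.mono r hr x y h1 h2 h3
          have := h.nn (r * cos x, r * sin x)
          have := hr.1
          simp only
          gcongr
    _ = 4 * ∫⁻ z, Φ z ∂(rect (π / 8) (π / 4)) := by
        rw [lintegral_const_mul' _ _ (by simp), rect, lintegral_prod _ hΦ.aemeasurable]

lemma final_bound (n : ℕ) (hn : 2 ≤ n) (α p q : ℝ) (hα : 0 < α) (hp : 1 < p) (hpq : p ≤ q)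
    (hq : q * ((n - 1 : ℕ) : ℝ) = 2 * ((n - 1 : ℕ) : ℝ) + 2 + α) :
    ∃ K : ℝ, 0 < K ∧ ∀ u ∈ Kplus n (Metric.ball (0 : Euc (n + n)) 1), ∀ e : ℝ, 0 < e →
      (∫ x in Metric.ball (0 : Euc (n + n)) 1, ‖gradient u x‖ ^ 2) ≤ e ^ 2 →
      (∫ x in Metric.ball (0 : Euc (n + n)) 1, u x ^ p * ‖x‖ ^ α) ≤ K * e ^ p := by
  have hpi := pi_pos
  obtain ⟨k, hk⟩ := exists_nat_ge q
  have hm : 1 ≤ n - 1 := by omega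
  set m := n - 1 with hmdef
  have hab : π / 8 < π / 4 := by linarith
  obtain ⟨C1, hC1, H1⟩ := core m hm hab 0
  obtain ⟨Ck, hCk, Hk⟩ := core m hm hab k
  obtain ⟨CD, hCD, HD⟩ := D_bound n (by omega)
  obtain ⟨CU, hCU, HU⟩ := U_bound n (by omega)
  set M := (rect (π / 8) (π / 4)) univ with hM
  have hMt : M ≠ ⊤ := by
    rw [hM, rect, ← univ_prod_univ, Measure.prod_prod]
    exact ENNReal.mul_ne_top (measure_ne_top _ _) (measure_ne_top _ _)
  set K' : ENNReal := CU * (M + C1 * CD + Ck * CD ^ (k + 1)) with hK'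
  have hK't : K' ≠ ⊤ := by
    refine ENNReal.mul_ne_top hCU (ENNReal.add_ne_top.2 ⟨ENNReal.add_ne_top.2
      ⟨hMt, ENNReal.mul_ne_top hC1 hCD⟩, ENNReal.mul_ne_top hCk (ENNReal.pow_ne_top hCD)⟩)
  refine ⟨K'.toReal + 1, by positivity, fun u hu e he hE => ?_⟩
  obtain ⟨W, hW⟩ := exists_red n (by omega) u hu
  have hint := hu.1.2.2.2.1
  have hucont := hu.1.1
  have hu0 := hu.2.1
  have hP := hW.prof (π / 8) (π / 4)
  have hD := HD u W hW
  rw [← ofReal_integral_eq_lintegral_ofReal hint (Eventually.of_forall fun x => by positivity)] at hD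
  have hD' := hD.trans (mul_le_mul_right (ENNReal.ofReal_le_ofReal hE) CD)
  have h1 := H1 _ _ hP
  have hk' := Hk _ _ hP
  have hup := HU u W hW α p (by linarith) hα
  rw [← hmdef] at hD' hup
  set V : ℝ → ℝ → ℝ := fun r θ => W (r * cos θ, r * sin θ) with hV
  set D := Dint (π / 8) (π / 4) (fun r θ => ‖fderiv ℝ W (r * cos θ, r * sin θ)‖) m with hDdef
  have hpt : ∫⁻ z, ENNReal.ofReal (W (z.1 * cos z.2, z.1 * sin z.2) ^ p * z.1 ^ α * z.1 ^ (2 * m + 1))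
      ∂(rect (π / 8) (π / 4)) ≤ ENNReal.ofReal (e ^ p) * (M + C1 * CD + Ck * CD ^ (k + 1)) := by
    calc _ ≤ ∫⁻ z, ENNReal.ofReal (e ^ p) * (1 +
          ENNReal.ofReal ((e ^ 2)⁻¹) * ENNReal.ofReal (V z.1 z.2 ^ 2 * z.1 ^ (2 * m - 1)) +
          ENNReal.ofReal ((e ^ (2 * (k + 1)))⁻¹) *
            ENNReal.ofReal (V z.1 z.2 ^ (2 * (k + 1)) * z.1 ^ (2 * (k + 1) * m - 1)))
            ∂(rect (π / 8) (π / 4)) := by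
          refine lintegral_mono_ae ?_
          filter_upwards [Prof.ae_mem (π / 8) (π / 4)] with z hz
          have hr0 := hz.1.1
          have hVn : 0 ≤ V z.1 z.2 := hW.nn _
          have := ptw (k := k + 1) hm hα hp hpq hq (by push_cast; linarith) hz.1
            (y := V z.1 z.2 / e) (by positivity)
          rw [← ENNReal.ofReal_one, ← ENNReal.ofReal_mul (by positivity),
            ← ENNReal.ofReal_mul (by positivity), ← ENNReal.ofReal_add (by positivity) (by positivity),
            ← ENNReal.ofReal_add (by positivity) (by positivity), ← ENNReal.ofReal_mul (by positivity)]
          apply ENNReal.ofReal_le_ofReal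
          have h2 := mul_le_mul_of_nonneg_left this (by positivity : 0 ≤ e ^ p)
          have h3 : e ^ p * ((V z.1 z.2 / e) ^ p * z.1 ^ α * z.1 ^ (2 * m + 1)) =
              V z.1 z.2 ^ p * z.1 ^ α * z.1 ^ (2 * m + 1) := by
            rw [div_rpow hVn he.le]
            have : e ^ p ≠ 0 := by positivity
            field_simp
          rw [h3] at h2
          refine h2.trans (le_of_eq ?_)
          rw [div_pow, div_pow]
          ring
      _ = ENNReal.ofReal (e ^ p) * (M +
          ENNReal.ofReal ((e ^ 2)⁻¹) * Qint (π / 8) (π / 4) V 2 (2 * m - 1) +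
          ENNReal.ofReal ((e ^ (2 * (k + 1)))⁻¹) *
            Qint (π / 8) (π / 4) V (2 * (k + 1)) (2 * (k + 1) * m - 1)) := by
          have hm1 := hP.mQ 2 (2 * m - 1)
          have hm2 := hP.mQ (2 * (k + 1)) (2 * (k + 1) * m - 1)
          unfold Qint
          rw [lintegral_const_mul' _ _ (by simp),
            lintegral_add_left ((hm1.const_mul _).const_add _),
            lintegral_add_left measurable_const, lintegral_const_mul' _ _ (by simp),
            lintegral_const_mul' _ _ (by simp), lintegral_one]
      _ ≤ _ := by
          simp only [zero_add, mul_one, pow_one] at h1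
          gcongr ENNReal.ofReal (e ^ p) * (M + ?_ + ?_)
          · calc _ ≤ ENNReal.ofReal ((e ^ 2)⁻¹) * (C1 * (CD * ENNReal.ofReal (e ^ 2))) := by
                  gcongr; exact h1.trans (by gcongr)
              _ = (ENNReal.ofReal ((e ^ 2)⁻¹) * ENNReal.ofReal (e ^ 2)) * (C1 * CD) := by ring
              _ = _ := by
                  rw [← ENNReal.ofReal_mul (by positivity), inv_mul_cancel₀ (by positivity)]; simp
          · calc _ ≤ ENNReal.ofReal ((e ^ (2 * (k + 1)))⁻¹) *
                    (Ck * (CD * ENNReal.ofReal (e ^ 2)) ^ (k + 1)) := by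
                  gcongr; exact hk'.trans (by gcongr)
              _ = (ENNReal.ofReal ((e ^ (2 * (k + 1)))⁻¹) * ENNReal.ofReal (e ^ 2) ^ (k + 1)) *
                    (Ck * CD ^ (k + 1)) := by ring
              _ = _ := by
                  rw [← ENNReal.ofReal_pow (by positivity), ← ENNReal.ofReal_mul (by positivity),
                    ← pow_mul, inv_mul_cancel₀ (by positivity)]; simp
  have htot : ∫⁻ x in Metric.ball (0 : Euc (n + n)) 1, ENNReal.ofReal (u x ^ p * ‖x‖ ^ α) ≤
      K' * ENNReal.ofReal (e ^ p) := by
    refine hup.trans ?_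
    rw [hK', mul_assoc, mul_comm _ (ENNReal.ofReal (e ^ p))]
    gcongr
  rw [integral_eq_lintegral_of_nonneg_ae (Eventually.of_forall fun x => by
    have := hu0 x; simp only [Pi.zero_apply]; positivity) (by
      have := hucont.measurable
      exact Measurable.aestronglyMeasurable (by fun_prop))]
  calc _ ≤ (K' * ENNReal.ofReal (e ^ p)).toReal :=
        ENNReal.toReal_mono (ENNReal.mul_ne_top hK't (by simp)) htot
    _ = K'.toReal * e ^ p := by
        rw [ENNReal.toReal_mul, ENNReal.toReal_ofReal (by positivity)]
    _ ≤ _ := by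
        have : 0 < e ^ p := by positivity
        nlinarith

/-- Corollary 5.4: the continuous embedding
`K₊ ⊂ L^p(B₁, |x|^α dx)` for `N = 2n ≥ 4`, `α > 0` and `1 < p ≤ (2N+2α)/(N−2)`. -/
theorem statement11
    (n N : ℕ) (hn : 2 ≤ n) (hN : N = 2 * n)
    (B1 : Set (Euc N)) (hB1 : B1 = Metric.ball (0 : Euc N) 1)
    (α : ℝ) (hα : 0 < α)
    (p : ℝ) (hp1 : 1 < p) (hp2 : p ≤ (2 * N + 2 * α) / ((N : ℝ) - 2)) :
    ∃ C : ℝ, 0 < C ∧ ∀ u ∈ Kplus n B1,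
      (∫ x in B1, u x ^ p * ‖x‖ ^ α) ^ (1 / p) ≤
        C * (∫ x in B1, ‖gradient u x‖ ^ 2) ^ (1 / 2 : ℝ) := by
  have hN' : N = n + n := by omega
  subst hN' hB1
  have hn2 : (2:ℝ) ≤ n := by exact_mod_cast hn
  have hcast : ((n - 1 : ℕ) : ℝ) = n - 1 := by rw [Nat.cast_sub (by omega)]; simp
  obtain ⟨K, hK, H⟩ := final_bound n hn α p _ hα hp1 hp2 (by
    rw [hcast]; push_cast
    have h0 : (n:ℝ) - 1 ≠ 0 := ne_of_gt (by linarith)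
    rw [show (n:ℝ) + n - 2 = 2 * (n - 1) by ring, div_mul_eq_mul_div,
      div_eq_iff (mul_ne_zero two_ne_zero h0)]
    ring)
  have hC : 0 < K ^ (1 / p) := by positivity
  refine ⟨K ^ (1 / p), hC, fun u hu => ?_⟩
  set E := ∫ x in Metric.ball (0 : Euc (n + n)) 1, ‖gradient u x‖ ^ 2 with hE
  have hE0 : 0 ≤ E := integral_nonneg fun x => by positivity
  rw [← Real.sqrt_eq_rpow]
  refine le_of_forall_pos_le_add fun ε hε => ?_
  have hs := Real.sqrt_nonneg E
  have he : 0 < √E + ε / K ^ (1 / p) := by positivity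
  have h1 := H u hu (√E + ε / K ^ (1 / p)) he (by
    rw [← hE]
    calc E = √E ^ 2 := (Real.sq_sqrt hE0).symm
      _ ≤ _ := by gcongr; linarith [div_pos hε hC])
  have hu0 := hu.2.1
  have h2 := Real.rpow_le_rpow (integral_nonneg fun x => by
    have := hu0 x; simp only [Pi.zero_apply]; positivity) h1 (by positivity : 0 ≤ 1 / p)
  rw [Real.mul_rpow hK.le (by positivity), ← Real.rpow_mul he.le,
    mul_one_div_cancel (by linarith), Real.rpow_one, mul_add, mul_div_cancel₀ _ hC.ne'] at h2
  exact h2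

end
end
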